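/- (Identifiability of Gaussian moment secants.) Let n ≥ 2 and 5 ≤ d ≤ 9, and set N := n*(n+3)/2. For every m ≥ 1 with N * (m + 1 + N) ≤ choose (n+d−1) d, the Gaussian moment variety GM_d(ℂ^n) is m-identifiable. -/

import Mathlib

noncomputable section

open MvPolynomial

/-- The Zariski topology on a `ℂ`-vector space `M` (for finite-dimensional `M`,
identified with a coordinate space via a basis, this is the topology in which a set
is closed iff it is the common zero locus of a family of polynomial functions
of the coordinates). -/
def ztV (M : Type*) [AddCommGroup M] [Module ℂ M] : TopologicalSpace M :=
  TopologicalSpace.generateFrom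
    { U | ∃ (k : ℕ) (p : MvPolynomial (Fin k) ℂ) (L : Fin k → M →ₗ[ℂ] ℂ),
        U = { x | MvPolynomial.eval (fun i => L i x) p ≠ 0 } }

def zIsOpenV {M : Type*} [AddCommGroup M] [Module ℂ M] (S : Set M) : Prop :=
  @IsOpen _ (ztV M) S

def zClosureV {M : Type*} [AddCommGroup M] [Module ℂ M] (S : Set M) : Set M :=
  @closure _ (ztV M) S

/-- The topological Krull dimension of `S` (with the subspace Zariski topology):
the supremum of lengths of chains of irreducible closed subsets. -/
def zDimV {M : Type*} [AddCommGroup M] [Module ℂ M] (S : Set M) : WithBot ℕ∞ :=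
  @topologicalKrullDim ↥S (TopologicalSpace.induced Subtype.val (ztV M))

/-- The `m`-th secant variety: the Zariski closure of the set of sums of `m` points of `V`. -/
def secantV {M : Type*} [AddCommGroup M] [Module ℂ M] (m : ℕ) (V : Set M) : Set M :=
  zClosureV { p | ∃ x : Fin m → M, (∀ i, x i ∈ V) ∧ p = ∑ i, x i }

/-- `V` is `m`-identifiable: there is a dense open subset `O` of `σ_m V` such that every
`p ∈ O` is a sum of `m` points of `V`, uniquely up to a permutation of the summands. -/
def IsIdentifiableV {M : Type*} [AddCommGroup M] [Module ℂ M] (m : ℕ) (V : Set M) : Prop :=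
  ∃ O : Set M, O ⊆ secantV m V ∧
    (∃ U, zIsOpenV U ∧ O = U ∩ secantV m V) ∧
    secantV m V ⊆ zClosureV O ∧
    ∀ p ∈ O,
      (∃ x : Fin m → M, (∀ i, x i ∈ V) ∧ p = ∑ i, x i) ∧
      ∀ x y : Fin m → M, (∀ i, x i ∈ V) → (∀ i, y i ∈ V) →
        p = ∑ i, x i → p = ∑ i, y i →
          ∃ e : Equiv.Perm (Fin m), ∀ i, y i = x (e i)

/-- The degree-`d` homogeneous component of `exp(ℓ + q/2)`:
`s_d(ℓ, q) = ∑_{j=0}^{⌊d/2⌋} (1 / (2^j j! (d-2j)!)) • ℓ^(d-2j) q^j`. -/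
def sMoment (n d : ℕ) (ℓ q : MvPolynomial (Fin n) ℂ) : MvPolynomial (Fin n) ℂ :=
  ∑ j ∈ Finset.range (d / 2 + 1),
    ((1 : ℂ) / ((2 ^ j * Nat.factorial j * Nat.factorial (d - 2 * j) : ℕ) : ℂ)) •
      (ℓ ^ (d - 2 * j) * q ^ j)

/-- The Gaussian moment variety: the Zariski closure in `S^d_n` of the set of all
`s_d(ℓ, q)` with `ℓ` a linear form and `q` a quadratic form. -/
def GMVariety (n d : ℕ) : Set ↥(homogeneousSubmodule (Fin n) ℂ d) :=
  zClosureV { f | ∃ ℓ q : MvPolynomial (Fin n) ℂ,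
    ℓ ∈ homogeneousSubmodule (Fin n) ℂ 1 ∧ q ∈ homogeneousSubmodule (Fin n) ℂ 2 ∧
    (f : MvPolynomial (Fin n) ℂ) = sMoment n d ℓ q }

namespace GaussMoment

section Recursion
variable {A : Type*} [CommRing A] [Algebra ℂ A]

/-- The degree `k` part of `exp (l + q)`, when `l` has degree one and `q` degree two. -/
def expPart (l q : A) : ℕ → A
  | 0 => 1
  | 1 => l
  | k + 2 => ((k + 2 : ℂ)⁻¹) • (l * expPart l q (k + 1) + 2 * q * expPart l q k)

theorem expPart_zero (l q : A) : expPart l q 0 = 1 := by rw [expPart]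

theorem expPart_one (l q : A) : expPart l q 1 = l := by rw [expPart]

theorem expPart_rec (l q : A) (k : ℕ) :
    ((k : A) + 2) * expPart l q (k + 2) =
      l * expPart l q (k + 1) + 2 * q * expPart l q k := by
  have h : ((k : A) + 2) = algebraMap ℂ A (k + 2 : ℂ) := by
    rw [map_add, map_natCast, map_ofNat]
  have hk : (k + 2 : ℂ) ≠ 0 := by exact_mod_cast (by omega : k + 2 ≠ 0)
  rw [expPart, h, ← Algebra.smul_def, smul_smul, mul_inv_cancel₀ hk, one_smul]

theorem map_expPart {A' : Type*} [CommRing A'] [Algebra ℂ A'] (f : A →ₐ[ℂ] A') (l q : A) :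
    ∀ k, f (expPart l q k) = expPart (f l) (f q) k
  | 0 => by simp [expPart_zero]
  | 1 => by simp [expPart_one]
  | k + 2 => by
    rw [expPart, expPart, map_smul, map_add, map_mul, map_mul, map_mul,
      map_expPart f l q (k + 1), map_expPart f l q k, map_ofNat]

theorem isUnit_natCast_add_two (k : ℕ) : IsUnit ((k : A) + 2) := by
  have h : ((k : A) + 2) = algebraMap ℂ A (k + 2 : ℂ) := by
    rw [map_add, map_natCast, map_ofNat]
  rw [h]
  exact (IsUnit.mk0 _ (by exact_mod_cast (by omega : k + 2 ≠ 0))).map _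

/-- The chain rule for an additive map satisfying the Leibniz rule. -/
theorem leibniz_expPart (δ : A →ₗ[ℂ] A) (hδ : ∀ a b, δ (a * b) = δ a * b + a * δ b) (l q : A) :
    ∀ k, δ (expPart l q (k + 2)) = δ l * expPart l q (k + 1) + δ q * expPart l q k := by
  have h1 : δ 1 = 0 := by simpa using hδ 1 1
  have h2 : δ 2 = 0 := by
    rw [show (2 : A) = 1 + 1 by norm_num, map_add, h1, add_zero]
  intro k
  induction k using Nat.strong_induction_on with
  | _ k ih =>
    have key : (k + 2 : ℂ) • δ (expPart l q (k + 2)) =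
        (k + 2 : ℂ) • (δ l * expPart l q (k + 1) + δ q * expPart l q k) := by
      have e : (k + 2 : ℂ) • expPart l q (k + 2) =
          l * expPart l q (k + 1) + 2 * q * expPart l q k := by
        rw [← expPart_rec, Algebra.smul_def, map_add, map_natCast, map_ofNat]
      rw [← map_smul, e, map_add, hδ, hδ, hδ, h2, Algebra.smul_def]
      simp only [map_add, map_natCast, map_ofNat]
      match k, ih with
      | 0, _ =>
        simp only [expPart_one, expPart_zero, h1, zero_add, Nat.cast_zero]; ring
      | 1, ih =>
        rw [ih 0 (by omega)]
        have := expPart_rec l q 0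
        simp only [zero_add, expPart_one, expPart_zero, Nat.cast_one, Nat.cast_zero] at this ⊢
        linear_combination (- δ l) * this
      | k + 2, ih =>
        rw [show k + 2 + 1 = (k + 1) + 2 by ring, ih (k + 1) (by omega), ih k (by omega)]
        have h3 := expPart_rec l q (k + 1)
        have h4 := expPart_rec l q k
        simp only [show k + 1 + 1 = k + 2 by ring, show k + 1 + 2 = k + 3 by ring] at h3 h4 ⊢
        push_cast at h3 h4 ⊢
        linear_combination (-δ l) * h3 - δ q * h4
    have hk : (k + 2 : ℂ) ≠ 0 := by exact_mod_cast (by omega : k + 2 ≠ 0)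
    have := congrArg (fun z => (k + 2 : ℂ)⁻¹ • z) key
    simpa only [smul_smul, inv_mul_cancel₀ hk, one_smul] using this

end Recursion

section Homogeneous
variable {n : ℕ} {F : Type*} [Field F]

theorem homogeneousComponent_mul_of_isHomogeneous {i : ℕ} {a : MvPolynomial (Fin n) F}
    (ha : a.IsHomogeneous i) (b : MvPolynomial (Fin n) F) (j : ℕ) :
    homogeneousComponent (i + j) (a * b) = a * homogeneousComponent j b := by
  classical
  conv_lhs => rw [← sum_homogeneousComponent b, Finset.mul_sum, map_sum]
  have h : ∀ k, homogeneousComponent (i + j) (a * homogeneousComponent k b) =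
      if k = j then a * homogeneousComponent k b else 0 := by
    intro k
    rw [homogeneousComponent_of_mem
      ((mem_homogeneousSubmodule _ _).2 (ha.mul (homogeneousComponent_isHomogeneous k b)))]
    simp [eq_comm]
  rw [Finset.sum_congr rfl fun k _ => h k, Finset.sum_ite_eq']
  split_ifs with hj
  · rfl
  · rw [homogeneousComponent_eq_zero _ _ (by simpa using hj), mul_zero]

theorem exists_isHomogeneous_of_dvd {i j : ℕ} {p g : MvPolynomial (Fin n) F}
    (hp : p.IsHomogeneous i) (hg : g.IsHomogeneous (i + j)) (h : p ∣ g) :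
    ∃ c : MvPolynomial (Fin n) F, c.IsHomogeneous j ∧ g = p * c := by
  obtain ⟨c, rfl⟩ := h
  refine ⟨homogeneousComponent j c, homogeneousComponent_isHomogeneous _ _, ?_⟩
  rw [← homogeneousComponent_mul_of_isHomogeneous hp, homogeneousComponent_eq_self hg]

theorem eq_zero_of_dvd_of_lt {i j : ℕ} {p g : MvPolynomial (Fin n) F}
    (hp : p.IsHomogeneous i) (hg : g.IsHomogeneous j) (hij : j < i) (h : p ∣ g) : g = 0 := by
  obtain ⟨c, rfl⟩ := h
  by_contra hne
  have hp0 : p ≠ 0 := left_ne_zero_of_mul hne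
  have hc0 : c ≠ 0 := right_ne_zero_of_mul hne
  have h1 := hg.totalDegree hne
  rw [totalDegree_mul_of_isDomain hp0 hc0, hp.totalDegree hp0] at h1
  omega

theorem exists_C_of_isHomogeneous_zero {p : MvPolynomial (Fin n) F} (hp : p.IsHomogeneous 0) :
    ∃ c : F, p = C c := by
  refine ⟨coeff 0 p, ?_⟩
  rw [← homogeneousComponent_zero, homogeneousComponent_eq_self hp]

theorem isHomogeneous_expPart [Algebra ℂ F] {l q : MvPolynomial (Fin n) F} (hl : l.IsHomogeneous 1)
    (hq : q.IsHomogeneous 2) : ∀ k, (expPart l q k).IsHomogeneous k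
  | 0 => by rw [expPart_zero]; exact isHomogeneous_one _ _
  | 1 => by rwa [expPart_one]
  | k + 2 => by
    rw [expPart, Algebra.smul_def, IsScalarTower.algebraMap_apply ℂ F, algebraMap_eq]
    refine IsHomogeneous.C_mul ?_ _
    have h1 := hl.mul (isHomogeneous_expPart hl hq (k + 1))
    have h2 := (hq.mul (isHomogeneous_expPart hl hq k)).C_mul 2
    rw [show 1 + (k + 1) = k + 2 by ring] at h1
    rw [show 2 + k = k + 2 by ring, map_ofNat, ← mul_assoc] at h2
    exact h1.add h2

end Homogeneous

section BasePoint
variable {n : ℕ} {F : Type*} [Field F]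

/-- A pair of a linear and a quadratic form cutting out an integral scheme of codimension two. -/
structure IsGeneralPair (l q : MvPolynomial (Fin n) F) : Prop where
  hl : l.IsHomogeneous 1
  hq : q.IsHomogeneous 2
  prime_l : Prime l
  isPrime_span : (Ideal.span {l, q}).IsPrime
  not_dvd : ¬ l ∣ q
  exists_X : ∃ i, ¬ l ∣ X i

namespace IsGeneralPair
variable {l q : MvPolynomial (Fin n) F}

theorem not_isUnit_q (h : IsGeneralPair l q) : ¬ IsUnit q := fun hu =>
  h.isPrime_span.ne_top
    (Ideal.eq_top_of_isUnit_mem _ (Ideal.subset_span (by simp : q ∈ ({l, q} : Set _))) hu)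

theorem eq_of_mem_span (h : IsGeneralPair l q) {b : MvPolynomial (Fin n) F}
    (hb : b.IsHomogeneous 2) (hm : b ∈ Ideal.span {l, q}) :
    ∃ (k : MvPolynomial (Fin n) F) (c : F), k.IsHomogeneous 1 ∧ b = l * k + C c * q := by
  obtain ⟨f, g, rfl⟩ := Ideal.mem_span_pair.1 hm
  obtain ⟨c, hc⟩ := exists_C_of_isHomogeneous_zero (homogeneousComponent_isHomogeneous 0 g)
  refine ⟨homogeneousComponent 1 f, c, homogeneousComponent_isHomogeneous 1 f, ?_⟩
  rw [← homogeneousComponent_eq_self hb, map_add, mul_comm f, mul_comm g,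
    show 2 = 1 + 1 from rfl, homogeneousComponent_mul_of_isHomogeneous h.hl,
    show 1 + 1 = 2 + 0 from rfl, homogeneousComponent_mul_of_isHomogeneous h.hq, hc, mul_comm q]

theorem eq_of_mem_span_one (h : IsGeneralPair l q) {a : MvPolynomial (Fin n) F}
    (ha : a.IsHomogeneous 1) (hm : a ∈ Ideal.span {l, q}) : ∃ c : F, a = C c * l := by
  obtain ⟨f, g, hfg⟩ := Ideal.mem_span_pair.1 hm
  obtain ⟨i, hi⟩ := h.exists_X
  obtain ⟨c, hc⟩ := exists_C_of_isHomogeneous_zero (homogeneousComponent_isHomogeneous 0 f)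
  refine ⟨c, ?_⟩
  have h0 : homogeneousComponent 1 (q * g) = 0 := by
    by_cases hg : q * g = 0
    · rw [hg, map_zero]
    · rw [homogeneousComponent_eq_zero']
      intro e he h1
      have : coeff e (q * g) = 0 := by
        rw [coeff_mul]
        refine Finset.sum_eq_zero fun x hx => ?_
        have hx' : x.1 + x.2 = e := by simpa using hx
        have : x.1.degree ≠ 2 := by
          rw [← hx', map_add] at h1; omega
        rw [h.hq.coeff_eq_zero this, zero_mul]
      exact (mem_support_iff.1 he) this
  rw [← homogeneousComponent_eq_self ha, ← hfg, map_add, mul_comm g, h0, add_zero, mul_comm f,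
    show 1 = 1 + 0 from rfl, homogeneousComponent_mul_of_isHomogeneous h.hl, hc, mul_comm]

theorem X_notMem (h : IsGeneralPair l q) {i : Fin n} (hi : ¬ l ∣ X i) :
    (X i : MvPolynomial (Fin n) F) ∉ Ideal.span {l, q} := by
  intro hm
  obtain ⟨c, hc⟩ := h.eq_of_mem_span_one (isHomogeneous_X F i) hm
  exact hi ⟨C c, by rw [hc, mul_comm]⟩

variable [Algebra ℂ F]

theorem isRelPrime_expPart_q (h : IsGeneralPair l q) : ∀ k, IsRelPrime (expPart l q k) q
  | 0 => by rw [expPart_zero]; exact isRelPrime_one_left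
  | 1 => by
    rw [expPart_one]
    exact (h.prime_l.irreducible.isRelPrime_iff_not_dvd).2 h.not_dvd
  | k + 2 => by
    have h1 := ((isRelPrime_expPart_q h 1).mul_left (isRelPrime_expPart_q h (k + 1)))
    rw [expPart_one] at h1
    refine (isRelPrime_mul_unit_left_left (isUnit_natCast_add_two k)).1 ?_
    rw [expPart_rec, show 2 * q * expPart l q k = q * (2 * expPart l q k) by ring]
    exact IsRelPrime.of_add_mul_left_left (z := - (2 * expPart l q k)) (by simpa using h1)

theorem isRelPrime_expPart_succ (h : IsGeneralPair l q) :
    ∀ k, IsRelPrime (expPart l q k) (expPart l q (k + 1))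
  | 0 => by rw [expPart_zero]; exact isRelPrime_one_left
  | k + 1 => by
    refine (isRelPrime_mul_unit_left_right (isUnit_natCast_add_two k)).1 ?_
    rw [expPart_rec]
    have h2 : IsUnit (2 : MvPolynomial (Fin n) F) := by
      simpa using isUnit_natCast_add_two (A := MvPolynomial (Fin n) F) 0
    have h1 : IsRelPrime (expPart l q (k + 1)) (2 * q * expPart l q k) :=
      ((h2.isRelPrime_right).mul_right (isRelPrime_expPart_q h (k + 1))).mul_right
        (isRelPrime_expPart_succ h k).symm
    refine IsRelPrime.of_add_mul_left_right (z := -l) ?_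
    convert h1 using 1
    ring

theorem expPart_ne_zero (h : IsGeneralPair l q) (k : ℕ) : expPart l q k ≠ 0 := fun h0 => by
  have := h.isRelPrime_expPart_q k
  rw [h0, isRelPrime_zero_left] at this
  exact h.not_isUnit_q this

theorem eq_zero_of_tangent_eq_zero (h : IsGeneralPair l q) {r : ℕ} {a b : MvPolynomial (Fin n) F}
    (hb : b.IsHomogeneous 2)
    (hab : a * expPart l q (r + 3) + b * expPart l q (r + 2) = 0) : a = 0 ∧ b = 0 := by
  have h1 : expPart l q (r + 3) ∣ b * expPart l q (r + 2) :=
    ⟨-a, by linear_combination hab⟩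
  have h2 := (h.isRelPrime_expPart_succ (r + 2)).symm.dvd_of_dvd_mul_right h1
  have h3 := eq_zero_of_dvd_of_lt (isHomogeneous_expPart h.hl h.hq (r + 3)) hb (by omega) h2
  subst h3
  simpa [h.expPart_ne_zero] using hab

theorem expPart_succ_mem (l q : MvPolynomial (Fin n) F) :
    ∀ k, expPart l q (k + 1) ∈ Ideal.span {l, q}
  | 0 => by rw [expPart_one]; exact Ideal.subset_span (by simp)
  | k + 1 => by
    have hl : l ∈ Ideal.span {l, q} := Ideal.subset_span (by simp)
    have hq : q ∈ Ideal.span {l, q} := Ideal.subset_span (by simp)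
    have h1 : ((k : MvPolynomial (Fin n) F) + 2) * expPart l q (k + 2) ∈ Ideal.span {l, q} := by
      rw [expPart_rec]
      refine Ideal.add_mem _ (Ideal.mul_mem_right _ _ hl) (Ideal.mul_mem_right _ _ ?_)
      exact Ideal.mul_mem_left _ _ hq
    exact (Ideal.unit_mul_mem_iff_mem _ (isUnit_natCast_add_two k)).1 h1

theorem eq_of_sq_mem_tangent (h : IsGeneralPair l q) {r : ℕ} {a b a' b' : MvPolynomial (Fin n) F}
    (hb : b.IsHomogeneous 2)
    (hB : a * a * expPart l q (r + 2) + (a * b + a * b) * expPart l q (r + 1) +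
      b * b * expPart l q r = a' * expPart l q (r + 3) + b' * expPart l q (r + 2)) :
    ∃ (k : MvPolynomial (Fin n) F) (c : F), k.IsHomogeneous 1 ∧ b = l * k + C c * q := by
  apply h.eq_of_mem_span hb
  have e1 := expPart_rec l q r
  have e2 := expPart_rec l q (r + 1)
  simp only [show r + 1 + 1 = r + 2 by ring, show r + 1 + 2 = r + 3 by ring] at e2
  push_cast at e2
  set s0 := expPart l q r
  set s1 := expPart l q (r + 1) with hs1
  set s2 := expPart l q (r + 2) with hs2
  set s3 := expPart l q (r + 3)
  set Q := 2 * q * (r + 3) * a ^ 2 + (r + 3) * (r + 2) * b ^ 2 - 2 * q * a' * l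
    - 2 * q * (r + 3) * b' with hQ
  have h1 : s1 ∣ Q * s2 := by
    refine ⟨-(2 * q * (r + 3) * (2 * a * b) - (r + 3) * b ^ 2 * l - 4 * q ^ 2 * a'), ?_⟩
    rw [hQ]
    linear_combination 2 * q * (r + 3) * hB + (r + 3) * b ^ 2 * e1 + 2 * q * a' * e2
  have h2 : s1 ∣ Q := (h.isRelPrime_expPart_succ (r + 1)).dvd_of_dvd_mul_right h1
  have hq : q ∈ Ideal.span {l, q} := Ideal.subset_span (by simp)
  have h3 : Q ∈ Ideal.span {l, q} := Ideal.mem_of_dvd _ h2 (expPart_succ_mem l q r)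
  have h4 : ((r : MvPolynomial (Fin n) F) + 3) * (r + 2) * b ^ 2 ∈ Ideal.span {l, q} := by
    have : ((r : MvPolynomial (Fin n) F) + 3) * (r + 2) * b ^ 2 =
        Q - q * (2 * (r + 3) * a ^ 2 - 2 * a' * l - 2 * (r + 3) * b') := by rw [hQ]; ring
    rw [this]
    exact Ideal.sub_mem _ h3 (Ideal.mul_mem_right _ _ hq)
  have hu : IsUnit (((r : MvPolynomial (Fin n) F) + 3) * (r + 2)) := by
    refine IsUnit.mul ?_ (isUnit_natCast_add_two r)
    have := isUnit_natCast_add_two (A := MvPolynomial (Fin n) F) (r + 1)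
    convert this using 1
    push_cast; ring
  exact h.isPrime_span.mem_of_pow_mem 2 ((Ideal.unit_mul_mem_iff_mem _ hu).1 h4)

/-- Cubics whose product with `s_{r+1}` is tangent lie in the span of multiples of `q`
and of `l ^ 3`. -/
theorem eq_of_cubic_mul_mem_tangent (h : IsGeneralPair l q) {r : ℕ} (hr : 1 ≤ r)
    {P a' b' : MvPolynomial (Fin n) F} (ha' : a'.IsHomogeneous 1) (hb' : b'.IsHomogeneous 2)
    (hP : P * expPart l q (r + 1) = a' * expPart l q (r + 3) + b' * expPart l q (r + 2)) :
    ∃ (k : MvPolynomial (Fin n) F) (c : F), k.IsHomogeneous 1 ∧ P = k * q + C c * l ^ 3 := by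
  have e2 := expPart_rec l q (r + 1)
  simp only [show r + 1 + 1 = r + 2 by ring, show r + 1 + 2 = r + 3 by ring] at e2
  push_cast at e2
  obtain ⟨u, hu⟩ := isUnit_natCast_add_two (A := F) (r + 1)
  have hu3 : (C (u : F) : MvPolynomial (Fin n) F) = r + 1 + 2 := by rw [hu]; simp [map_ofNat C 2]
  have hv : (C (u : F) : MvPolynomial (Fin n) F) * C ((u : F)⁻¹) = 1 := by
    rw [← C_mul, mul_inv_cancel₀ u.ne_zero, C_1]
  set v := (C ((u : F)⁻¹) : MvPolynomial (Fin n) F) with hvdef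
  rw [← hu3] at e2
  have hs := isHomogeneous_expPart h.hl h.hq (r + 1)
  have hrp := h.isRelPrime_expPart_succ (r + 1)
  have hne2 := h.expPart_ne_zero (r + 2)
  have hne1 := h.expPart_ne_zero (r + 1)
  have hG : (v * (a' * l) + b').IsHomogeneous 2 :=
    (IsHomogeneous.C_mul (ha'.mul h.hl) _).add hb'
  have hk : (v * 2 * a').IsHomogeneous 1 := by
    rw [mul_assoc]
    refine IsHomogeneous.C_mul ?_ _
    rw [← map_ofNat C 2]
    exact IsHomogeneous.C_mul ha' _
  have key : expPart l q (r + 1) * (P - 2 * q * v * a') =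
      (v * (a' * l) + b') * expPart l q (r + 2) := by
    linear_combination hP + v * a' * e2 - a' * expPart l q (r + 3) * hv
  have hd : expPart l q (r + 1) ∣ v * (a' * l) + b' :=
    hrp.dvd_of_dvd_mul_right ⟨_, key.symm⟩
  obtain ⟨c, hc, hcC⟩ : ∃ c : F, v * (a' * l) + b' = C c * expPart l q (r + 1) ∧
      (c = 0 ∨ r = 1) := by
    rcases Nat.lt_or_ge 1 r with h1 | h1
    · exact ⟨0, by rw [eq_zero_of_dvd_of_lt hs hG (by omega) hd]; simp, Or.inl rfl⟩
    · obtain rfl : r = 1 := by omega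
      obtain ⟨g, hg, hg'⟩ := exists_isHomogeneous_of_dvd (j := 0) hs (by simpa using hG) hd
      obtain ⟨c, rfl⟩ := exists_C_of_isHomogeneous_zero hg
      exact ⟨c, by rw [hg', mul_comm], Or.inr rfl⟩
  have hPc : P - 2 * q * v * a' = C c * expPart l q (r + 2) := by
    apply mul_left_cancel₀ hne1
    rw [key, hc]; ring
  rcases hcC with rfl | rfl
  · refine ⟨v * 2 * a', 0, hk, ?_⟩
    rw [C_0, zero_mul] at hPc ⊢
    linear_combination hPc
  · have r0 := expPart_rec l q 0
    have r1 := expPart_rec l q 1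
    simp only [zero_add, expPart_one, expPart_zero, Nat.cast_zero, mul_one, Nat.cast_one] at r0 r1
    have h2 : (C (1 / 2 : F) : MvPolynomial (Fin n) F) * 2 = 1 := by
      rw [← map_ofNat C 2, ← C_mul]
      have : CharZero F := charZero_of_injective_algebraMap (algebraMap ℂ F).injective
      simp
    have h3 : (C (1 / 3 : F) : MvPolynomial (Fin n) F) * 3 = 1 := by
      rw [← map_ofNat C 3, ← C_mul]
      have : CharZero F := charZero_of_injective_algebraMap (algebraMap ℂ F).injective
      simp
    refine ⟨v * 2 * a' + C (c * (1 / 3) * (2 + 1)) * l, c * (1 / 3) * (1 / 2),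
      hk.add (IsHomogeneous.C_mul h.hl _), ?_⟩
    simp only [C_mul, C_add, map_ofNat, C_1] at hPc ⊢
    have e3 : expPart l q 3 =
        C (1 / 3 : F) * (l * (C (1 / 2 : F) * (l ^ 2 + 2 * q)) + 2 * q * l) := by
      have : expPart l q 2 = C (1 / 2 : F) * (l ^ 2 + 2 * q) := by
        linear_combination C (1 / 2 : F) * r0 - expPart l q 2 * h2
      rw [this] at r1
      linear_combination C (1 / 3 : F) * r1 - expPart l q 3 * h3
    rw [e3] at hPc
    linear_combination hPc + C c * C (1 / 3 : F) * l * q * h2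

theorem eq_zero_of_forall_mem_tangent (h : IsGeneralPair l q) {r : ℕ} (hr : 1 ≤ r)
    {a k : MvPolynomial (Fin n) F} (ha : a.IsHomogeneous 1) (hk : k.IsHomogeneous 1)
    (h1 : ∀ i, ∃ a' b' : MvPolynomial (Fin n) F, a'.IsHomogeneous 1 ∧ b'.IsHomogeneous 2 ∧
      a * X i * expPart l q (r + 2) + l * k * X i * expPart l q (r + 1) =
        a' * expPart l q (r + 3) + b' * expPart l q (r + 2))
    (h2 : ∀ i, ∃ a' b' : MvPolynomial (Fin n) F, a'.IsHomogeneous 1 ∧ b'.IsHomogeneous 2 ∧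
      a * X i ^ 2 * expPart l q (r + 1) + l * k * X i ^ 2 * expPart l q r =
        a' * expPart l q (r + 3) + b' * expPart l q (r + 2)) :
    a = 0 ∧ k = 0 := by
  obtain ⟨i, hi⟩ := h.exists_X
  have hl0 := h.prime_l.ne_zero
  have hlq : ∀ c : F, l ∣ C c * q → c = 0 := by
    intro c hc
    by_contra hne
    refine h.not_dvd ((h.prime_l.dvd_or_dvd hc).resolve_left fun hd => ?_)
    exact h.prime_l.not_isUnit (isUnit_of_dvd_unit hd ((isUnit_iff_ne_zero.2 hne).map C))
  have hlX : ∀ c : F, l ∣ C c * X i → c = 0 := by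
    intro c hc
    by_contra hne
    refine hi ((h.prime_l.dvd_or_dvd hc).resolve_left fun hd => ?_)
    exact h.prime_l.not_isUnit (isUnit_of_dvd_unit hd ((isUnit_iff_ne_zero.2 hne).map C))
  have hk0 : k = 0 := by
    obtain ⟨a', b', ha', hb', e⟩ := h1 i
    obtain ⟨g, c, hg, hgc⟩ := h.eq_of_cubic_mul_mem_tangent (P := l * k * X i) hr ha'
      (b' := b' - a * X i) (hb'.sub (ha.mul (isHomogeneous_X F i))) (by linear_combination e)
    have hlg : l ∣ g := by
      refine (h.prime_l.dvd_or_dvd (?_ : l ∣ g * q)).resolve_right h.not_dvd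
      exact ⟨k * X i - C c * l ^ 2, by linear_combination -hgc⟩
    obtain ⟨g', hg', rfl⟩ := exists_isHomogeneous_of_dvd (j := 0) h.hl hg hlg
    obtain ⟨c2, rfl⟩ := exists_C_of_isHomogeneous_zero hg'
    have e2 : k * X i = C c2 * q + C c * l ^ 2 := by
      apply mul_left_cancel₀ hl0
      linear_combination hgc
    have hkm : k * X i ∈ Ideal.span {l, q} := by
      rw [e2]
      refine Ideal.add_mem _ (Ideal.mul_mem_left _ _ (Ideal.subset_span (by simp))) ?_
      exact Ideal.mul_mem_left _ _ (Ideal.pow_mem_of_mem _ (Ideal.subset_span (by simp)) 2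
        (by omega))
    obtain ⟨c3, rfl⟩ := h.eq_of_mem_span_one hk
      ((h.isPrime_span.mem_or_mem hkm).resolve_right (h.X_notMem hi))
    have hc2 : c2 = 0 := hlq c2 ⟨C c3 * X i - C c * l, by linear_combination -e2⟩
    rw [hc2, C_0, zero_mul, zero_add] at e2
    have hc3 : c3 = 0 := hlX c3 ⟨C c, by
      apply mul_left_cancel₀ hl0
      linear_combination e2⟩
    rw [hc3, C_0, zero_mul]
  refine ⟨?_, hk0⟩
  obtain ⟨a', b', ha', hb', e⟩ := h2 i
  obtain ⟨g, c, hg, hgc⟩ := h.eq_of_cubic_mul_mem_tangent (P := a * X i ^ 2) hr ha' hb'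
    (by rw [hk0] at e; linear_combination e)
  have hm : a * X i ^ 2 ∈ Ideal.span {l, q} := by
    rw [hgc]
    refine Ideal.add_mem _ (Ideal.mul_mem_left _ _ (Ideal.subset_span (by simp))) ?_
    exact Ideal.mul_mem_left _ _ (Ideal.pow_mem_of_mem _ (Ideal.subset_span (by simp)) 3
      (by omega))
  have hX2 : (X i : MvPolynomial (Fin n) F) ^ 2 ∉ Ideal.span {l, q} := fun hX =>
    h.X_notMem hi (h.isPrime_span.mem_of_pow_mem 2 hX)
  obtain ⟨c3, rfl⟩ := h.eq_of_mem_span_one ha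
    ((h.isPrime_span.mem_or_mem hm).resolve_right hX2)
  have hlg : l ∣ g := by
    refine (h.prime_l.dvd_or_dvd (?_ : l ∣ g * q)).resolve_right h.not_dvd
    exact ⟨C c3 * X i ^ 2 - C c * l ^ 2, by linear_combination -hgc⟩
  obtain ⟨g', hg', rfl⟩ := exists_isHomogeneous_of_dvd (j := 0) h.hl hg hlg
  have e2 : C c3 * X i ^ 2 = g' * q + C c * l ^ 2 := by
    apply mul_left_cancel₀ hl0
    linear_combination hgc
  have hm2 : C c3 * X i ^ 2 ∈ Ideal.span {l, q} := by
    rw [e2]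
    refine Ideal.add_mem _ (Ideal.mul_mem_left _ _ (Ideal.subset_span (by simp))) ?_
    exact Ideal.mul_mem_left _ _ (Ideal.pow_mem_of_mem _ (Ideal.subset_span (by simp)) 2
      (by omega))
  have hc3 : c3 = 0 := by
    by_contra hne
    exact h.isPrime_span.ne_top (Ideal.eq_top_of_isUnit_mem _
      ((h.isPrime_span.mem_or_mem hm2).resolve_right hX2) ((isUnit_iff_ne_zero.2 hne).map C))
  rw [hc3, C_0, zero_mul]

end IsGeneralPair
end BasePoint

section Coordinates

/-- Exponents of the monomials of degree `k` in `n` variables. -/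
abbrev Mon (n k : ℕ) : Type := {e : Fin n →₀ ℕ // e.degree = k}

/-- Exponents of degree `k` are multisets of cardinality `k`. -/
def monEquivSym (n k : ℕ) : Mon n k ≃ Sym (Fin n) k :=
  (Multiset.toFinsupp (α := Fin n)).symm.toEquiv.subtypeEquiv fun e => by
    change e.degree = k ↔ Multiset.card (Finsupp.toMultiset e) = k
    rw [Finsupp.card_toMultiset, Finsupp.degree_apply]
    rfl

instance (n k : ℕ) : Fintype (Mon n k) := Fintype.ofEquiv _ (monEquivSym n k).symm

theorem card_mon (n k : ℕ) : Fintype.card (Mon n k) = (n + k - 1).choose k := by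
  rw [Fintype.card_congr (monEquivSym n k), Sym.card_sym_eq_choose, Fintype.card_fin]

/-- The index set of the coordinates of a pair of a linear and a quadratic form. -/
abbrev Coord (n : ℕ) : Type := Mon n 1 ⊕ Mon n 2

theorem card_coord (n : ℕ) : Fintype.card (Coord n) = n * (n + 3) / 2 := by
  rw [Fintype.card_sum, card_mon, card_mon]
  simp only [Nat.add_sub_cancel, Nat.choose_one_right, Nat.choose_two_right]
  rw [show n + 2 - 1 = n + 1 by omega, Nat.add_sub_cancel]
  have h1 : n * (n + 3) = n * 2 + (n + 1) * n := by ring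
  omega

variable {n : ℕ} {F : Type*} [CommRing F]

/-- The form of degree `k` with given coefficients. -/
def form (n k : ℕ) (F : Type*) [CommRing F] : (Mon n k → F) →ₗ[F] MvPolynomial (Fin n) F :=
  ∑ e : Mon n k, (monomial e.1).comp (LinearMap.proj e)

/-- The coefficients in degree `k`. -/
def coeffs (n k : ℕ) (F : Type*) [CommRing F] : MvPolynomial (Fin n) F →ₗ[F] (Mon n k → F) :=
  LinearMap.pi fun e => lcoeff F e.1

theorem coeffs_apply {k : ℕ} (p : MvPolynomial (Fin n) F) (e : Mon n k) :
    coeffs n k F p e = coeff e.1 p := rfl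

theorem form_apply {k : ℕ} (u : Mon n k → F) :
    form n k F u = ∑ e : Mon n k, monomial e.1 (u e) := by
  simp [form]

theorem isHomogeneous_form {k : ℕ} (u : Mon n k → F) : (form n k F u).IsHomogeneous k := by
  rw [form_apply]
  exact IsHomogeneous.sum _ _ _ fun e _ => isHomogeneous_monomial _ e.2

theorem coeff_form {k : ℕ} (u : Mon n k → F) (e : Mon n k) : coeff e.1 (form n k F u) = u e := by
  classical
  rw [form_apply, coeff_sum, Finset.sum_eq_single e]
  · simp
  · intro e' _ h
    rw [coeff_monomial, if_neg fun h' => h (Subtype.ext h')]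
  · simp

theorem coeffs_form {k : ℕ} (u : Mon n k → F) : coeffs n k F (form n k F u) = u :=
  funext fun e => coeff_form u e

theorem ext_of_isHomogeneous {k : ℕ} {p p' : MvPolynomial (Fin n) F} (hp : p.IsHomogeneous k)
    (hp' : p'.IsHomogeneous k) (h : coeffs n k F p = coeffs n k F p') : p = p' := by
  ext e
  by_cases he : e.degree = k
  · exact congrFun h ⟨e, he⟩
  · rw [hp.coeff_eq_zero he, hp'.coeff_eq_zero he]

theorem form_coeffs {k : ℕ} {p : MvPolynomial (Fin n) F} (hp : p.IsHomogeneous k) :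
    form n k F (coeffs n k F p) = p :=
  ext_of_isHomogeneous (isHomogeneous_form _) hp (coeffs_form _)

theorem map_form {F' : Type*} [CommRing F'] (f : F →+* F') {k : ℕ} (u : Mon n k → F) :
    map f (form n k F u) = form n k F' (fun e => f (u e)) := by
  simp [form_apply, map_monomial]

theorem coeffs_map {F' : Type*} [CommRing F'] (f : F →+* F') {k : ℕ}
    (p : MvPolynomial (Fin n) F) :
    coeffs n k F' (map f p) = fun e => f (coeffs n k F p e) := by
  ext e; simp [coeffs_apply, coeff_map]

/-- The linear form of a point. -/
def lin (n : ℕ) (F : Type*) [CommRing F] : (Coord n → F) →ₗ[F] MvPolynomial (Fin n) F :=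
  (form n 1 F).comp (LinearMap.funLeft F F Sum.inl)

/-- The quadratic form of a point. -/
def quad (n : ℕ) (F : Type*) [CommRing F] : (Coord n → F) →ₗ[F] MvPolynomial (Fin n) F :=
  (form n 2 F).comp (LinearMap.funLeft F F Sum.inr)

/-- The point with given linear and quadratic form. -/
def point (a b : MvPolynomial (Fin n) F) : Coord n → F :=
  Sum.elim (coeffs n 1 F a) (coeffs n 2 F b)

theorem isHomogeneous_lin (u : Coord n → F) : (lin n F u).IsHomogeneous 1 := isHomogeneous_form _

theorem isHomogeneous_quad (u : Coord n → F) : (quad n F u).IsHomogeneous 2 :=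
  isHomogeneous_form _

theorem lin_point {a b : MvPolynomial (Fin n) F} (ha : a.IsHomogeneous 1) :
    lin n F (point a b) = a := form_coeffs ha

theorem quad_point {a b : MvPolynomial (Fin n) F} (hb : b.IsHomogeneous 2) :
    quad n F (point a b) = b := form_coeffs hb

theorem point_lin_quad (u : Coord n → F) : point (lin n F u) (quad n F u) = u := by
  funext k
  rcases k with k | k
  · exact congrFun (coeffs_form fun e => u (Sum.inl e)) k
  · exact congrFun (coeffs_form fun e => u (Sum.inr e)) k

theorem point_ext {u v : Coord n → F} (h1 : lin n F u = lin n F v)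
    (h2 : quad n F u = quad n F v) : u = v := by
  rw [← point_lin_quad u, ← point_lin_quad v, h1, h2]

theorem map_lin {F' : Type*} [CommRing F'] (f : F →+* F') (u : Coord n → F) :
    map f (lin n F u) = lin n F' (fun k => f (u k)) := map_form f _

theorem map_quad {F' : Type*} [CommRing F'] (f : F →+* F') (u : Coord n → F) :
    map f (quad n F u) = quad n F' (fun k => f (u k)) := map_form f _

section Substitution
variable [Algebra ℂ F]

/-- Linear substitution of variables. -/
def subst (F : Type*) [CommRing F] [Algebra ℂ F] (g : Matrix (Fin n) (Fin n) ℂ) :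
    MvPolynomial (Fin n) F →ₐ[F] MvPolynomial (Fin n) F :=
  bind₁ (g.map (algebraMap ℂ F)).toMvPolynomial

theorem subst_subst (g h : Matrix (Fin n) (Fin n) ℂ) (p : MvPolynomial (Fin n) F) :
    subst F g (subst F h p) = subst F (h * g) p := by
  rw [subst, subst, subst, bind₁_bind₁, Matrix.map_mul]
  congr 2
  funext i
  rw [Matrix.toMvPolynomial_mul]

theorem subst_one (p : MvPolynomial (Fin n) F) : subst F 1 p = p := by
  rw [subst, Matrix.map_one _ (map_zero _) (map_one _), Matrix.toMvPolynomial_one, bind₁_X_left]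
  rfl

theorem isHomogeneous_subst (g : Matrix (Fin n) (Fin n) ℂ) {p : MvPolynomial (Fin n) F} {k : ℕ}
    (hp : p.IsHomogeneous k) : (subst F g p).IsHomogeneous k := by
  have := hp.aeval (g.map (algebraMap ℂ F)).toMvPolynomial
    (n := 1) (fun i => Matrix.toMvPolynomial_isHomogeneous _ i)
  simpa [subst] using this

theorem map_subst {F' : Type*} [CommRing F'] [Algebra ℂ F'] (f : F →ₐ[ℂ] F')
    (g : Matrix (Fin n) (Fin n) ℂ) (p : MvPolynomial (Fin n) F) :
    map (f : F →+* F') (subst F g p) = subst F' g (map (f : F →+* F') p) := by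
  rw [subst, subst, map_bind₁]
  congr 2
  funext i
  rw [← Matrix.toMvPolynomial_map, Matrix.map_map]
  congr 2
  funext z
  simp

/-- Linear substitution acting on points. -/
def actPoint (g : Matrix (Fin n) (Fin n) ℂ) (u : Coord n → F) : Coord n → F :=
  point (subst F g (lin n F u)) (subst F g (quad n F u))

theorem lin_actPoint (g : Matrix (Fin n) (Fin n) ℂ) (u : Coord n → F) :
    lin n F (actPoint g u) = subst F g (lin n F u) :=
  lin_point (isHomogeneous_subst g (isHomogeneous_lin u))

theorem quad_actPoint (g : Matrix (Fin n) (Fin n) ℂ) (u : Coord n → F) :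
    quad n F (actPoint g u) = subst F g (quad n F u) :=
  quad_point (isHomogeneous_subst g (isHomogeneous_quad u))

theorem actPoint_actPoint (g h : Matrix (Fin n) (Fin n) ℂ) (u : Coord n → F) :
    actPoint g (actPoint h u) = actPoint (h * g) u := by
  apply point_ext
  · rw [lin_actPoint, lin_actPoint, lin_actPoint, subst_subst]
  · rw [quad_actPoint, quad_actPoint, quad_actPoint, subst_subst]

theorem actPoint_one (u : Coord n → F) : actPoint 1 u = u := by
  apply point_ext
  · rw [lin_actPoint, subst_one]
  · rw [quad_actPoint, subst_one]

theorem map_actPoint {F' : Type*} [CommRing F'] [Algebra ℂ F'] (f : F →ₐ[ℂ] F')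
    (g : Matrix (Fin n) (Fin n) ℂ) (u : Coord n → F) :
    (fun k => f (actPoint g u k)) = actPoint g (fun k => f (u k)) := by
  have h1 := map_lin (f : F →+* F') (actPoint g u)
  have h2 := map_quad (f : F →+* F') (actPoint g u)
  apply point_ext
  · refine h1.symm.trans ?_
    rw [lin_actPoint, lin_actPoint, map_subst, map_lin]; rfl
  · refine h2.symm.trans ?_
    rw [quad_actPoint, quad_actPoint, map_subst, map_quad]; rfl

/-- Linear substitution acting on coefficient vectors of forms of degree `k`. -/
def actForm (k : ℕ) (F : Type*) [CommRing F] [Algebra ℂ F] (g : Matrix (Fin n) (Fin n) ℂ) :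
    (Mon n k → F) →ₗ[F] (Mon n k → F) :=
  (coeffs n k F).comp ((subst F g).toLinearMap.comp (form n k F))

theorem actForm_coeffs {k : ℕ} (g : Matrix (Fin n) (Fin n) ℂ) {p : MvPolynomial (Fin n) F}
    (hp : p.IsHomogeneous k) : actForm k F g (coeffs n k F p) = coeffs n k F (subst F g p) := by
  simp [actForm, form_coeffs hp]

theorem actForm_actForm {k : ℕ} (g h : Matrix (Fin n) (Fin n) ℂ) (v : Mon n k → F) :
    actForm k F g (actForm k F h v) = actForm k F (h * g) v := by
  rw [← coeffs_form v, actForm_coeffs _ (isHomogeneous_form v),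
    actForm_coeffs _ (isHomogeneous_subst _ (isHomogeneous_form v)),
    actForm_coeffs _ (isHomogeneous_form v), subst_subst]

theorem actForm_one {k : ℕ} (v : Mon n k → F) : actForm k F 1 v = v := by
  rw [← coeffs_form v, actForm_coeffs _ (isHomogeneous_form v), subst_one]

end Substitution
end Coordinates

section Tangent
variable {n : ℕ} {F : Type*} [Field F]

/-- The Euler vector field of the weighted scaling. -/
def euler (u : Coord n → F) : Coord n → F :=
  Sum.elim (fun e => u (Sum.inl e)) (fun e => 2 * u (Sum.inr e))

theorem euler_eq_point (u : Coord n → F) :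
    euler u = point (lin n F u) (2 * quad n F u) := by
  have h := point_lin_quad u
  funext k
  rcases k with k | k
  · exact (congrFun h (Sum.inl k)).symm
  · have h2 : (2 : MvPolynomial (Fin n) F) * quad n F u = (2 : F) • quad n F u := by
      rw [smul_eq_C_mul, map_ofNat]
    change 2 * u (Sum.inr k) = coeffs n 2 F _ k
    rw [h2, map_smul, Pi.smul_apply, smul_eq_mul]
    congr 1
    exact (congrFun h (Sum.inr k)).symm

theorem lin_euler (u : Coord n → F) : lin n F (euler u) = lin n F u := by
  rw [euler_eq_point, lin_point (isHomogeneous_lin u)]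

theorem quad_euler (u : Coord n → F) : quad n F (euler u) = 2 * quad n F u := by
  rw [euler_eq_point, quad_point]
  simpa [map_ofNat] using (isHomogeneous_quad u).C_mul (2 : F)

theorem map_euler {F' : Type*} [Field F'] (f : F →+* F') (u : Coord n → F) :
    (fun k => f (euler u k)) = euler (fun k => f (u k)) := by
  funext k
  rcases k with k | k <;> simp [euler, map_ofNat]

variable [Algebra ℂ F]

/-- The degree `k` moment form of a point, as a polynomial. -/
def mom (u : Coord n → F) (k : ℕ) : MvPolynomial (Fin n) F := expPart (lin n F u) (quad n F u) k

theorem isHomogeneous_mom (u : Coord n → F) (k : ℕ) : (mom u k).IsHomogeneous k :=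
  isHomogeneous_expPart (isHomogeneous_lin u) (isHomogeneous_quad u) k

theorem map_mom {F' : Type*} [Field F'] [Algebra ℂ F'] (f : F →ₐ[ℂ] F') (u : Coord n → F)
    (k : ℕ) : map (f : F →+* F') (mom u k) = mom (fun i => f (u i)) k := by
  have := map_expPart (mapAlgHom f) (lin n F u) (quad n F u) k
  simp only [mapAlgHom_apply] at this
  refine this.trans ?_
  have h1 := map_lin (f : F →+* F') u
  have h2 := map_quad (f : F →+* F') u
  rw [mom]
  exact congrArg₂ (fun a b => expPart a b k) h1 h2

theorem subst_mom (g : Matrix (Fin n) (Fin n) ℂ) (u : Coord n → F) (k : ℕ) :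
    subst F g (mom u k) = mom (actPoint g u) k := by
  rw [mom, mom, lin_actPoint, quad_actPoint]
  exact map_expPart ((subst F g).restrictScalars ℂ) _ _ k

/-- The derivative of `mom u (r + 4)`, as a polynomial. -/
def tanPoly (r : ℕ) (u w : Coord n → F) : MvPolynomial (Fin n) F :=
  lin n F w * mom u (r + 3) + quad n F w * mom u (r + 2)

/-- The second derivative of `mom u (r + 4)`, as a polynomial. -/
def hessPoly (r : ℕ) (u w w' : Coord n → F) : MvPolynomial (Fin n) F :=
  lin n F w * lin n F w' * mom u (r + 2) +
    (lin n F w * quad n F w' + lin n F w' * quad n F w) * mom u (r + 1) +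
    quad n F w * quad n F w' * mom u r

theorem isHomogeneous_tanPoly (r : ℕ) (u w : Coord n → F) :
    (tanPoly r u w).IsHomogeneous (r + 4) := by
  have h1 := (isHomogeneous_lin w).mul (isHomogeneous_mom u (r + 3))
  have h2 := (isHomogeneous_quad w).mul (isHomogeneous_mom u (r + 2))
  rw [show 1 + (r + 3) = r + 4 by omega] at h1
  rw [show 2 + (r + 2) = r + 4 by omega] at h2
  exact h1.add h2

theorem isHomogeneous_hessPoly (r : ℕ) (u w w' : Coord n → F) :
    (hessPoly r u w w').IsHomogeneous (r + 4) := by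
  have h1 := ((isHomogeneous_lin w).mul (isHomogeneous_lin w')).mul (isHomogeneous_mom u (r + 2))
  have h2 := (((isHomogeneous_lin w).mul (isHomogeneous_quad w')).add
    ((isHomogeneous_lin w').mul (isHomogeneous_quad w))).mul (isHomogeneous_mom u (r + 1))
  have h3 := ((isHomogeneous_quad w).mul (isHomogeneous_quad w')).mul (isHomogeneous_mom u r)
  rw [show 1 + 1 + (r + 2) = r + 4 by omega] at h1
  rw [show 1 + 2 + (r + 1) = r + 4 by omega] at h2
  rw [show 2 + 2 + r = r + 4 by omega] at h3
  exact (h1.add h2).add h3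

/-- The moment form of degree `r + 4`. -/
def phi (r : ℕ) (u : Coord n → F) : Mon n (r + 4) → F := coeffs n (r + 4) F (mom u (r + 4))

/-- The differential of `phi r` at `u`. -/
def tan (r : ℕ) (u : Coord n → F) : (Coord n → F) →ₗ[F] (Mon n (r + 4) → F) where
  toFun w := coeffs n (r + 4) F (tanPoly r u w)
  map_add' w w' := by
    rw [← map_add]; refine congrArg _ ?_; simp only [tanPoly, map_add]; ring
  map_smul' c w := by
    rw [RingHom.id_apply, ← map_smul]; refine congrArg _ ?_
    simp only [tanPoly, map_smul, smul_add, smul_mul_assoc]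

/-- The second differential of `phi r` at `u`. -/
def hess (r : ℕ) (u : Coord n → F) :
    (Coord n → F) →ₗ[F] (Coord n → F) →ₗ[F] (Mon n (r + 4) → F) :=
  LinearMap.mk₂ F (fun w w' => coeffs n (r + 4) F (hessPoly r u w w'))
    (fun w₁ w₂ w' => by
      rw [← map_add]; refine congrArg _ ?_; simp only [hessPoly, map_add]; ring)
    (fun c w w' => by
      rw [← map_smul]; refine congrArg _ ?_
      simp only [hessPoly, map_smul, smul_eq_C_mul]; ring)
    (fun w w₁ w₂ => by
      rw [← map_add]; refine congrArg _ ?_; simp only [hessPoly, map_add]; ring)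
    (fun c w w' => by
      rw [← map_smul]; refine congrArg _ ?_
      simp only [hessPoly, map_smul, smul_eq_C_mul]; ring)

theorem tan_apply (r : ℕ) (u w : Coord n → F) :
    tan r u w = coeffs n (r + 4) F (tanPoly r u w) := rfl

theorem hess_apply (r : ℕ) (u w w' : Coord n → F) :
    hess r u w w' = coeffs n (r + 4) F (hessPoly r u w w') := rfl

theorem hess_comm (r : ℕ) (u w w' : Coord n → F) : hess r u w w' = hess r u w' w := by
  rw [hess_apply, hess_apply]; refine congrArg _ ?_; simp only [hessPoly]; ring

section Map
variable {F' : Type*} [Field F'] [Algebra ℂ F'] (f : F →ₐ[ℂ] F')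

theorem map_phi (r : ℕ) (u : Coord n → F) :
    (fun e => f (phi r u e)) = phi r (fun k => f (u k)) := by
  rw [phi, phi, ← map_mom f, coeffs_map]; rfl

theorem map_tan (r : ℕ) (u w : Coord n → F) :
    (fun e => f (tan r u w e)) = tan r (fun k => f (u k)) (fun k => f (w k)) := by
  have h1 := map_lin (f : F →+* F') w
  have h2 := map_quad (f : F →+* F') w
  simp only [RingHom.coe_coe] at h1 h2
  rw [tan_apply, tan_apply, tanPoly, tanPoly, ← map_mom f, ← map_mom f, ← h1, ← h2,
    ← map_mul, ← map_mul, ← map_add, coeffs_map]; rfl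

theorem map_hess (r : ℕ) (u w w' : Coord n → F) :
    (fun e => f (hess r u w w' e)) =
      hess r (fun k => f (u k)) (fun k => f (w k)) (fun k => f (w' k)) := by
  have h1 := map_lin (f : F →+* F') w
  have h2 := map_quad (f : F →+* F') w
  have h3 := map_lin (f : F →+* F') w'
  have h4 := map_quad (f : F →+* F') w'
  simp only [RingHom.coe_coe] at h1 h2 h3 h4
  rw [hess_apply, hess_apply, hessPoly, hessPoly, ← map_mom f, ← map_mom f, ← map_mom f,
    ← h1, ← h2, ← h3, ← h4]
  simp only [← map_mul, ← map_add]
  rw [coeffs_map]; rfl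

end Map

theorem actForm_tan (r : ℕ) (g : Matrix (Fin n) (Fin n) ℂ) (u w : Coord n → F) :
    actForm (r + 4) F g (tan r u w) = tan r (actPoint g u) (actPoint g w) := by
  rw [tan_apply, tan_apply, actForm_coeffs _ (isHomogeneous_tanPoly r u w), tanPoly, tanPoly,
    map_add, map_mul, map_mul, subst_mom, subst_mom, lin_actPoint, quad_actPoint]

theorem tan_euler (r : ℕ) (u : Coord n → F) :
    tan r u (euler u) = ((r : F) + 4) • phi r u := by
  rw [tan_apply, phi, ← map_smul]
  refine congrArg _ ?_
  have := expPart_rec (lin n F u) (quad n F u) (r + 2)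
  rw [tanPoly, lin_euler, quad_euler, smul_eq_C_mul]
  simp only [map_add, map_natCast, map_ofNat, mom]
  push_cast at this
  linear_combination -this

theorem hess_euler_mem (r : ℕ) (u w : Coord n → F) :
    hess r u (euler u) w ∈ LinearMap.range (tan r u) := by
  have e1 := expPart_rec (lin n F u) (quad n F u) (r + 1)
  have e2 := expPart_rec (lin n F u) (quad n F u) r
  push_cast at e1
  have ha : (((r : MvPolynomial (Fin n) F) + 3) * lin n F w).IsHomogeneous 1 := by
    simpa [map_ofNat] using (isHomogeneous_lin w).C_mul ((r : F) + 3)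
  have hb : (((r : MvPolynomial (Fin n) F) + 2) * quad n F w).IsHomogeneous 2 := by
    simpa [map_ofNat] using (isHomogeneous_quad w).C_mul ((r : F) + 2)
  refine ⟨point (((r : MvPolynomial (Fin n) F) + 3) * lin n F w)
    (((r : MvPolynomial (Fin n) F) + 2) * quad n F w), ?_⟩
  rw [tan_apply, hess_apply]
  refine congrArg _ ?_
  rw [tanPoly, hessPoly, lin_euler, quad_euler, lin_point ha, quad_point hb]
  simp only [mom, show r + 1 + 2 = r + 3 by ring, show r + 1 + 1 = r + 2 by ring] at *
  linear_combination lin n F w * e1 + quad n F w * e2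

end Tangent

section Irreducible

theorem exists_separating (n k : ℕ) : ∃ t : Fin n → ℂ, (∀ i, t i ≠ 0) ∧
    Function.Injective fun e : Mon n k => ∏ i, t i ^ (e.1 i) := by
  classical
  let P : MvPolynomial (Fin n) ℂ := (∏ i, X i) *
    ∏ p ∈ (Finset.univ : Finset (Mon n k)).offDiag, (monomial p.1.1 1 - monomial p.2.1 1)
  have hP : P ≠ 0 := by
    refine mul_ne_zero (Finset.prod_ne_zero_iff.2 fun i _ => X_ne_zero i)
      (Finset.prod_ne_zero_iff.2 fun p hp => ?_)
    rw [Finset.mem_offDiag] at hp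
    refine sub_ne_zero.2 fun h => hp.2.2 (Subtype.ext ?_)
    exact monomial_left_injective one_ne_zero h
  obtain ⟨t, ht⟩ : ∃ t, eval t P ≠ 0 := by
    by_contra! h
    exact hP (MvPolynomial.funext fun x => by rw [h x, map_zero])
  rw [map_mul, map_prod, map_prod] at ht
  have h1 := Finset.prod_ne_zero_iff.1 (left_ne_zero_of_mul ht)
  have h2 := Finset.prod_ne_zero_iff.1 (right_ne_zero_of_mul ht)
  refine ⟨t, fun i => by simpa using h1 i (Finset.mem_univ i), fun e e' hee => ?_⟩
  by_contra hne
  refine h2 (e, e') (by simp [hne]) ?_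
  simp only [map_sub, eval_monomial, one_mul, Finsupp.prod_fintype _ _ fun i => pow_zero (t i)]
  exact sub_eq_zero.2 hee

variable {n k : ℕ} {F : Type*} [Field F]

theorem form_single [DecidableEq (Mon n k)] (e : Mon n k) :
    form n k F (Pi.single e 1) = monomial e.1 1 := by
  rw [form_apply, Finset.sum_eq_single e]
  · simp
  · intro e' _ h; simp [Pi.single_eq_of_ne h]
  · simp

theorem coeff_single_eq_eval {p : MvPolynomial (Fin n) F} (hp : p.IsHomogeneous k) (i : Fin n) :
    coeff (Finsupp.single i k) p = eval (Pi.single i 1) p := by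
  classical
  rw [← form_coeffs hp]
  set v := coeffs n k F p
  have := coeff_form v ⟨Finsupp.single i k, Finsupp.degree_single i k⟩
  refine this.trans ?_
  rw [form_apply, map_sum, Finset.sum_eq_single ⟨Finsupp.single i k, Finsupp.degree_single i k⟩]
  · simp [eval_monomial]
  · intro e _ he
    rw [eval_monomial, Finsupp.prod_fintype _ _ (fun i => pow_zero _)]
    obtain ⟨j, hji, hj⟩ : ∃ j, j ≠ i ∧ e.1 j ≠ 0 := by
      by_contra! h
      apply he
      apply Subtype.ext
      have h1 : e.1 = Finsupp.single i (e.1 i) := by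
        ext j
        rcases eq_or_ne j i with rfl | hj
        · simp
        · rw [h j hj, Finsupp.single_eq_of_ne hj]
      have h2 := e.2
      rw [h1, Finsupp.degree_single] at h2
      rw [h1, h2]
    rw [Finset.prod_eq_zero (Finset.mem_univ j), mul_zero]
    rw [Pi.single_eq_of_ne hji, zero_pow hj]
  · simp

theorem coeff_sum_X_pow_ne_zero [CharZero F] (e : Mon n k) :
    coeff e.1 ((∑ j, X j : MvPolynomial (Fin n) F) ^ k) ≠ 0 := by
  classical
  rw [Finset.sum_pow_eq_sum_piAntidiag, coeff_sum, Finset.sum_eq_single (e.1 : Fin n → ℕ)]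
  · have : (∏ i, (X i : MvPolynomial (Fin n) F) ^ e.1 i) = monomial e.1 1 := by
      rw [monomial_eq, Finsupp.prod_fintype _ _ (fun i => pow_zero _), C_1, one_mul]
    rw [this, ← C_eq_coe_nat, coeff_C_mul, coeff_monomial, if_pos rfl, mul_one]
    exact_mod_cast (Nat.multinomial_pos _ _).ne'
  · intro f _ hf
    have : (∏ i, (X i : MvPolynomial (Fin n) F) ^ f i) =
        monomial (Finsupp.equivFunOnFinite.symm f) 1 := by
      rw [monomial_eq, Finsupp.prod_fintype _ _ (fun i => pow_zero _), C_1, one_mul]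
      rfl
    rw [this, ← C_eq_coe_nat, coeff_C_mul, coeff_monomial, if_neg, mul_zero]
    rintro h
    exact hf (by rw [← h]; rfl)
  · intro h
    exfalso
    apply h
    rw [Finset.mem_piAntidiag]
    refine ⟨?_, by simp⟩
    rw [← Finsupp.degree_eq_sum]; exact e.2

variable [Algebra ℂ F]

theorem subst_X (g : Matrix (Fin n) (Fin n) ℂ) (i : Fin n) :
    subst F g (X i) = ∑ j, C (algebraMap ℂ F (g i j)) * X j := by
  rw [subst, bind₁_X_right, Matrix.toMvPolynomial]
  simp [← C_mul_X_eq_monomial]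

theorem subst_monomial (g : Matrix (Fin n) (Fin n) ℂ) (e : Fin n →₀ ℕ) (c : F) :
    subst F g (monomial e c) = C c * ∏ i, (subst F g (X i)) ^ e i := by
  rw [monomial_eq, map_mul, ← algebraMap_eq, AlgHom.commutes,
    Finsupp.prod_fintype _ _ (fun i => pow_zero _), map_prod]
  simp only [map_pow]

theorem actForm_diagonal (t : Fin n → ℂ) (v : Mon n k → F) (e : Mon n k) :
    actForm k F (Matrix.diagonal t) v e = algebraMap ℂ F (∏ i, t i ^ (e.1 i)) * v e := by
  classical
  have hX : ∀ i, subst F (Matrix.diagonal t) (X i) = C (algebraMap ℂ F (t i)) * X i := by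
    intro i
    rw [subst_X, Finset.sum_eq_single i]
    · simp
    · intro j _ hj; simp [Matrix.diagonal_apply_ne' t hj]
    · simp
  have hm : ∀ e' : Mon n k, subst F (Matrix.diagonal t) (monomial e'.1 (v e')) =
      monomial e'.1 (algebraMap ℂ F (∏ i, t i ^ (e'.1 i)) * v e') := by
    intro e'
    rw [subst_monomial]
    simp only [hX, mul_pow, Finset.prod_mul_distrib]
    rw [monomial_eq, Finsupp.prod_fintype _ _ (fun i => pow_zero _)]
    simp only [map_mul, map_prod, map_pow]
    ring
  have : actForm k F (Matrix.diagonal t) v =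
      coeffs n k F (form n k F fun e' => algebraMap ℂ F (∏ i, t i ^ (e'.1 i)) * v e') := by
    simp only [actForm, LinearMap.comp_apply, AlgHom.toLinearMap_apply, form_apply, map_sum, hm]
  rw [this, coeffs_form]

theorem isUnit_diagonal {t : Fin n → ℂ} (ht : ∀ i, t i ≠ 0) :
    IsUnit (Matrix.diagonal t) := by
  rw [Matrix.isUnit_iff_isUnit_det, Matrix.det_diagonal, isUnit_iff_ne_zero]
  exact Finset.prod_ne_zero_iff.2 fun i _ => ht i

variable {Z : Submodule F (Mon n k → F)}

theorem single_mem_of_invariant [DecidableEq (Mon n k)]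
    (hZ : ∀ g : Matrix (Fin n) (Fin n) ℂ, IsUnit g → ∀ v ∈ Z, actForm k F g v ∈ Z)
    {v : Mon n k → F} (hv : v ∈ Z) {e : Mon n k} (he : v e ≠ 0) :
    (Pi.single e 1 : Mon n k → F) ∈ Z := by
  obtain ⟨t, ht, hinj⟩ := exists_separating n k
  set χ : Mon n k → F := fun e => algebraMap ℂ F (∏ i, t i ^ (e.1 i)) with hχ
  have hχi : Function.Injective χ := (algebraMap ℂ F).injective.comp hinj
  have hpow : ∀ j : ℕ, (fun e => χ e ^ j * v e) ∈ Z := by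
    intro j
    induction j with
    | zero => simpa using hv
    | succ j ih =>
      have := hZ _ (isUnit_diagonal ht) _ ih
      convert this using 1
      funext e
      rw [actForm_diagonal]
      simp only [hχ]; ring
  have hpoly : ∀ p : Polynomial F, (fun e => p.eval (χ e) * v e) ∈ Z := by
    intro p
    induction p using Polynomial.induction_on' with
    | add p q hp hq =>
      convert Z.add_mem hp hq using 1
      funext e; simp [add_mul]
    | monomial j a =>
      convert Z.smul_mem a (hpow j) using 1
      funext e; simp [mul_assoc]
  have h1 := Z.smul_mem (v e)⁻¹ (hpoly (Lagrange.basis Finset.univ χ e))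
  convert h1 using 1
  funext e'
  rcases eq_or_ne e' e with rfl | h
  · rw [Pi.single_eq_same, Pi.smul_apply,
      Lagrange.eval_basis_self hχi.injOn (Finset.mem_univ _)]
    simp [he]
  · rw [Pi.single_eq_of_ne h, Pi.smul_apply,
      Lagrange.eval_basis_of_ne h.symm (Finset.mem_univ _)]
    simp

theorem actForm_apply (g : Matrix (Fin n) (Fin n) ℂ) (v : Mon n k → F) (e : Mon n k) :
    actForm k F g v e = coeff e.1 (subst F g (form n k F v)) := rfl

/-- A nonzero subspace of the space of forms of degree `k` stable under `GL_n(ℂ)` is everything. -/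
theorem eq_top_of_invariant (hn : 0 < n)
    (hZ : ∀ g : Matrix (Fin n) (Fin n) ℂ, IsUnit g → ∀ v ∈ Z, actForm k F g v ∈ Z)
    (hne : Z ≠ ⊥) : Z = ⊤ := by
  classical
  have : CharZero F := charZero_of_injective_algebraMap (algebraMap ℂ F).injective
  obtain ⟨v, hv, hv0⟩ := Z.ne_bot_iff.1 hne
  obtain ⟨e, he⟩ : ∃ e, v e ≠ 0 := by
    by_contra! h
    exact hv0 (funext h)
  have h1 := single_mem_of_invariant hZ hv he
  let i0 : Fin n := ⟨0, hn⟩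
  let top : Mon n k := ⟨Finsupp.single i0 k, Finsupp.degree_single i0 k⟩
  -- the substitution adding the first variable to all others
  let g : Matrix (Fin n) (Fin n) ℂ := Matrix.of fun i j =>
    if j = i then 1 else if j = i0 then 1 else 0
  have hg : IsUnit g := by
    rw [Matrix.isUnit_iff_isUnit_det, Matrix.det_of_isLowerTriangular g]
    · simp [g]
    · intro i j hij
      have hij' : i < j := hij
      have h2 : j ≠ i := hij'.ne'
      have h3 : j ≠ i0 := by
        rintro rfl
        exact absurd hij' (by simp [i0, Fin.lt_def])
      simp [g, h2, h3]
  have htop : (Pi.single top 1 : Mon n k → F) ∈ Z := by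
    refine single_mem_of_invariant hZ (hZ g hg _ h1) ?_
    rw [actForm_apply, coeff_single_eq_eval (isHomogeneous_subst g (isHomogeneous_form _)) i0,
      form_single, subst_monomial, map_mul, map_prod, eval_C, one_mul, Finset.prod_eq_one]
    · exact one_ne_zero
    · intro i _
      rw [map_pow, subst_X, map_sum, Finset.sum_eq_single i0]
      · simp only [map_mul, eval_C, eval_X, Pi.single_eq_same, g, Matrix.of_apply]
        split_ifs <;> simp
      · intro j _ hj
        rw [map_mul, eval_X, Pi.single_eq_of_ne hj, mul_zero]
      · simp
  -- the substitution sending the first variable to the sum of all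
  let g' : Matrix (Fin n) (Fin n) ℂ := Matrix.of fun i j =>
    if j = i then 1 else if i = i0 then 1 else 0
  have hg' : IsUnit g' := by
    rw [Matrix.isUnit_iff_isUnit_det, Matrix.det_of_isUpperTriangular]
    · simp [g']
    · intro i j hij
      have hij' : j < i := hij
      have h2 : j ≠ i := hij'.ne
      have h3 : i ≠ i0 := by
        rintro rfl
        exact absurd hij' (by simp [i0, Fin.lt_def])
      simp [g', h2, h3]
  have hall : ∀ e : Mon n k, (Pi.single e 1 : Mon n k → F) ∈ Z := by
    intro e
    refine single_mem_of_invariant hZ (hZ g' hg' _ htop) ?_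
    rw [actForm_apply, form_single, subst_monomial, C_1, one_mul, Finset.prod_eq_single i0]
    · have : subst F g' (X i0) = ∑ j, X j := by
        rw [subst_X]
        refine Finset.sum_congr rfl fun j _ => ?_
        simp [g']
      rw [this]
      simpa [top] using coeff_sum_X_pow_ne_zero e
    · intro j _ hj
      simp [top, Finsupp.single_eq_of_ne hj]
    · simp
  rw [eq_top_iff]
  intro w _
  rw [pi_eq_sum_univ w]
  refine Z.sum_mem fun e _ => Z.smul_mem _ ?_
  convert hall e using 1
  funext e'
  simp [Pi.single_apply, eq_comm]

end Irreducible

section Conjugation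
variable {ι F : Type*} [Field F] [Algebra ℂ F]

/-- The image of a submodule of a coordinate space under a field automorphism. -/
def conj (σ : F ≃ₐ[ℂ] F) : Submodule F (ι → F) ≃o Submodule F (ι → F) where
  toFun A :=
    { carrier := {v | (fun e => σ.symm (v e)) ∈ A}
      add_mem' := fun {v w} hv hw => by
        have := A.add_mem hv hw
        have h : (fun e => σ.symm (v e)) + (fun e => σ.symm (w e)) =
            fun e => σ.symm ((v + w) e) := by ext e; simp
        rwa [h] at this
      zero_mem' := by
        have h : (fun e => σ.symm ((0 : ι → F) e)) = 0 := by ext e; simp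
        rw [Set.mem_ofPred_eq, h]; exact A.zero_mem
      smul_mem' := fun c v hv => by
        have := A.smul_mem (σ.symm c) hv
        have h : σ.symm c • (fun e => σ.symm (v e)) = fun e => σ.symm ((c • v) e) := by
          ext e; simp
        rwa [h] at this }
  invFun A :=
    { carrier := {v | (fun e => σ (v e)) ∈ A}
      add_mem' := fun {v w} hv hw => by
        have := A.add_mem hv hw
        have h : (fun e => σ (v e)) + (fun e => σ (w e)) = fun e => σ ((v + w) e) := by
          ext e; simp
        rwa [h] at this
      zero_mem' := by
        have h : (fun e => σ ((0 : ι → F) e)) = 0 := by ext e; simp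
        rw [Set.mem_ofPred_eq, h]; exact A.zero_mem
      smul_mem' := fun c v hv => by
        have := A.smul_mem (σ c) hv
        have h : σ c • (fun e => σ (v e)) = fun e => σ ((c • v) e) := by ext e; simp
        rwa [h] at this }
  left_inv A := by ext v; simp
  right_inv A := by ext v; simp
  map_rel_iff' {A B} := by
    constructor
    · intro h v hv
      have : (fun e => σ (v e)) ∈ ({v | (fun e => σ.symm (v e)) ∈ B} : Set (ι → F)) := by
        apply h
        change (fun e => σ.symm (σ (v e))) ∈ A
        simpa using hv
      change (fun e => σ.symm (σ (v e))) ∈ B at this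
      simpa using this
    · intro h v hv
      exact h hv

theorem mem_conj {σ : F ≃ₐ[ℂ] F} {A : Submodule F (ι → F)} {v : ι → F} :
    v ∈ conj σ A ↔ (fun e => σ.symm (v e)) ∈ A := Iff.rfl

theorem map_mem_conj {σ : F ≃ₐ[ℂ] F} {A : Submodule F (ι → F)} {v : ι → F} :
    (fun e => σ (v e)) ∈ conj σ A ↔ v ∈ A := by
  simp [mem_conj]

theorem finrank_conj (σ : F ≃ₐ[ℂ] F) (A : Submodule F (ι → F)) :
    Module.finrank F (conj σ A) = Module.finrank F A := by
  refine congrArg Cardinal.toNat (rank_eq_of_equiv_equiv σ (M := A) (M₁ := conj σ A)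
    { toFun := fun v => ⟨fun e => σ (v.1 e), map_mem_conj.2 v.2⟩
      invFun := fun v => ⟨fun e => σ.symm (v.1 e), v.2⟩
      left_inv := fun v => by ext e; simp
      right_inv := fun v => by ext e; simp
      map_add' := fun v w => by ext e; simp } σ.bijective fun c v => ?_).symm
  ext e
  simp

theorem conj_range_tan {n : ℕ} (r : ℕ) (σ : F ≃ₐ[ℂ] F) (u : Coord n → F) :
    conj σ (LinearMap.range (tan r u)) = LinearMap.range (tan r fun k => σ (u k)) := by
  ext v
  rw [mem_conj]
  constructor
  · rintro ⟨w, hw⟩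
    refine ⟨fun k => σ (w k), ?_⟩
    rw [← AlgEquiv.coe_toAlgHom, ← map_tan, hw]
    simp
  · rintro ⟨w, rfl⟩
    refine ⟨fun k => σ.symm (w k), ?_⟩
    have := map_tan (σ.symm : F →ₐ[ℂ] F) r (fun k => σ (u k)) w
    simp only [AlgEquiv.coe_toAlgHom, AlgEquiv.symm_apply_apply] at this
    exact this.symm

end Conjugation

variable {n : ℕ}

/-- The function field of a sequence of points. -/
abbrev GenField (n : ℕ) : Type := FractionRing (MvPolynomial (ℕ × Coord n) ℂ)

/-- The `i`-th generic point. -/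
def gen (i : ℕ) : Coord n → GenField n := fun k => algebraMap _ _ (X (i, k) : MvPolynomial _ ℂ)

theorem exists_algEquiv_perm (π : Equiv.Perm ℕ) :
    ∃ σ : GenField n ≃ₐ[ℂ] GenField n, ∀ i, (fun k => σ (gen i k)) = gen (π i) := by
  let f : MvPolynomial (ℕ × Coord n) ℂ ≃ₐ[ℂ] MvPolynomial (ℕ × Coord n) ℂ :=
    renameEquiv ℂ (π.prodCongr (Equiv.refl _))
  refine ⟨IsFractionRing.fieldEquivOfAlgEquiv ℂ _ _ f, fun i => funext fun k => ?_⟩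
  rw [gen, IsFractionRing.fieldEquivOfAlgEquiv_algebraMap]
  simp [f, gen]

/-- The substitution of variables acting on the points with index in `J`. -/
def actOn (J : Finset ℕ) (g : Matrix (Fin n) (Fin n) ℂ) :
    MvPolynomial (ℕ × Coord n) ℂ →ₐ[ℂ] MvPolynomial (ℕ × Coord n) ℂ :=
  aeval fun p => if p.1 ∈ J then actPoint g (fun k => X (p.1, k)) p.2 else X p

theorem actOn_X (J : Finset ℕ) (g : Matrix (Fin n) (Fin n) ℂ) (i : ℕ) :
    (fun k => actOn J g (X (i, k))) =
      if i ∈ J then actPoint g (fun k => (X (i, k) : MvPolynomial (ℕ × Coord n) ℂ))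
      else fun k => X (i, k) := by
  funext k
  split_ifs with h <;> simp [actOn, h]

theorem actOn_actOn {J : Finset ℕ} {g h : Matrix (Fin n) (Fin n) ℂ} (hgh : g * h = 1) :
    (actOn J g).comp (actOn J h) = AlgHom.id ℂ _ := by
  apply algHom_ext
  rintro ⟨i, k⟩
  rw [AlgHom.comp_apply]
  refine congrFun (f := fun k => actOn J g (actOn J h (X (i, k)))) (g := fun k => X (i, k)) ?_ k
  have h1 := actOn_X J h i
  have h2 := actOn_X J g i
  by_cases hi : i ∈ J
  · simp only [hi, if_true] at h1 h2
    have := map_actPoint (actOn J g) h (fun k => (X (i, k) : MvPolynomial (ℕ × Coord n) ℂ))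
    rw [← h1, h2, actPoint_actPoint, hgh, actPoint_one] at this
    exact this
  · simp only [hi, if_false] at h1 h2
    funext k
    rw [congrFun h1 k, congrFun h2 k]

theorem exists_algEquiv_act (J : Finset ℕ) {g : Matrix (Fin n) (Fin n) ℂ} (hg : IsUnit g) :
    ∃ σ : GenField n ≃ₐ[ℂ] GenField n, (∀ i ∈ J, (fun k => σ (gen i k)) = actPoint g (gen i)) ∧
      ∀ i, i ∉ J → (fun k => σ (gen i k)) = gen i := by
  obtain ⟨g, rfl⟩ := hg
  let f : MvPolynomial (ℕ × Coord n) ℂ ≃ₐ[ℂ] MvPolynomial (ℕ × Coord n) ℂ :=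
    AlgEquiv.ofAlgHom (actOn J g.1) (actOn J g.2) (actOn_actOn g.3) (actOn_actOn g.4)
  have key : ∀ i k, IsFractionRing.fieldEquivOfAlgEquiv ℂ (GenField n) (GenField n) f (gen i k) =
      algebraMap _ _ (actOn J g.1 (X (i, k))) := fun i k => by
    rw [gen, IsFractionRing.fieldEquivOfAlgEquiv_algebraMap]; rfl
  refine ⟨IsFractionRing.fieldEquivOfAlgEquiv ℂ _ _ f, fun i hi => ?_, fun i hi => ?_⟩
  · have h := actOn_X J g.1 i
    simp only [hi, if_true] at h
    have := map_actPoint (IsScalarTower.toAlgHom ℂ (MvPolynomial (ℕ × Coord n) ℂ) (GenField n)) g.1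
      (fun k => (X (i, k) : MvPolynomial (ℕ × Coord n) ℂ))
    rw [← h] at this
    funext k
    rw [key]
    exact congrFun this k
  · have h := actOn_X J g.1 i
    simp only [hi, if_false] at h
    funext k
    rw [key, congrFun h k, gen]

variable (r : ℕ)

/-- The tangent space at the `i`-th generic point. -/
def tang (i : ℕ) : Submodule (GenField n) (Mon n (r + 4) → GenField n) :=
  LinearMap.range (tan r (gen i))

/-- The sum of the tangent spaces at the generic points with index in `J`. -/
def tangSum (J : Finset ℕ) : Submodule (GenField n) (Mon n (r + 4) → GenField n) :=
  ⨆ i ∈ J, tang r i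

variable {r}

theorem tangSum_mono {J J' : Finset ℕ} (h : J ⊆ J') :
    (tangSum r J : Submodule (GenField n) _) ≤ tangSum r J' :=
  biSup_mono fun _ hi => h hi

theorem tang_le_tangSum {J : Finset ℕ} {i : ℕ} (h : i ∈ J) :
    (tang r i : Submodule (GenField n) _) ≤ tangSum r J :=
  le_biSup (tang r) h

theorem tangSum_insert (i : ℕ) (J : Finset ℕ) :
    (tangSum r (insert i J) : Submodule (GenField n) _) = tang r i ⊔ tangSum r J :=
  Finset.iSup_insert i J (tang r)

theorem conj_tang {σ : GenField n ≃ₐ[ℂ] GenField n} {i j : ℕ}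
    (h : (fun k => σ (gen i k)) = gen j) : conj σ (tang r i) = tang r j := by
  rw [tang, conj_range_tan, h, tang]

theorem conj_tangSum {σ : GenField n ≃ₐ[ℂ] GenField n} {π : Equiv.Perm ℕ}
    (h : ∀ i, (fun k => σ (gen i k)) = gen (π i)) (J : Finset ℕ) :
    conj σ (tangSum r J) = tangSum r (J.map π.toEmbedding) := by
  rw [tangSum, map_iSup₂, tangSum, Finset.map_eq_image, Finset.iSup_finset_image]
  exact biSup_congr fun i _ => conj_tang (h i)

theorem conj_tangSum_of_fixed {σ : GenField n ≃ₐ[ℂ] GenField n} {J : Finset ℕ}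
    (h : ∀ i ∈ J, (fun k => σ (gen i k)) = gen i) : conj σ (tangSum r J) = tangSum r J := by
  rw [tangSum, map_iSup₂]
  exact biSup_congr fun i hi => conj_tang (h i hi)

theorem conj_tang_le {σ : GenField n ≃ₐ[ℂ] GenField n} {g : Matrix (Fin n) (Fin n) ℂ}
    (hg : IsUnit g) {i : ℕ} (h : (fun k => σ (gen i k)) = actPoint g (gen i)) :
    conj σ (tang r i) ≤ (tang r i).map (actForm (r + 4) (GenField n) g) := by
  obtain ⟨g, rfl⟩ := hg
  rw [tang, conj_range_tan, h]
  rintro _ ⟨w, rfl⟩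
  refine ⟨tan r (gen i) (actPoint g.2 w), ⟨_, rfl⟩, ?_⟩
  rw [actForm_tan, actPoint_actPoint, g.4, actPoint_one]

theorem conj_tangSum_le {σ : GenField n ≃ₐ[ℂ] GenField n} {g : Matrix (Fin n) (Fin n) ℂ}
    (hg : IsUnit g) {J : Finset ℕ} (h : ∀ i ∈ J, (fun k => σ (gen i k)) = actPoint g (gen i)) :
    conj σ (tangSum r J) ≤ (tangSum r J).map (actForm (r + 4) (GenField n) g) := by
  rw [tangSum, map_iSup₂]
  refine iSup₂_le fun i hi => (conj_tang_le hg (h i hi)).trans (Submodule.map_mono ?_)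
  exact tang_le_tangSum hi

section Growth
open Module

theorem exchange {Z : Finset ℕ} {P : Finset ℕ → Prop}
    (h : ∀ J a b, Disjoint J Z → a ∈ J → b ∉ J → b ∉ Z → P J → P (insert b (J.erase a)))
    {J J' : Finset ℕ} (hJ : Disjoint J Z) (hJ' : Disjoint J' Z) (hc : J.card = J'.card)
    (hP : P J) : P J' := by
  obtain ⟨k, hk⟩ : ∃ k, (J' \ J).card = k := ⟨_, rfl⟩
  induction k generalizing J with
  | zero =>
    have h1 : J' ⊆ J := Finset.sdiff_eq_empty_iff_subset.1 (Finset.card_eq_zero.1 hk)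
    rwa [Finset.eq_of_subset_of_card_le h1 hc.le]
  | succ k ih =>
    obtain ⟨b, hb⟩ : (J' \ J).Nonempty := by rw [← Finset.card_pos]; omega
    obtain ⟨a, ha⟩ : (J \ J').Nonempty := by
      rw [← Finset.card_pos, Finset.card_sdiff_comm hc]; omega
    rw [Finset.mem_sdiff] at ha hb
    have hbZ : b ∉ Z := Finset.disjoint_left.1 hJ' hb.1
    refine ih (J := insert b (J.erase a)) ?_ ?_ (h J a b hJ ha.1 hb.2 hbZ hP) ?_
    · rw [Finset.disjoint_insert_left]
      exact ⟨hbZ, hJ.mono_left (Finset.erase_subset a J)⟩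
    · rw [Finset.card_insert_of_notMem (by simp [hb.2]), Finset.card_erase_of_mem ha.1, ← hc]
      have := Finset.card_pos.2 ⟨a, ha.1⟩
      omega
    · have : J' \ insert b (J.erase a) = (J' \ J).erase b := by
        ext x; simp only [Finset.mem_sdiff, Finset.mem_insert, Finset.mem_erase]; grind
      rw [this, Finset.card_erase_of_mem (by simp [hb]), hk]
      rfl

theorem map_swap_of_mem {J : Finset ℕ} {a b : ℕ} (ha : a ∈ J) (hb : b ∉ J) :
    J.map (Equiv.swap a b).toEmbedding = insert b (J.erase a) := by
  ext x
  rw [Finset.mem_map_equiv, Equiv.symm_swap, Equiv.swap_apply_def]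
  simp only [Finset.mem_insert, Finset.mem_erase]
  grind

theorem map_swap_of_notMem {J : Finset ℕ} {a b : ℕ} (ha : a ∉ J) (hb : b ∉ J) :
    J.map (Equiv.swap a b).toEmbedding = J := by
  ext x
  rw [Finset.mem_map_equiv, Equiv.symm_swap, Equiv.swap_apply_def]
  grind

variable {n r : ℕ}

/-- A subspace fixed by the automorphisms fixing the generic point of index `0`. -/
def IsFixed {ι : Type*} (A : Submodule (GenField n) (ι → GenField n)) : Prop :=
  ∀ σ : GenField n ≃ₐ[ℂ] GenField n, (fun k => σ (gen 0 k)) = gen 0 → conj σ A = A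

theorem isFixed_tang : IsFixed (tang r 0 : Submodule (GenField n) _) :=
  fun _ hσ => conj_tang hσ

theorem finrank_inf_tangSum_eq {A : Submodule (GenField n) (Mon n (r + 4) → GenField n)}
    (hA : IsFixed A) {J J' : Finset ℕ} (hJ : 0 ∉ J) (hJ' : 0 ∉ J') (hc : J.card = J'.card) :
    finrank (GenField n) ↥(A ⊓ tangSum r J) = finrank (GenField n) ↥(A ⊓ tangSum r J') := by
  refine (exchange (Z := {0}) (P := fun J' => finrank (GenField n) ↥(A ⊓ tangSum r J') =
    finrank (GenField n) ↥(A ⊓ tangSum r J)) (J := J) ?_ (by simpa) (by simpa) hc rfl).symm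
  intro J a b hJ0 ha hb hb0 hP
  obtain ⟨σ, hσ⟩ := exists_algEquiv_perm (n := n) (Equiv.swap a b)
  have ha0 : a ≠ 0 := fun h => Finset.disjoint_left.1 hJ0 ha (by simp [h])
  have h0 : (fun k => σ (gen 0 k)) = gen 0 := by
    rw [hσ, Equiv.swap_apply_of_ne_of_ne ha0.symm fun h => hb0 (by simp [← h])]
  rw [← hP, ← finrank_conj σ (A ⊓ tangSum r J), map_inf, hA σ h0, conj_tangSum hσ,
    map_swap_of_mem ha hb]

theorem inf_tangSum_eq_of_finrank_eq {A : Submodule (GenField n) (Mon n (r + 4) → GenField n)}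
    (hA : IsFixed A) {J K J' : Finset ℕ} (hJ : 0 ∉ J) (hK : 0 ∉ K) (hJ' : 0 ∉ J')
    (hc : K.card = J.card + 1) (hc' : J.card = J'.card)
    (h : finrank (GenField n) ↥(A ⊓ tangSum r J) = finrank (GenField n) ↥(A ⊓ tangSum r K)) :
    A ⊓ tangSum r J' = A ⊓ tangSum r J := by
  have key : ∀ J₁ b, 0 ∉ J₁ → b ≠ 0 → b ∉ J₁ → J₁.card = J.card →
      A ⊓ tangSum r J₁ = A ⊓ tangSum r (insert b J₁) := by
    intro J₁ b h0 hb hb₁ hc₁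
    refine Submodule.eq_of_le_of_finrank_eq
      (inf_le_inf_left _ (tangSum_mono (Finset.subset_insert _ _))) ?_
    rw [finrank_inf_tangSum_eq hA h0 hJ hc₁, h]
    refine finrank_inf_tangSum_eq hA hK ?_ ?_
    · simp [h0, hb.symm]
    · rw [Finset.card_insert_of_notMem hb₁, hc₁, hc]
  refine (exchange (Z := {0}) (P := fun J' => J'.card = J.card ∧ A ⊓ tangSum r J' =
    A ⊓ tangSum r J) (J := J) ?_ (by simpa) (by simpa) hc' ⟨rfl, rfl⟩).2
  rintro J₁ a b hJ0 ha hb hb0 ⟨hc₁, hP⟩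
  have h0 : 0 ∉ J₁ := by simpa using hJ0
  have hb0' : b ≠ 0 := by simpa using hb0
  have ha0 : a ≠ 0 := fun h => h0 (h ▸ ha)
  have hcard : (insert b (J₁.erase a)).card = J.card := by
    rw [Finset.card_insert_of_notMem (by simp [hb]), Finset.card_erase_of_mem ha, ← hc₁]
    have := Finset.card_pos.2 ⟨a, ha⟩
    omega
  refine ⟨hcard, ?_⟩
  have hab : a ≠ b := fun h => hb (h ▸ ha)
  rw [← hP, key J₁ b h0 hb0' hb hc₁, key (insert b (J₁.erase a)) a (by simp [h0, hb0'.symm]) ha0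
    (by simp [hab]) hcard, Finset.insert_comm, Finset.insert_erase ha]

theorem tangSum_eq_top {A : Submodule (GenField n) (Mon n (r + 4) → GenField n)} (hn : 0 < n)
    (hA : IsFixed A) {J K : Finset ℕ} (hJ : 0 ∉ J) (hK : 0 ∉ K) (hc : K.card = J.card + 1)
    (h : finrank (GenField n) ↥(A ⊓ tangSum r J) = finrank (GenField n) ↥(A ⊓ tangSum r K))
    (hne : A ⊓ tangSum r J ≠ ⊥) : (tangSum r J : Submodule (GenField n) _) = ⊤ := by
  obtain ⟨S, hS, hSc⟩ := Infinite.exists_superset_card_eq (insert 0 J)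
    ((insert 0 J).card + J.card) (by omega)
  set J' := S \ insert 0 J with hJ'
  have hJ'c : J'.card = J.card := by rw [hJ', Finset.card_sdiff_of_subset hS]; omega
  have hJ'0 : 0 ∉ J' := by simp [hJ']
  have hdisj : ∀ i ∈ J', i ∉ J := fun i hi => by
    simp only [hJ', Finset.mem_sdiff, Finset.mem_insert] at hi; tauto
  have heq := inf_tangSum_eq_of_finrank_eq hA hJ hK hJ'0 hc hJ'c.symm h
  have hact : ∀ g : Matrix (Fin n) (Fin n) ℂ, IsUnit g → ∀ v ∈ A ⊓ tangSum r J,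
      actForm (r + 4) (GenField n) g v ∈ tangSum r J := by
    intro g hg v hv
    obtain ⟨g', hg'⟩ := hg
    obtain ⟨σ, hσ, hσ'⟩ := exists_algEquiv_act J (n := n) (g := g'.2) ⟨g'⁻¹, rfl⟩
    have h1 : conj σ (A ⊓ tangSum r J) = A ⊓ tangSum r J := by
      rw [← heq, map_inf, hA σ (hσ' 0 hJ),
        conj_tangSum_of_fixed fun i hi => hσ' i (hdisj i hi)]
    have h2 : v ∈ conj σ (tangSum r J) := by
      rw [← h1, map_inf] at hv
      exact hv.2
    obtain ⟨w, hw, rfl⟩ := conj_tangSum_le ⟨g'⁻¹, rfl⟩ hσ h2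
    rw [actForm_actForm]
    subst hg'
    rw [Units.inv_mul, actForm_one]
    exact hw
  let Z : Submodule (GenField n) (Mon n (r + 4) → GenField n) :=
    { carrier := {v | ∀ g : Matrix (Fin n) (Fin n) ℂ, IsUnit g →
        actForm (r + 4) (GenField n) g v ∈ tangSum r J}
      add_mem' := fun {v w} hv hw g hg => by rw [map_add]; exact add_mem (hv g hg) (hw g hg)
      zero_mem' := fun g _ => by rw [map_zero]; exact zero_mem _
      smul_mem' := fun c v hv g hg => by rw [map_smul]; exact Submodule.smul_mem _ c (hv g hg) }
  have hZ : Z = ⊤ := by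
    refine eq_top_of_invariant hn ?_ ?_
    · intro g hg v hv g₁ hg₁
      rw [actForm_actForm]
      exact hv _ (hg.mul hg₁)
    · intro hbot
      apply hne
      rw [eq_bot_iff, ← hbot]
      exact fun v hv g hg => hact g hg v hv
  rw [eq_top_iff, ← hZ]
  intro v hv
  simpa [actForm_one] using hv 1 isUnit_one

theorem finrank_tang (i : ℕ) :
    finrank (GenField n) ↥(tang r i : Submodule (GenField n) _) =
      finrank (GenField n) ↥(tang r 0 : Submodule (GenField n) _) := by
  obtain ⟨σ, hσ⟩ := exists_algEquiv_perm (n := n) (Equiv.swap i 0)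
  rw [← finrank_conj σ (tang r i), conj_tang (hσ i), Equiv.swap_apply_left]

theorem finrank_tang_le (i : ℕ) :
    finrank (GenField n) ↥(tang r i : Submodule (GenField n) _) ≤ n * (n + 3) / 2 := by
  refine (LinearMap.finrank_range_le _).trans ?_
  rw [finrank_fintype_fun_eq_card, card_coord]

theorem finrank_tang_inf {J : Finset ℕ} {b : ℕ} (h0 : 0 ∉ J) (hb : b ∉ J) :
    finrank (GenField n) ↥(tang r b ⊓ tangSum r J : Submodule (GenField n) _) =
      finrank (GenField n) ↥(tang r 0 ⊓ tangSum r J : Submodule (GenField n) _) := by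
  obtain ⟨σ, hσ⟩ := exists_algEquiv_perm (n := n) (Equiv.swap b 0)
  rw [← finrank_conj σ (tang r b ⊓ tangSum r J), map_inf, conj_tang (hσ b), conj_tangSum hσ,
    Equiv.swap_apply_left, map_swap_of_notMem hb h0]

theorem finrank_tangSum_le (J : Finset ℕ) :
    finrank (GenField n) ↥(tangSum r J : Submodule (GenField n) _) ≤
      J.card * (n * (n + 3) / 2) := by
  induction J using Finset.induction_on with
  | empty =>
    have h : (tangSum r ∅ : Submodule (GenField n) _) = ⊥ := by
      simp only [tangSum, Finset.notMem_empty, iSup_false, iSup_bot]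
    rw [h, finrank_bot]
    exact Nat.zero_le _
  | insert a J ha ih =>
    rw [tangSum_insert, Finset.card_insert_of_notMem ha, add_mul, one_mul]
    exact (Submodule.finrank_add_le_finrank_add_finrank _ _).trans
      ((add_le_add (finrank_tang_le a) ih).trans_eq (add_comm _ _))

/-- A fixed space containing the tangent space at the generic point of index `0` and not much
larger than it meets few generic tangent spaces trivially. -/
theorem inf_tangSum_eq_bot {A : Submodule (GenField n) (Mon n (r + 4) → GenField n)} (hn : 0 < n)
    (hA : IsFixed A) (h0 : tang r 0 ≤ A) {N j e : ℕ} (hN : N = n * (n + 3) / 2)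
    (hAe : finrank (GenField n) ↥A ≤
      finrank (GenField n) ↥(tang r 0 : Submodule (GenField n) (Mon n (r + 4) → _)) + e)
    (hD : 2 * ((j + e) * N) + N * (N - 1) < 2 * (n + (r + 4) - 1).choose (r + 4))
    {J : Finset ℕ} (hJ : 0 ∉ J) (hj : J.card ≤ j) : A ⊓ tangSum r J = ⊥ := by
  by_contra hne
  have hchain : ∃ K : ℕ → Finset ℕ, K 0 = J ∧ ∀ i, 0 ∉ K i ∧
      ∃ b, b ≠ 0 ∧ b ∉ K i ∧ K (i + 1) = insert b (K i) := by
    choose b hb using fun s : Finset ℕ => Infinite.exists_notMem_finset (insert 0 s)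
    have hb0 : ∀ s, b s ≠ 0 := fun s h => hb s (by simp [h])
    refine ⟨fun i => (fun s => insert (b s) s)^[i] J, rfl, fun i => ⟨?_, ?_⟩⟩
    · induction i with
      | zero => exact hJ
      | succ i ih =>
        simp only [Function.iterate_succ_apply', Finset.mem_insert, not_or]
        exact ⟨(hb0 _).symm, ih⟩
    · refine ⟨_, hb0 _, fun h => hb _ (Finset.mem_insert_of_mem h), ?_⟩
      simp only [Function.iterate_succ_apply']
  obtain ⟨K, rfl, hK⟩ := hchain
  choose hK0 b hb0 hbK hKs using hK
  have hcard : ∀ i, (K (i + 1)).card = (K i).card + 1 := fun i => by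
    rw [hKs, Finset.card_insert_of_notMem (hbK i)]
  have hmono : ∀ i, A ⊓ tangSum r (K i) ≤ A ⊓ tangSum r (K (i + 1)) := fun i =>
    inf_le_inf_left _ (tangSum_mono (by rw [hKs]; exact Finset.subset_insert _ _))
  set N0 := finrank (GenField n) ↥(tang r 0 : Submodule (GenField n) (Mon n (r + 4) → _))
  have hN0 : N0 ≤ N := hN ▸ finrank_tang_le 0
  set a : ℕ → ℕ := fun i => finrank (GenField n) ↥(A ⊓ tangSum r (K i)) with ha
  set f : ℕ → ℕ := fun i =>
    finrank (GenField n) ↥(tangSum r (K i) : Submodule (GenField n) _) with hf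
  have haN : ∀ i, a i ≤ N0 + e := fun i => (Submodule.finrank_mono inf_le_left).trans hAe
  have hnb : ∀ i, A ⊓ tangSum r (K i) ≠ ⊥ := by
    intro i
    induction i with
    | zero => exact hne
    | succ i ih => exact fun h => ih (eq_bot_iff.2 (h ▸ hmono i))
  have hgrow : ∀ t, (∀ i < t, (tangSum r (K i) : Submodule (GenField n) _) ≠ ⊤) →
      ∀ i ≤ t, i + 1 ≤ a i := by
    intro t ht i
    induction i with
    | zero => exact fun _ => Nat.one_le_iff_ne_zero.2 fun h => hnb 0 (Submodule.finrank_eq_zero.1 h)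
    | succ i ih =>
      intro hi
      have h1 := ih (by omega)
      have h2 : a i ≤ a (i + 1) := Submodule.finrank_mono (hmono i)
      have h3 : a i ≠ a (i + 1) := fun h =>
        ht i (by omega) (tangSum_eq_top hn hA (hK0 i) (hK0 (i + 1)) (hcard i) h (hnb i))
      omega
  have hf0 : f 0 ≤ (K 0).card * N := hN ▸ finrank_tangSum_le _
  have hstep : ∀ i, f (i + 1) + a i ≤ f i + N + e := by
    intro i
    have h1 := Submodule.finrank_sup_add_finrank_inf_eq (tang r (b i) : Submodule (GenField n) _)
      (tangSum r (K i))
    rw [finrank_tang_inf (hK0 i) (hbK i), ← tangSum_insert, ← hKs, finrank_tang] at h1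
    have h2 := Submodule.finrank_sup_add_finrank_inf_eq (tang r 0) (A ⊓ tangSum r (K i))
    rw [← inf_assoc, inf_eq_left.2 h0] at h2
    have h3 : finrank (GenField n) ↥(tang r 0 ⊔ A ⊓ tangSum r (K i)) ≤ N0 + e :=
      (Submodule.finrank_mono (sup_le h0 inf_le_left)).trans hAe
    simp only [hf, ha]
    omega
  have hstep' : ∀ i, f (i + 1) ≤ f i + N := by
    intro i
    have h1 := Submodule.finrank_add_le_finrank_add_finrank
      (tang r (b i) : Submodule (GenField n) _) (tangSum r (K i))
    have h2 := finrank_tang_le (n := n) (r := r) (b i)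
    rw [← tangSum_insert, ← hKs] at h1
    simp only [hf]
    omega
  have hex : ∃ t, (tangSum r (K t) : Submodule (GenField n) _) = ⊤ := by
    by_contra! h
    have h1 := hgrow (N0 + e) (fun i _ => h i) _ le_rfl
    have := haN (N0 + e)
    omega
  classical
  have ht := Nat.find_spec hex
  set t := Nat.find hex
  have hlt : ∀ i < t, (tangSum r (K i) : Submodule (GenField n) _) ≠ ⊤ :=
    fun i hi => Nat.find_min hex hi
  have hat := hgrow t hlt
  have htN : t < N + e := by have := hat t le_rfl; have := haN t; omega
  have hft : f t = (n + (r + 4) - 1).choose (r + 4) := by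
    simp only [hf]
    rw [ht, finrank_top, finrank_fintype_fun_eq_card, card_mon]
  have hb1 : ∀ i ≤ t, f i ≤ ((K 0).card + i) * N := by
    intro i
    induction i with
    | zero => simpa using hf0
    | succ i ih =>
      intro hi
      have h1 := ih (by omega)
      have h2 := hstep' i
      nlinarith
  have hb2 : ∀ i, e + i ≤ t → 2 * f (e + i) + i * (i + 1) ≤
      2 * (((K 0).card + e) * N) + 2 * i * N := by
    intro i
    induction i with
    | zero => intro hi; have := hb1 e (by omega); simpa using this
    | succ i ih =>
      intro hi
      have h1 := ih (by omega)
      have h2 := hstep (e + i)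
      have h3 := hat (e + i) (by omega)
      rw [← add_assoc e i 1]
      nlinarith
  have hjN : (K 0).card * N ≤ j * N := Nat.mul_le_mul_right _ hj
  rcases le_or_gt t e with hte | hte
  · have h1 := hb1 t le_rfl
    have h2 : t * N ≤ e * N := Nat.mul_le_mul_right _ hte
    have h3 : 0 ≤ N * (N - 1) := Nat.zero_le _
    nlinarith
  · obtain ⟨i, hi⟩ := Nat.exists_eq_add_of_lt hte
    rw [add_assoc] at hi
    have h1 := hb2 (i + 1) (by omega)
    rw [← hi] at h1
    obtain ⟨c, hc⟩ : ∃ c, N = i + 1 + c + 1 := ⟨N - (i + 2), by omega⟩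
    have h2 : N - 1 = i + 1 + c := by omega
    rw [h2] at hD
    have h3 : 2 * (i + 1) * N ≤ N * (i + 1 + c) + (i + 1) * (i + 1 + 1) := by
      rw [hc]; nlinarith
    nlinarith

end Growth

section GeneralPair
variable {n : ℕ} {F : Type*} [Field F]

theorem eq_sum_of_isHomogeneous_one {p : MvPolynomial (Fin n) F} (hp : p.IsHomogeneous 1) :
    p = ∑ j, C (coeff (Finsupp.single j 1) p) * X j := by
  classical
  have h := hp.sum_X_mul_pderiv
  rw [one_smul] at h
  conv_lhs => rw [← h]
  refine Finset.sum_congr rfl fun j _ => ?_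
  obtain ⟨c, hc⟩ := exists_C_of_isHomogeneous_zero (hp.pderiv (i := j))
  have h2 : coeff 0 (pderiv j p) = coeff (Finsupp.single j 1) p := by
    rw [coeff_pderiv]; simp
  rw [hc, coeff_zero_C] at h2
  rw [hc, h2, mul_comm]

theorem eval_of_isHomogeneous_one {p : MvPolynomial (Fin n) F} (hp : p.IsHomogeneous 1)
    (w : Fin n → F) : eval w p = (fun j => coeff (Finsupp.single j 1) p) ⬝ᵥ w := by
  conv_lhs => rw [eq_sum_of_isHomogeneous_one hp]
  simp [dotProduct]

/-- The matrix of the polar form of a quadratic form. -/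
def gram {F : Type*} [CommRing F] (q : MvPolynomial (Fin n) F) : Matrix (Fin n) (Fin n) F :=
  Matrix.of fun i j => coeff (Finsupp.single j 1) (pderiv i q)

theorem map_gram {F F' : Type*} [CommRing F] [CommRing F'] (f : F →+* F')
    (q : MvPolynomial (Fin n) F) : gram (map f q) = (gram q).map f := by
  ext i j
  simp [gram, pderiv_map, coeff_map]

theorem gram_sum_sq [CharZero F] : (gram (∑ i, X i ^ 2 : MvPolynomial (Fin n) F)).det ≠ 0 := by
  classical
  have : gram (∑ i, X i ^ 2 : MvPolynomial (Fin n) F) = (2 : F) • 1 := by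
    ext i j
    have h : pderiv i (∑ i, X i ^ 2 : MvPolynomial (Fin n) F) = C 2 * X i := by
      rw [map_sum, Finset.sum_eq_single i]
      · simp [map_ofNat]
      · intro b _ hb
        rw [pderiv_pow, pderiv_X_of_ne hb, mul_zero]
      · simp
    rw [gram, Matrix.of_apply, h, coeff_C_mul, coeff_X]
    simp [Matrix.one_apply, Finsupp.single_left_inj, eq_comm]
  rw [this, Matrix.det_smul, Matrix.det_one, mul_one]
  exact pow_ne_zero _ two_ne_zero

theorem exists_ne_zero_eval_eq_zero {k : ℕ} (hk : k < n) (f : Fin k → MvPolynomial (Fin n) F)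
    (hf : ∀ i, (f i).IsHomogeneous 1) : ∃ w : Fin n → F, w ≠ 0 ∧ ∀ i, eval w (f i) = 0 := by
  let T : (Fin n → F) →ₗ[F] (Fin k → F) :=
    Matrix.mulVecLin (Matrix.of fun i j => coeff (Finsupp.single j 1) (f i))
  have hT : LinearMap.ker T ≠ ⊥ := LinearMap.ker_ne_bot_of_finrank_lt (by simpa using hk)
  obtain ⟨w, hw, hw0⟩ := (Submodule.ne_bot_iff _).1 hT
  refine ⟨w, hw0, fun i => ?_⟩
  rw [eval_of_isHomogeneous_one (hf i)]
  exact congrFun hw i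

theorem ne_mul_add_mul (hn : 5 ≤ n) {q f g l k : MvPolynomial (Fin n) F}
    (hdet : (gram q).det ≠ 0) (hq : q.IsHomogeneous 2)
    (hf : f.IsHomogeneous 1) (hg : g.IsHomogeneous 1) (hl : l.IsHomogeneous 1)
    (hk : k.IsHomogeneous 1) : q ≠ f * g + l * k := by
  intro h
  obtain ⟨w, hw0, hw⟩ := exists_ne_zero_eval_eq_zero (k := 4) (by omega) ![f, g, l, k]
    (by intro i; fin_cases i <;> assumption)
  have h0 := hw 0
  have h1 := hw 1
  have h2 := hw 2
  have h3 := hw 3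
  simp only [Matrix.cons_val] at h0 h1 h2 h3
  refine hdet (Matrix.exists_mulVec_eq_zero_iff.1 ⟨w, hw0, funext fun i => ?_⟩)
  have := eval_of_isHomogeneous_one (hq.pderiv (i := i)) w
  refine Eq.trans this.symm ?_
  rw [h]
  simp [h0, h1, h2, h3]

theorem isGeneralPair_of_det_ne_zero (hn : 5 ≤ n) {l q : MvPolynomial (Fin n) F}
    (hl : l.IsHomogeneous 1) (hl0 : l ≠ 0) (hq : q.IsHomogeneous 2)
    (hdet : (gram q).det ≠ 0) : IsGeneralPair l q := by
  have hirr : Irreducible l := by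
    refine irreducible_of_totalDegree_eq_one (hl.totalDegree hl0) fun x hx => ?_
    obtain ⟨e, he⟩ := ne_zero_iff.1 hl0
    exact isUnit_iff_ne_zero.2 fun h0 => he (zero_dvd_iff.1 (h0 ▸ hx e))
  have hnd : ¬ l ∣ q := by
    intro h
    obtain ⟨k, hk, hqk⟩ := exists_isHomogeneous_of_dvd hl (j := 1) hq h
    exact ne_mul_add_mul hn hdet hq (isHomogeneous_zero _ _ _) (isHomogeneous_zero _ _ _) hl hk
      (by rw [hqk]; ring)
  refine ⟨hl, hq, hirr.prime, ?_, hnd, ?_⟩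
  · obtain ⟨i₀, hi₀⟩ : ∃ i, coeff (Finsupp.single i 1) l ≠ 0 := by
      by_contra! h
      exact hl0 (by rw [eq_sum_of_isHomogeneous_one hl]; simp [h])
    set a := coeff (Finsupp.single i₀ 1) l with ha
    let ψ : MvPolynomial (Fin n) F →ₐ[F] MvPolynomial (Fin n) F :=
      aeval fun i => X i - C (if i = i₀ then a⁻¹ else 0) * l
    have hψl : ψ l = 0 := by
      have h1 : ψ l = ∑ j, C (coeff (Finsupp.single j 1) l) *
          (X j - C (if j = i₀ then a⁻¹ else 0) * l) := by
        conv_lhs => rw [eq_sum_of_isHomogeneous_one hl]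
        simp [ψ, algebraMap_eq]
      rw [h1]
      simp only [mul_sub, Finset.sum_sub_distrib]
      rw [← eq_sum_of_isHomogeneous_one hl, Finset.sum_eq_single i₀, if_pos rfl, ← mul_assoc,
        ← C_mul, mul_inv_cancel₀ hi₀, C_1, one_mul, sub_self]
      · intro b _ hb; simp [hb]
      · simp
    have hψd : ∀ p, l ∣ p - ψ p := by
      intro p
      have : (Ideal.Quotient.mkₐ F (Ideal.span {l})).comp ψ = Ideal.Quotient.mkₐ F _ := by
        apply algHom_ext
        intro i
        simp only [AlgHom.comp_apply, ψ, aeval_X, Ideal.Quotient.mkₐ_eq_mk]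
        rw [Ideal.Quotient.eq, Ideal.mem_span_singleton]
        exact ⟨- C (if i = i₀ then a⁻¹ else 0), by ring⟩
      have h := DFunLike.congr_fun this p
      simp only [AlgHom.comp_apply, Ideal.Quotient.mkₐ_eq_mk] at h
      rw [eq_comm, Ideal.Quotient.eq, Ideal.mem_span_singleton] at h
      exact h
    have hψq : (ψ q).IsHomogeneous 2 := by
      have := hq.aeval (fun i => X i - C (if i = i₀ then a⁻¹ else 0) * l) (n := 1)
        (fun i => (isHomogeneous_X F i).sub (hl.C_mul _))
      rwa [one_mul] at this
    obtain ⟨κ, hκ, hqκ⟩ := exists_isHomogeneous_of_dvd hl (j := 1) (hq.sub hψq) (hψd q)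
    have hq0 : ψ q ≠ 0 := fun h0 => hnd (by simpa [h0] using hψd q)
    have hirrq : Irreducible (ψ q) := by
      refine ⟨fun hu => ?_, fun f g hfg => ?_⟩
      · have h1 := (isUnit_iff_totalDegree_of_isReduced.1 hu).2
        rw [hψq.totalDegree hq0] at h1
        omega
      · have hf0 : f ≠ 0 := left_ne_zero_of_mul (hfg ▸ hq0)
        have hg0 : g ≠ 0 := right_ne_zero_of_mul (hfg ▸ hq0)
        have hdeg : f.totalDegree + g.totalDegree = 2 := by
          rw [← totalDegree_mul_of_isDomain hf0 hg0, ← hfg, hψq.totalDegree hq0]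
        have hunit : ∀ p : MvPolynomial (Fin n) F, p ≠ 0 → p.totalDegree = 0 → IsUnit p := by
          intro p hp hd
          rw [totalDegree_eq_zero_iff_eq_C.1 hd] at hp ⊢
          exact (isUnit_iff_ne_zero.2 fun h => hp (by rw [h, C_0])).map C
        by_contra! hcon
        have h1 : f.totalDegree ≠ 0 := fun h => hcon.1 (hunit f hf0 h)
        have h2 : g.totalDegree ≠ 0 := fun h => hcon.2 (hunit g hg0 h)
        have hdec : ∀ p : MvPolynomial (Fin n) F, p.totalDegree = 1 →
            p = homogeneousComponent 0 p + homogeneousComponent 1 p := by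
          intro p hp
          conv_lhs => rw [← sum_homogeneousComponent p, hp]
          simp [Finset.sum_range_succ]
        have hf := hdec f (by omega)
        have hg := hdec g (by omega)
        have f0 := homogeneousComponent_isHomogeneous 0 f
        have f1 := homogeneousComponent_isHomogeneous 1 f
        have g0 := homogeneousComponent_isHomogeneous 0 g
        have g1 := homogeneousComponent_isHomogeneous 1 g
        set fa := homogeneousComponent 0 f
        set fb := homogeneousComponent 1 f
        set ga := homogeneousComponent 0 g
        set gb := homogeneousComponent 1 g
        have hcomp : ψ q = fb * gb := by
          rw [← homogeneousComponent_eq_self hψq, hfg, hf, hg,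
            show (fa + fb) * (ga + gb) = fa * ga + fa * gb + fb * ga + fb * gb by ring]
          simp only [map_add]
          rw [homogeneousComponent_of_mem (f0.mul g0), homogeneousComponent_of_mem (f0.mul g1),
            homogeneousComponent_of_mem (f1.mul g0), homogeneousComponent_of_mem (f1.mul g1)]
          simp
        exact ne_mul_add_mul hn hdet hq f1 g1 hl hκ (by rw [← hcomp, ← hqκ]; ring)
    have hprime := hirrq.prime
    have hback : ∀ p, ψ q ∣ ψ p → p ∈ Ideal.span {l, q} := by
      rintro p ⟨t, ht⟩
      obtain ⟨s, hs⟩ := hψd p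
      rw [Ideal.mem_span_pair]
      exact ⟨s - t * κ, t, by linear_combination (-1 : MvPolynomial (Fin n) F) * hs - ht + t * hqκ⟩
    have hforw : ∀ p, p ∈ Ideal.span {l, q} → ψ q ∣ ψ p := by
      intro p hp
      obtain ⟨s, t, rfl⟩ := Ideal.mem_span_pair.1 hp
      exact ⟨ψ t, by rw [map_add, map_mul, map_mul, hψl]; ring⟩
    refine ⟨fun htop => ?_, fun {x y} hxy => ?_⟩
    · have := hforw 1 (htop ▸ Submodule.mem_top)
      rw [map_one] at this
      exact hprime.not_isUnit (isUnit_of_dvd_one this)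
    · have := hforw _ hxy
      rw [map_mul] at this
      exact (hprime.dvd_or_dvd this).imp (hback x) (hback y)
  · by_contra! h
    obtain ⟨w, hw0, hw⟩ := exists_ne_zero_eval_eq_zero (k := 1) (by omega) (fun _ => l)
      (fun _ => hl)
    refine hw0 (funext fun i => ?_)
    obtain ⟨c, hc⟩ := h i
    have := congrArg (eval w) hc
    rwa [map_mul, hw 0, zero_mul, eval_X] at this

end GeneralPair

variable {n : ℕ}

theorem isGeneralPair_gen (hn : 5 ≤ n) (i : ℕ) :
    IsGeneralPair (lin n (GenField n) (gen i)) (quad n (GenField n) (gen i)) := by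
  have hspec : ∀ p : MvPolynomial (ℕ × Coord n) ℂ, algebraMap _ (GenField n) p = 0 → p = 0 :=
    fun p hp => (map_eq_zero_iff _ (IsFractionRing.injective _ (GenField n))).1 hp
  refine isGeneralPair_of_det_ne_zero hn (isHomogeneous_lin _) ?_ (isHomogeneous_quad _) ?_
  · intro h
    let e : Mon n 1 := ⟨Finsupp.single ⟨0, by omega⟩ 1, by simp⟩
    have h1 := coeff_form (fun e => gen i (Sum.inl e) : Mon n 1 → GenField n) e
    have h2 : form n 1 (GenField n) (fun e => gen i (Sum.inl e)) = 0 := h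
    rw [h2, coeff_zero, gen] at h1
    exact X_ne_zero _ (hspec _ h1.symm)
  · intro h
    set u : Coord n → MvPolynomial (ℕ × Coord n) ℂ := fun k => X (i, k)
    have h1 := map_quad (algebraMap (MvPolynomial (ℕ × Coord n) ℂ) (GenField n)) u
    change map _ _ = quad n (GenField n) (gen i) at h1
    rw [← h1, map_gram, ← RingHom.mapMatrix_apply, ← RingHom.map_det] at h
    have h2 := hspec _ h
    let p₀ : Coord n → ℂ := point 0 (∑ i, X i ^ 2)
    let ev : MvPolynomial (ℕ × Coord n) ℂ →+* ℂ := eval fun p => p₀ p.2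
    have h3 := congrArg ev h2
    have hev : (fun k => ev (u k)) = p₀ := by funext k; simp [ev, u]
    rw [map_zero, RingHom.map_det, RingHom.mapMatrix_apply, ← map_gram, map_quad, hev,
      quad_point] at h3
    · exact gram_sum_sq h3
    · refine IsHomogeneous.sum _ _ _ fun i _ => ?_
      simpa using (isHomogeneous_X ℂ i).pow 2

section Contact
open Module
variable {n r K m N : ℕ}

variable (n r) in
/-- Any `K + 1` generic tangent spaces are independent. -/
def TangIndep (K : ℕ) : Prop :=
  ∀ (J : Finset ℕ) (i : ℕ), i ∉ J → J.card ≤ K →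
    (tang r i ⊓ tangSum r J : Submodule (GenField n) (Mon n (r + 4) → GenField n)) = ⊥

theorem tangIndep (hn : 0 < n) (hN : N = n * (n + 3) / 2)
    (hD : N * (m + 1 + N) ≤ (n + (r + 4) - 1).choose (r + 4)) (hN0 : 0 < N) :
    TangIndep n r (m + N / 2) := by
  have key : ∀ J : Finset ℕ, 0 ∉ J → J.card ≤ m + N / 2 →
      (tang r 0 ⊓ tangSum r J : Submodule (GenField n) (Mon n (r + 4) → GenField n)) = ⊥ := by
    intro J hJ hc
    refine inf_tangSum_eq_bot hn isFixed_tang le_rfl hN (e := 0) le_rfl ?_ hJ hc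
    obtain ⟨M, rfl⟩ : ∃ M, N = M + 1 := ⟨N - 1, by omega⟩
    have h2 : 2 * ((M + 1) / 2) ≤ M + 1 := Nat.mul_div_le _ _
    rw [Nat.add_sub_cancel]
    nlinarith
  intro J i hi hc
  obtain ⟨σ, hσ⟩ := exists_algEquiv_perm (n := n) (Equiv.swap i 0)
  apply (conj σ).injective
  rw [map_bot, map_inf, conj_tang (hσ i), conj_tangSum hσ, Equiv.swap_apply_left]
  refine key _ ?_ (by rwa [Finset.card_map])
  rw [Finset.mem_map_equiv, Equiv.symm_swap, Equiv.swap_apply_right]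
  exact hi

theorem tangSum_inf_le (hK : TangIndep n r K) {J₁ J₂ : Finset ℕ} (hc : (J₁ ∪ J₂).card ≤ K + 1) :
    (tangSum r J₁ ⊓ tangSum r J₂ : Submodule (GenField n) (Mon n (r + 4) → GenField n)) ≤
      tangSum r (J₁ ∩ J₂) := by
  obtain ⟨k, hk⟩ : ∃ k, (J₁ \ J₂).card = k := ⟨_, rfl⟩
  induction k generalizing J₁ with
  | zero =>
    have h1 : J₁ ⊆ J₂ := Finset.sdiff_eq_empty_iff_subset.1 (Finset.card_eq_zero.1 hk)
    rw [Finset.inter_eq_left.2 h1]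
    exact inf_le_left
  | succ k ih =>
    obtain ⟨b, hb⟩ : (J₁ \ J₂).Nonempty := by rw [← Finset.card_pos]; omega
    rw [Finset.mem_sdiff] at hb
    have hJ : J₁.erase b ∩ J₂ = J₁ ∩ J₂ := by
      ext x; simp only [Finset.mem_inter, Finset.mem_erase]; grind
    have hd : J₁.erase b \ J₂ = (J₁ \ J₂).erase b := by
      ext x; simp only [Finset.mem_sdiff, Finset.mem_erase]; grind
    rintro x ⟨hx₁, hx₂⟩
    have hx₁' := hx₁
    rw [SetLike.mem_coe, ← Finset.insert_erase hb.1, tangSum_insert, Submodule.mem_sup] at hx₁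
    obtain ⟨t, ht, y, hy, rfl⟩ := hx₁
    have ht' : t ∈ tangSum r ((J₁ ∪ J₂).erase b) := by
      have h1 := Submodule.sub_mem _ (tangSum_mono (J' := (J₁ ∪ J₂).erase b) ?_ hx₂)
        (tangSum_mono (J' := (J₁ ∪ J₂).erase b) ?_ hy)
      · simpa using h1
      · intro z hz; simp only [Finset.mem_erase, Finset.mem_union]; grind
      · exact Finset.erase_subset_erase _ Finset.subset_union_left
    have ht0 : t = 0 := by
      have h1 : t ∈ tang r b ⊓ tangSum r ((J₁ ∪ J₂).erase b) := ⟨ht, ht'⟩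
      rw [hK _ _ (Finset.notMem_erase _ _)] at h1
      · exact h1
      · rw [Finset.card_erase_of_mem (Finset.mem_union_left _ hb.1)]
        omega
    rw [ht0, zero_add] at hx₂ ⊢
    rw [← hJ]
    refine ih ?_ ?_ ⟨hy, hx₂⟩
    · exact (Finset.card_le_card (Finset.union_subset_union_left
        (Finset.erase_subset _ _))).trans hc
    · rw [hd, Finset.card_erase_of_mem (by simp [hb]), hk]
      rfl

variable (r) in
/-- The tangent vectors at the generic point of index `0` whose second fundamental form takes
values in the sum of the tangent spaces at the generic points with index in `J` or `0`. -/
def contact (J : Finset ℕ) : Submodule (GenField n) (Coord n → GenField n) :=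
  ⨅ w, (tangSum r (insert 0 J)).comap ((hess r (gen 0)).flip w)

theorem mem_contact {J : Finset ℕ} {u : Coord n → GenField n} :
    u ∈ contact r J ↔ ∀ w, hess r (gen 0) u w ∈ tangSum r (insert 0 J) := by
  simp [contact]

theorem contact_mono {J J' : Finset ℕ} (h : J ⊆ J') :
    (contact r J : Submodule (GenField n) _) ≤ contact r J' := fun _ hu =>
  mem_contact.2 fun w => tangSum_mono (Finset.insert_subset_insert 0 h) (mem_contact.1 hu w)

theorem euler_mem_contact (J : Finset ℕ) : euler (gen 0 : Coord n → _) ∈ contact r J :=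
  mem_contact.2 fun w => tang_le_tangSum (Finset.mem_insert_self 0 J) (hess_euler_mem r _ w)

theorem contact_inf (hK : TangIndep n r K) {J₁ J₂ : Finset ℕ}
    (hc : (insert 0 (J₁ ∪ J₂)).card ≤ K + 1) :
    (contact r J₁ ⊓ contact r J₂ : Submodule (GenField n) _) = contact r (J₁ ∩ J₂) := by
  refine le_antisymm (fun u hu => mem_contact.2 fun w => ?_)
    (le_inf (contact_mono Finset.inter_subset_left) (contact_mono Finset.inter_subset_right))
  rw [Finset.insert_inter_distrib]
  refine tangSum_inf_le hK ?_ ⟨mem_contact.1 hu.1 w, mem_contact.1 hu.2 w⟩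
  rwa [← Finset.insert_union_distrib]

theorem conj_contact {σ : GenField n ≃ₐ[ℂ] GenField n} {π : Equiv.Perm ℕ} (h0 : π 0 = 0)
    (h : ∀ i, (fun k => σ (gen i k)) = gen (π i)) (J : Finset ℕ) :
    conj σ (contact r J) = contact r (J.map π.toEmbedding) := by
  ext u
  have hins : (insert 0 J).map π.toEmbedding = insert 0 (J.map π.toEmbedding) := by
    rw [Finset.map_insert]; simp [h0]
  rw [mem_conj, mem_contact, mem_contact, ← hins, ← conj_tangSum h]
  have key : ∀ w, (fun e => σ (hess r (gen 0) (fun e => σ.symm (u e)) w e)) =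
      hess r (gen 0) u (fun k => σ (w k)) := by
    intro w
    have := map_hess (σ : GenField n →ₐ[ℂ] GenField n) r (gen 0) (fun e => σ.symm (u e)) w
    simp only [AlgEquiv.coe_toAlgHom, AlgEquiv.apply_symm_apply, h, h0] at this
    exact this
  constructor
  · intro hu w
    have h1 := key fun k => σ.symm (w k)
    simp only [AlgEquiv.apply_symm_apply] at h1
    rw [← h1, map_mem_conj]
    exact hu _
  · intro hu w
    rw [← map_mem_conj (σ := σ), key]
    exact hu _

variable (n r) in
/-- The dimension of `contact r J` for `J` of cardinality `k`. -/
def contactDim (k : ℕ) : ℕ :=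
  finrank (GenField n) ↥(contact r (Finset.Icc 1 k) : Submodule (GenField n) (Coord n → _))

theorem finrank_contact {J : Finset ℕ} (hJ : 0 ∉ J) :
    finrank (GenField n) ↥(contact r J : Submodule (GenField n) (Coord n → _)) =
      contactDim n r J.card := by
  refine exchange (Z := {0}) (P := fun J' => finrank (GenField n)
    ↥(contact r J' : Submodule (GenField n) (Coord n → _)) =
    contactDim n r J.card) (J := Finset.Icc 1 J.card) ?_ (by simp) (by simpa) (by simp) rfl
  intro J' a b hJ0 ha hb hb0 hP
  obtain ⟨σ, hσ⟩ := exists_algEquiv_perm (n := n) (Equiv.swap a b)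
  have ha0 : a ≠ 0 := fun h => Finset.disjoint_left.1 hJ0 ha (by simp [h])
  have h0 : Equiv.swap a b 0 = 0 :=
    Equiv.swap_apply_of_ne_of_ne ha0.symm fun h => hb0 (by simp [← h])
  rw [← hP, ← finrank_conj σ (contact r J'), conj_contact h0 hσ, map_swap_of_mem ha hb]

theorem contactDim_convex (hK : TangIndep n r K) {L : Finset ℕ} {a b : ℕ} (h0 : 0 ∉ L)
    (ha0 : a ≠ 0) (hb0 : b ≠ 0) (ha : a ∉ L) (hb : b ∉ L) (hab : a ≠ b) (hc : L.card + 2 ≤ K) :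
    finrank (GenField n) ↥(contact r (insert a L) ⊔ contact r (insert b L) :
      Submodule (GenField n) (Coord n → _)) + contactDim n r L.card =
      2 * contactDim n r (L.card + 1) := by
  have h1 := Submodule.finrank_sup_add_finrank_inf_eq
    (contact r (insert a L) : Submodule (GenField n) (Coord n → _)) (contact r (insert b L))
  have h2 : insert a L ∩ insert b L = L := by
    ext x; simp only [Finset.mem_inter, Finset.mem_insert]; grind
  rw [contact_inf hK, h2, finrank_contact h0, finrank_contact (J := insert a L)
    (by simp [h0, ha0.symm]), finrank_contact (J := insert b L) (by simp [h0, hb0.symm]),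
    Finset.card_insert_of_notMem ha, Finset.card_insert_of_notMem hb] at h1
  · omega
  · have h3 : insert 0 (insert a L ∪ insert b L) = insert 0 (insert a (insert b L)) := by
      ext x; simp only [Finset.mem_union, Finset.mem_insert]; grind
    rw [h3]
    refine (Finset.card_insert_le _ _).trans ?_
    have := Finset.card_insert_le a (insert b L)
    have := Finset.card_insert_le b L
    omega

theorem contact_sup_le (L : Finset ℕ) (a b : ℕ) :
    (contact r (insert a L) ⊔ contact r (insert b L) : Submodule (GenField n) (Coord n → _)) ≤
      contact r (insert a (insert b L)) :=
  sup_le (contact_mono (by intro x; simp only [Finset.mem_insert]; grind))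
    (contact_mono (Finset.subset_insert _ _))

theorem contactDim_add_le (hK : TangIndep n r K) {k : ℕ} (hk : k + 2 ≤ K) :
    2 * contactDim n r (k + 1) ≤ contactDim n r (k + 2) + contactDim n r k := by
  have h := contactDim_convex hK (L := Finset.Icc 1 k) (a := k + 1) (b := k + 2) (by simp)
    (by omega) (by omega) (by simp) (by simp) (by omega) (by simpa using hk)
  have h1 := Submodule.finrank_mono (contact_sup_le (n := n) (r := r) (Finset.Icc 1 k)
    (k + 1) (k + 2))
  rw [finrank_contact (J := insert (k + 1) (insert (k + 2) (Finset.Icc 1 k))) (by simp),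
    Finset.card_insert_of_notMem (by simp), Finset.card_insert_of_notMem (by simp)] at h1
  simp only [Nat.card_Icc, Nat.add_sub_cancel, add_assoc, Nat.reduceAdd] at h h1
  omega

theorem contact_sup_eq (hK : TangIndep n r K) {L : Finset ℕ} {a b : ℕ} (h0 : 0 ∉ L)
    (ha0 : a ≠ 0) (hb0 : b ≠ 0) (ha : a ∉ L) (hb : b ∉ L) (hab : a ≠ b) (hc : L.card + 2 ≤ K)
    (heq : contactDim n r (L.card + 2) + contactDim n r L.card =
      2 * contactDim n r (L.card + 1)) :
    (contact r (insert a L) ⊔ contact r (insert b L) : Submodule (GenField n) (Coord n → _)) =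
      contact r (insert a (insert b L)) := by
  have h := contactDim_convex hK h0 ha0 hb0 ha hb hab hc
  refine Submodule.eq_of_le_of_finrank_eq (contact_sup_le L a b) ?_
  rw [finrank_contact (J := insert a (insert b L)) (by simp [h0, ha0.symm, hb0.symm]),
    Finset.card_insert_of_notMem (by simp [ha, hab]), Finset.card_insert_of_notMem hb,
    add_assoc]
  simp only [Nat.reduceAdd]
  omega

theorem hess_mem_of_contact (hK : TangIndep n r K) {j : ℕ} (hj : j + 2 ≤ K)
    (heq : contactDim n r (j + 2) + contactDim n r j = 2 * contactDim n r (j + 1))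
    {b : ℕ} (hb0 : b ≠ 0) {I' : Finset ℕ} (hI0 : 0 ∉ I') (hbI : b ∉ I') (hIc : I'.card = j + 1)
    {z : Coord n → GenField n} (hz : z ∈ contact r I') {L : Finset ℕ} (hL0 : 0 ∉ L) (hbL : b ∉ L)
    (hLc : L.card = j) {u : Coord n → GenField n} (hu : u ∈ contact r (insert b L)) :
    hess r (gen 0) u z ∈ tangSum r (insert 0 L) := by
  obtain ⟨c, hc⟩ : I'.Nonempty := by rw [← Finset.card_pos]; omega
  have hcard : (I'.erase c).card = j := by rw [Finset.card_erase_of_mem hc]; omega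
  refine (exchange (Z := {0, b}) (P := fun L => L.card = j ∧ ∀ u ∈ contact r (insert b L),
    hess r (gen 0) u z ∈ tangSum r (insert 0 L)) (J := I'.erase c) (J' := L) ?_ ?_ ?_
    (hcard.trans hLc.symm) ⟨hcard, fun u hu => ?_⟩).2 u hu
  · rintro L a a' hLZ ha ha' haZ ⟨hLc, hP⟩
    simp only [Finset.disjoint_insert_right, Finset.disjoint_singleton_right] at hLZ
    simp only [Finset.mem_insert, Finset.mem_singleton, not_or] at haZ
    refine ⟨?_, fun u hu => ?_⟩
    · rw [Finset.card_insert_of_notMem (by simp [ha']), Finset.card_erase_of_mem ha]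
      have := Finset.card_pos.2 ⟨a, ha⟩
      omega
    have hu1 : u ∈ contact r (insert b (insert a' L)) := by
      refine contact_mono ?_ hu
      intro x; simp only [Finset.mem_insert, Finset.mem_erase]; grind
    rw [← contact_sup_eq hK hLZ.1 hb0 haZ.1 hLZ.2 ha' (Ne.symm haZ.2) (by omega)
      (by rw [hLc]; exact heq), Submodule.mem_sup] at hu1
    have hmem1 := mem_contact.1 hu z
    obtain ⟨u₁, hu₁, u₂, hu₂, rfl⟩ := hu1
    have hmem2 : hess r (gen 0) (u₁ + u₂) z ∈ tangSum r (insert 0 (insert a' L)) := by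
      rw [map_add, LinearMap.add_apply]
      refine add_mem (tangSum_mono ?_ (hP u₁ hu₁)) (mem_contact.1 hu₂ z)
      intro x; simp only [Finset.mem_insert]; grind
    have hinter : insert 0 (insert a' L) ∩ insert 0 (insert b (insert a' (L.erase a))) =
        insert 0 (insert a' (L.erase a)) := by
      ext x; simp only [Finset.mem_inter, Finset.mem_insert, Finset.mem_erase]; grind
    rw [← hinter]
    refine tangSum_inf_le hK ?_ ⟨hmem2, hmem1⟩
    have huni : insert 0 (insert a' L) ∪ insert 0 (insert b (insert a' (L.erase a))) =
        insert 0 (insert b (insert a' L)) := by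
      ext x; simp only [Finset.mem_union, Finset.mem_insert, Finset.mem_erase]; grind
    rw [huni]
    have := Finset.card_insert_le 0 (insert b (insert a' L))
    have := Finset.card_insert_le b (insert a' L)
    have := Finset.card_insert_le a' L
    omega
  · simp [hI0, hbI]
  · simp [hL0, hbL]
  · have hmem1 := mem_contact.1 hu z
    have hmem2 := mem_contact.1 hz u
    rw [hess_comm] at hmem2
    have hinter : insert 0 (insert b (I'.erase c)) ∩ insert 0 I' = insert 0 (I'.erase c) := by
      ext x; simp only [Finset.mem_inter, Finset.mem_insert, Finset.mem_erase]; grind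
    rw [← hinter]
    refine tangSum_inf_le hK ?_ ⟨hmem1, hmem2⟩
    have huni : insert 0 (insert b (I'.erase c)) ∪ insert 0 I' = insert 0 (insert b I') := by
      ext x; simp only [Finset.mem_union, Finset.mem_insert, Finset.mem_erase]; grind
    rw [huni]
    have := Finset.card_insert_le 0 (insert b I')
    have := Finset.card_insert_le b I'
    omega

theorem contact_le_iSup {I : Finset ℕ} {b : ℕ} (hI0 : 0 ∉ I) (hb0 : b ≠ 0) (hb : b ∈ I) :
    (contact r I : Submodule (GenField n) (Coord n → _)) ≤
      sSup (contact r '' {I' | 0 ∉ I' ∧ b ∉ I' ∧ I'.card = I.card}) := by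
  classical
  set S : Set (Finset ℕ) := {I' | 0 ∉ I' ∧ b ∉ I' ∧ I'.card = I.card} with hS
  have hcomp : CompleteLattice.IsSupFiniteCompact
      (Submodule (GenField n) (Coord n → GenField n)) :=
    CompleteLattice.WellFoundedGT.isSupFiniteCompact _
  obtain ⟨t, ht, hsup⟩ := hcomp (contact r '' S)
  obtain ⟨t', ht', rfl⟩ := Finset.subset_set_image_iff.1 ht
  obtain ⟨b', hb'⟩ := Infinite.exists_notMem_finset (insert 0 (I ∪ t'.biUnion id))
  simp only [Finset.mem_insert, Finset.mem_union, Finset.mem_biUnion, not_or, not_exists,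
    not_and, id] at hb'
  obtain ⟨hb'0, hb'I, hb't⟩ := hb'
  obtain ⟨σ, hσ⟩ := exists_algEquiv_perm (n := n) (Equiv.swap b b')
  have h0 : Equiv.swap b b' 0 = 0 := Equiv.swap_apply_of_ne_of_ne hb0.symm (Ne.symm hb'0)
  have hfix : conj σ (sSup (contact r '' S)) = sSup (contact r '' S) := by
    rw [hsup, Finset.sup_image, Function.id_comp, Finset.sup_eq_iSup, map_iSup₂]
    refine biSup_congr fun I' hI' => ?_
    rw [conj_contact h0 hσ, map_swap_of_notMem (ht' hI').2.1 (hb't I' hI')]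
  have h1 : contact r (insert b' (I.erase b)) ≤ sSup (contact (n := n) r '' S) := by
    refine le_sSup ⟨_, ⟨?_, ?_, ?_⟩, rfl⟩
    · simp [hI0, Ne.symm hb'0]
    · have : b ≠ b' := fun h => hb'I (h ▸ hb)
      simp [this]
    · rw [Finset.card_insert_of_notMem (by simp [hb'I]), Finset.card_erase_of_mem hb]
      have := Finset.card_pos.2 ⟨b, hb⟩
      omega
  have h2 := (conj σ).monotone h1
  rw [hfix, conj_contact h0 hσ] at h2
  have h3 : (insert b' (I.erase b)).map (Equiv.swap b b').toEmbedding = I := by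
    rw [← map_swap_of_mem hb hb'I, Finset.map_map]
    ext x
    simp
  rwa [h3] at h2

theorem hess_mem_tang (hK : TangIndep n r K) {j : ℕ} (hj : j + 2 ≤ K)
    (heq : contactDim n r (j + 2) + contactDim n r j = 2 * contactDim n r (j + 1))
    {I : Finset ℕ} (hI0 : 0 ∉ I) (hIc : I.card = j + 1) {u z : Coord n → GenField n}
    (hu : u ∈ contact r I) (hz : z ∈ contact r I) : hess r (gen 0) u z ∈ tang r 0 := by
  have key : ∀ b ∈ I, hess r (gen 0) u z ∈ tangSum r (insert 0 (I.erase b)) := by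
    intro b hb
    have hb0 : b ≠ 0 := fun h => hI0 (h ▸ hb)
    have hle : sSup (contact r '' {I' | 0 ∉ I' ∧ b ∉ I' ∧ I'.card = I.card}) ≤
        (tangSum r (insert 0 (I.erase b))).comap (hess r (gen 0) u) := by
      refine sSup_le ?_
      rintro _ ⟨I', ⟨h0, hbI', hc⟩, rfl⟩ z hz
      refine hess_mem_of_contact hK hj heq hb0 h0 hbI' (hc.trans hIc) hz (by simp [hI0])
        (Finset.notMem_erase _ _) ?_ ?_
      · rw [Finset.card_erase_of_mem hb, hIc]; rfl
      · rwa [Finset.insert_erase hb]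
    exact hle (contact_le_iSup hI0 hb0 hb hz)
  have hall : ∀ S ⊆ I, hess r (gen 0) u z ∈ tangSum r (insert 0 (I \ S)) := by
    intro S
    induction S using Finset.induction_on with
    | empty => intro _; simpa using mem_contact.1 hu z
    | insert b S hbS ih =>
      intro hS
      have h1 := ih ((Finset.subset_insert _ _).trans hS)
      have h2 := key b (hS (Finset.mem_insert_self _ _))
      have hinter : insert 0 (I \ S) ∩ insert 0 (I.erase b) = insert 0 (I \ insert b S) := by
        ext x; simp only [Finset.mem_inter, Finset.mem_insert, Finset.mem_erase,
          Finset.mem_sdiff]; grind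
      rw [← hinter]
      refine tangSum_inf_le hK ?_ ⟨h1, h2⟩
      have huni : insert 0 (I \ S) ∪ insert 0 (I.erase b) ⊆ insert 0 I := by
        intro x; simp only [Finset.mem_union, Finset.mem_insert, Finset.mem_erase,
          Finset.mem_sdiff]; grind
      have := Finset.card_le_card huni
      have := Finset.card_insert_le 0 I
      omega
  have h := hall I subset_rfl
  rw [Finset.sdiff_self, tangSum_insert] at h
  have hbot : (tangSum r ∅ : Submodule (GenField n) (Mon n (r + 4) → _)) = ⊥ := by
    simp only [tangSum, Finset.notMem_empty, iSup_false, iSup_bot]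
  rwa [hbot, sup_bot_eq] at h

end Contact

section Local
variable {n r : ℕ} {F : Type*} [Field F]

theorem map_point {F' : Type*} [Field F'] (f : F →+* F') (a b : MvPolynomial (Fin n) F) :
    (fun k => f (point a b k)) = point (map f a) (map f b) := by
  funext k
  rcases k with k | k <;> simp [point, coeffs_apply, coeff_map]

variable [Algebra ℂ F]

theorem tan_injective {u : Coord n → F} (h : IsGeneralPair (lin n F u) (quad n F u)) :
    Function.Injective (tan r u) := by
  rw [injective_iff_map_eq_zero]
  intro w hw
  have h1 : tanPoly r u w = 0 := ext_of_isHomogeneous (isHomogeneous_tanPoly r u w)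
    (isHomogeneous_zero _ _ _) (by rw [← tan_apply, hw, map_zero])
  obtain ⟨h2, h3⟩ := h.eq_zero_of_tangent_eq_zero (isHomogeneous_quad w) h1
  exact point_ext (by rw [h2, map_zero]) (by rw [h3, map_zero])

theorem exists_of_hess_mem {u w w' : Coord n → F}
    (h : hess r u w w' ∈ LinearMap.range (tan r u)) :
    ∃ a b : MvPolynomial (Fin n) F, a.IsHomogeneous 1 ∧ b.IsHomogeneous 2 ∧
      hessPoly r u w w' = a * mom u (r + 3) + b * mom u (r + 2) := by
  obtain ⟨v, hv⟩ := h
  exact ⟨_, _, isHomogeneous_lin v, isHomogeneous_quad v, (ext_of_isHomogeneous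
    (isHomogeneous_tanPoly r u v) (isHomogeneous_hessPoly r u w w') hv).symm⟩

theorem eq_zero_of_hess_mem (hr : 1 ≤ r) {u : Coord n → F}
    (h : IsGeneralPair (lin n F u) (quad n F u)) {a k : MvPolynomial (Fin n) F}
    (ha : a.IsHomogeneous 1) (hk : k.IsHomogeneous 1)
    (h1 : ∀ i, hess r u (point a (lin n F u * k)) (point (X i) 0) ∈ LinearMap.range (tan r u))
    (h2 : ∀ i, hess r u (point a (lin n F u * k)) (point 0 (X i ^ 2)) ∈
      LinearMap.range (tan r u)) : point a (lin n F u * k) = 0 := by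
  have hlk : (lin n F u * k).IsHomogeneous 2 := (isHomogeneous_lin u).mul hk
  have hX2 : ∀ i : Fin n, (X i ^ 2 : MvPolynomial (Fin n) F).IsHomogeneous 2 := fun i => by
    simpa using (isHomogeneous_X F i).pow 2
  obtain ⟨ha0, hk0⟩ := h.eq_zero_of_forall_mem_tangent hr ha hk
    (fun i => by
      obtain ⟨a', b', ha', hb', hab⟩ := exists_of_hess_mem (h1 i)
      refine ⟨a', b', ha', hb', hab.symm.trans ?_ |>.symm⟩
      rw [hessPoly, lin_point ha, quad_point hlk, lin_point (isHomogeneous_X F i),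
        quad_point (isHomogeneous_zero _ _ _)]
      simp only [mom]
      ring)
    (fun i => by
      obtain ⟨a', b', ha', hb', hab⟩ := exists_of_hess_mem (h2 i)
      refine ⟨a', b', ha', hb', hab.symm.trans ?_ |>.symm⟩
      rw [hessPoly, lin_point ha, quad_point hlk, lin_point (isHomogeneous_zero _ _ _),
        quad_point (hX2 i)]
      simp only [mom]
      ring)
  rw [ha0, hk0, mul_zero]
  exact point_ext (by rw [lin_point (isHomogeneous_zero _ _ _), map_zero])
    (by rw [quad_point (isHomogeneous_zero _ _ _), map_zero])

theorem exists_quad_eq_of_hess_self_mem {u w : Coord n → F}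
    (h : IsGeneralPair (lin n F u) (quad n F u))
    (hw : hess r u w w ∈ LinearMap.range (tan r u)) :
    ∃ (k : MvPolynomial (Fin n) F) (c : F), k.IsHomogeneous 1 ∧
      quad n F w = lin n F u * k + C c * quad n F u := by
  obtain ⟨a, b, _, _, hab⟩ := exists_of_hess_mem hw
  exact h.eq_of_sq_mem_tangent (isHomogeneous_quad w) hab

end Local

section Conclusion
open Module
variable {n r K m N : ℕ}

theorem isFixed_of_forall_mem {ι : Type*} {A : Submodule (GenField n) (ι → GenField n)}
    (h : ∀ σ : GenField n ≃ₐ[ℂ] GenField n, (fun k => σ (gen 0 k)) = gen 0 →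
      ∀ v ∈ A, (fun e => σ (v e)) ∈ A) : IsFixed A := by
  intro σ hσ
  have hσ' : (fun k => σ.symm (gen 0 k)) = gen 0 := by
    funext k
    rw [AlgEquiv.symm_apply_eq]
    exact (congrFun hσ k).symm
  ext v
  rw [mem_conj]
  constructor
  · intro hv
    simpa using h σ hσ _ hv
  · exact h σ.symm hσ' v

variable (n) in
/-- The tangent vectors at the generic point of index `0` whose quadratic part is divisible
by the linear form. -/
def divisible : ((Mon n 1 → GenField n) × (Mon n 1 → GenField n)) →ₗ[GenField n]
    (Coord n → GenField n) where
  toFun p := point (form n 1 _ p.1) (lin n _ (gen 0) * form n 1 _ p.2)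
  map_add' p p' := by
    ext k; rcases k with k | k <;> simp [point, mul_add]
  map_smul' c p := by
    ext k; rcases k with k | k <;> simp [point]

theorem hess_divisible_mem_tang (hn : 5 ≤ n) (hN : N = n * (n + 3) / 2)
    (hD : N * (m + 1 + N) ≤ (n + (r + 4) - 1).choose (r + 4)) {I : Finset ℕ} (hI0 : 0 ∉ I)
    (hIc : I.card + 1 ≤ m) {η : Coord n → GenField n}
    (hη : ∀ σ : GenField n ≃ₐ[ℂ] GenField n, (fun k => σ (η k)) = η)
    {p : (Mon n 1 → GenField n) × (Mon n 1 → GenField n)} (hp : divisible n p ∈ contact r I) :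
    hess r (gen 0) (divisible n p) η ∈ tang r 0 := by
  set B : Submodule (GenField n) (Mon n (r + 4) → GenField n) :=
    LinearMap.range (((hess r (gen 0)).flip η).comp (divisible n)) with hB
  set A := tang r 0 ⊔ B with hA
  have hfix : IsFixed A := by
    refine isFixed_of_forall_mem fun σ hσ v hv => ?_
    rw [hA, Submodule.mem_sup] at hv
    obtain ⟨t, ht, _, ⟨q, rfl⟩, rfl⟩ := hv
    have h1 : (fun e => σ (t e)) ∈ tang r 0 := by
      rw [← isFixed_tang (r := r) σ hσ, map_mem_conj]
      exact ht
    have h2 : (fun e => σ ((((hess r (gen 0)).flip η).comp (divisible n)) q e)) ∈ B := by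
      refine ⟨(fun e => σ (q.1 e), fun e => σ (q.2 e)), ?_⟩
      simp only [LinearMap.comp_apply, LinearMap.flip_apply]
      have h3 := map_hess (σ : GenField n →ₐ[ℂ] GenField n) r (gen 0) (divisible n q) η
      simp only [AlgEquiv.coe_toAlgHom, hσ, hη] at h3
      rw [h3]
      refine congrArg (fun u => hess r (gen 0) u η) ?_
      have h4 := map_point (σ : GenField n →+* GenField n) (form n 1 _ q.1)
        (lin n _ (gen 0) * form n 1 _ q.2)
      rw [map_mul, map_form, map_form, map_lin] at h4
      simp only [RingHom.coe_coe, hσ] at h4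
      exact h4.symm
    have h3 := add_mem (Submodule.mem_sup_left (T := B) h1)
      (Submodule.mem_sup_right (S := tang r 0) h2)
    convert h3 using 1
    funext e
    simp
  have hBf : finrank (GenField n) ↥B ≤ 2 * n := by
    refine (LinearMap.finrank_range_le _).trans ?_
    rw [finrank_prod, finrank_fintype_fun_eq_card, card_mon, Nat.add_sub_cancel,
      Nat.choose_one_right]
    omega
  have hbot := inf_tangSum_eq_bot (j := m - 1) (by omega) hfix le_sup_left hN (e := 2 * n)
    ((Submodule.finrank_add_le_finrank_add_finrank _ _).trans (by omega)) ?_ hI0 (by omega)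
  · have h1 := mem_contact.1 hp η
    rw [tangSum_insert, Submodule.mem_sup] at h1
    obtain ⟨t, ht, s, hs, hts⟩ := h1
    have hsA : s ∈ A := by
      have : s = hess r (gen 0) (divisible n p) η - t := by rw [← hts]; abel
      rw [this]
      exact sub_mem (Submodule.mem_sup_right ⟨p, rfl⟩) (Submodule.mem_sup_left ht)
    have hs0 : s = 0 := by
      have : s ∈ A ⊓ tangSum r I := ⟨hsA, hs⟩
      rwa [hbot] at this
    rw [← hts, hs0, add_zero]
    exact ht
  · obtain ⟨m', rfl⟩ : ∃ m', m = m' + 1 := ⟨m - 1, by omega⟩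
    have h2N : 2 * N + 1 ≥ n * (n + 3) := by omega
    have h4n : 4 * n + 1 ≤ N + 2 := by nlinarith
    have hN0 : 0 < N := by omega
    obtain ⟨M, rfl⟩ : ∃ M, N = M + 1 := ⟨N - 1, by omega⟩
    rw [Nat.add_sub_cancel, Nat.add_sub_cancel]
    nlinarith

theorem mem_span_euler (hn : 5 ≤ n) (hr : 1 ≤ r) (hN : N = n * (n + 3) / 2)
    (hD : N * (m + 1 + N) ≤ (n + (r + 4) - 1).choose (r + 4)) {I : Finset ℕ} (hI0 : 0 ∉ I)
    (hIc : I.card + 1 ≤ m) {u : Coord n → GenField n} (hu : u ∈ contact r I)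
    (hself : hess r (gen 0) u u ∈ tang r 0) : u ∈ Submodule.span (GenField n) {euler (gen 0)} := by
  have hgp := isGeneralPair_gen hn 0
  obtain ⟨k, c, hk, hq⟩ := exists_quad_eq_of_hess_self_mem hgp hself
  set v := u - (c / 2) • euler (gen 0) with hv
  have hvc : v ∈ contact r I := sub_mem hu (Submodule.smul_mem _ _ (euler_mem_contact I))
  have hvq : quad n _ v = lin n _ (gen 0) * k := by
    have : (2 : MvPolynomial (Fin n) (GenField n)) = C 2 := (map_ofNat C 2).symm
    rw [hv, map_sub, map_smul, quad_euler, hq, smul_eq_C_mul, this, ← mul_assoc, ← C_mul,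
      div_mul_cancel₀ _ (two_ne_zero), add_sub_cancel_right]
  have hvd : v = divisible n (coeffs n 1 _ (lin n _ v), coeffs n 1 _ k) := by
    change v = point _ _
    rw [form_coeffs (isHomogeneous_lin v), form_coeffs hk, ← hvq, point_lin_quad]
  have hv0 : v = 0 := by
    have hvp : v = point (lin n _ v) (lin n _ (gen 0) * k) := by rw [← hvq, point_lin_quad]
    rw [hvp]
    refine eq_zero_of_hess_mem hr hgp (isHomogeneous_lin v) hk ?_ ?_
    · intro i
      rw [← hvp, hvd]
      rw [hvd] at hvc
      refine hess_divisible_mem_tang hn hN hD hI0 hIc (fun σ => ?_) hvc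
      have := map_point (σ : GenField n →+* GenField n) (X i) 0
      rwa [map_X, map_zero] at this
    · intro i
      rw [← hvp, hvd]
      rw [hvd] at hvc
      refine hess_divisible_mem_tang hn hN hD hI0 hIc (fun σ => ?_) hvc
      have := map_point (σ : GenField n →+* GenField n) 0 (X i ^ 2)
      rwa [map_pow, map_X, map_zero] at this
  rw [Submodule.mem_span_singleton]
  exact ⟨c / 2, (sub_eq_zero.1 hv0).symm⟩

theorem contactDim_le_one (hn : 5 ≤ n) (hr : 1 ≤ r) (hN : N = n * (n + 3) / 2)
    (hD : N * (m + 1 + N) ≤ (n + (r + 4) - 1).choose (r + 4)) {j : ℕ} (hj : j + 1 ≤ m) :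
    contactDim n r j ≤ 1 := by
  have hN0 : 2 ≤ N := by
    rw [hN, Nat.le_div_iff_mul_le two_pos]; nlinarith
  have hK : TangIndep n r (m + N / 2) := tangIndep (by omega) hN hD (by omega)
  have hone : ∀ I : Finset ℕ, 0 ∉ I → I.card + 1 ≤ m →
      (∀ u ∈ contact r I, hess r (gen 0) u u ∈ (tang r 0 : Submodule (GenField n) _)) →
      contactDim n r I.card ≤ 1 := by
    intro I hI0 hIc h
    rw [← finrank_contact hI0]
    refine (Submodule.finrank_mono (t := Submodule.span (GenField n) {euler (gen 0)})
      fun u hu => mem_span_euler hn hr hN hD hI0 hIc hu (h u hu)).trans ?_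
    exact (finrank_span_le_card _).trans (by simp)
  by_contra hcon
  have hex : ∃ j, j + 1 ≤ m ∧ 1 < contactDim n r j := ⟨j, hj, not_le.1 hcon⟩
  classical
  have hj₀ := Nat.find_spec hex
  have hmin := fun i => Nat.find_min hex (m := i)
  set j₀ := Nat.find hex
  obtain ⟨hjm, hjc⟩ := hj₀
  have hj0 : j₀ ≠ 0 := by
    intro h0
    rw [h0] at hjc
    have := hone ∅ (by simp) (by simp; omega) fun u hu => by
      have h1 := mem_contact.1 hu u
      have hbot : (tangSum r ∅ : Submodule (GenField n) (Mon n (r + 4) → _)) = ⊥ := by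
        simp only [tangSum, Finset.notMem_empty, iSup_false, iSup_bot]
      rwa [tangSum_insert, hbot, sup_bot_eq] at h1
    rw [Finset.card_empty] at this
    omega
  obtain ⟨i, hi⟩ := Nat.exists_eq_succ_of_ne_zero hj0
  have hprev : contactDim n r i ≤ 1 := by
    by_contra h
    exact hmin i (by omega) ⟨by omega, not_le.1 h⟩
  have hstrict : 2 * contactDim n r (i + 1) < contactDim n r (i + 2) + contactDim n r i := by
    refine lt_of_le_of_ne (contactDim_add_le hK (by omega)) fun heq => ?_
    have := hone (Finset.Icc 1 j₀) (by simp) (by simpa using hjm) fun u hu =>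
      hess_mem_tang hK (j := i) (by omega) heq.symm (by simp) (by simp; omega) hu hu
    rw [Nat.card_Icc, Nat.add_sub_cancel] at this
    omega
  have hinc : ∀ t, t + 1 ≤ N / 2 → contactDim n r (j₀ + t) + 2 ≤ contactDim n r (j₀ + t + 1) := by
    intro t
    induction t with
    | zero =>
      intro _
      rw [hi] at hjc ⊢
      simp only [Nat.succ_eq_add_one, add_zero, add_assoc, Nat.reduceAdd] at hjc ⊢
      omega
    | succ t ih =>
      intro ht
      have h1 := ih (by omega)
      have h2 := contactDim_add_le hK (k := j₀ + t) (by omega)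
      rw [← add_assoc j₀ t 1]
      rw [show j₀ + t + 2 = j₀ + t + 1 + 1 by rfl] at h2
      omega
  have hgrow : ∀ t, t ≤ N / 2 → 2 + 2 * t ≤ contactDim n r (j₀ + t) := by
    intro t
    induction t with
    | zero => intro _; rw [add_zero]; omega
    | succ t ih =>
      intro ht
      have h1 := ih (by omega)
      have h2 := hinc t ht
      rw [← add_assoc]
      omega
  have h1 := hgrow (N / 2) le_rfl
  have h2 : contactDim n r (j₀ + N / 2) ≤ N := by
    refine (Submodule.finrank_le _).trans ?_
    rw [finrank_fintype_fun_eq_card, card_coord, hN]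
  omega

theorem contact_eq_span (hn : 5 ≤ n) (hr : 1 ≤ r) (hN : N = n * (n + 3) / 2)
    (hD : N * (m + 1 + N) ≤ (n + (r + 4) - 1).choose (r + 4)) {I : Finset ℕ} (hI0 : 0 ∉ I)
    (hIc : I.card + 1 ≤ m) :
    contact r I = Submodule.span (GenField n) {euler (gen 0)} := by
  have hne : euler (gen 0 : Coord n → GenField n) ≠ 0 := by
    intro h
    have h1 : lin n _ (gen 0 : Coord n → GenField n) = 0 := by rw [← lin_euler, h, map_zero]
    exact (isGeneralPair_gen hn 0).prime_l.ne_zero h1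
  refine (Submodule.eq_of_le_of_finrank_le ?_ ?_).symm
  · rw [Submodule.span_singleton_le_iff_mem]
    exact euler_mem_contact I
  · rw [finrank_contact hI0, finrank_span_singleton hne]
    exact contactDim_le_one hn hr hN hD hIc

end Conclusion

section Functional
variable {L F : Type*} [Field L] [Field F] [Algebra L F]

/-- Linear functionals commute coefficientwise with base changes of linear maps. -/
theorem functional_comp_baseChange {ι κ : Type*} [Fintype ι] {T : (ι → L) →ₗ[L] (κ → L)}
    {T' : (ι → F) →ₗ[F] (κ → F)}
    (h : ∀ x, T' (fun i => algebraMap L F (x i)) = fun e => algebraMap L F (T x e))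
    (θ : F →ₗ[L] L) (x : ι → F) : (fun e => θ (T' x e)) = T (fun i => θ (x i)) := by
  classical
  have hsingle : ∀ i, (Pi.single i (1 : F) : ι → F) =
      fun k => algebraMap L F ((Pi.single i (1 : L) : ι → L) k) := by
    intro i
    funext k
    by_cases hk : k = i
    · subst hk; simp
    · simp [hk]
  have hx := congrArg T (pi_eq_sum_univ' fun i => θ (x i))
  rw [hx]
  conv_lhs => rw [pi_eq_sum_univ' x]
  funext e
  simp only [map_sum, map_smul, Finset.sum_apply, Pi.smul_apply, smul_eq_mul]
  refine Finset.sum_congr rfl fun i _ => ?_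
  rw [hsingle, h, mul_comm, ← Algebra.smul_def, map_smul, smul_eq_mul, mul_comm]

end Functional

section General
variable {n r m : ℕ} {F : Type*} [Field F] [Algebra ℂ F]

/-- The tangent spaces at the points `v i` are independent, of full dimension. -/
def TangentsIndependent (r : ℕ) (v : Fin m → Coord n → F) : Prop :=
  ∀ w : Fin m → Coord n → F, ∑ i, tan r (v i) (w i) = 0 → w = 0

/-- A tangent direction at `v i` along which the sum of the tangent spaces is stationary is
proportional to the Euler direction. -/
def ContactTrivialAt (r : ℕ) (v : Fin m → Coord n → F) (i : Fin m) : Prop :=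
  ∀ (u : Coord n → F) (c : Coord n → Fin m → Coord n → F),
    (∀ s, hess r (v i) u (Pi.single s 1) = ∑ k, tan r (v k) (c s k)) →
      ∀ k l, u k * euler (v i) l = u l * euler (v i) k

variable {F' : Type*} [Field F'] [Algebra ℂ F']

theorem map_single_one (f : F →ₐ[ℂ] F') (s : Coord n) :
    (fun k => f ((Pi.single s (1 : F) : Coord n → F) k)) = Pi.single s 1 := by
  funext k
  by_cases hk : k = s
  · subst hk; simp
  · simp [hk]

theorem TangentsIndependent.of_map (f : F →ₐ[ℂ] F') {v : Fin m → Coord n → F}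
    (h : TangentsIndependent r fun i k => f (v i k)) : TangentsIndependent r v := by
  intro w hw
  have h1 := h (fun i k => f (w i k)) ?_
  · funext i k
    have := congrFun (congrFun h1 i) k
    simpa using this
  · simp only [← map_tan]
    funext e
    have := congrArg f (congrFun hw e)
    simpa using this

theorem ContactTrivialAt.of_map (f : F →ₐ[ℂ] F') {v : Fin m → Coord n → F} {i : Fin m}
    (h : ContactTrivialAt r (fun i k => f (v i k)) i) : ContactTrivialAt r v i := by
  intro u c hc k l
  have h1 := h (fun k => f (u k)) (fun s i k => f (c s i k)) (fun s => ?_) k l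
  · have he := map_euler (f : F →+* F') (v i)
    simp only [RingHom.coe_coe] at he
    beta_reduce at h1
    rw [← he, ← map_mul, ← map_mul] at h1
    exact f.injective h1
  · rw [← map_single_one f, ← map_hess, hc s]
    simp only [← map_tan]
    funext e
    simp

theorem TangentsIndependent.map (f : F →ₐ[ℂ] F') {v : Fin m → Coord n → F}
    (h : TangentsIndependent r v) : TangentsIndependent r fun i k => f (v i k) := by
  let _ := (f : F →+* F').toAlgebra
  have hf : ∀ x, algebraMap F F' x = f x := fun _ => rfl
  intro w hw
  funext i k
  refine (Module.forall_dual_apply_eq_zero_iff F (w i k)).1 fun θ => ?_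
  have h1 := h (fun i k => θ (w i k)) ?_
  · exact congrFun (congrFun h1 i) k
  · funext e
    have h2 : ∀ i, (fun e => θ (tan r (fun k => f (v i k)) (w i) e)) =
        tan r (v i) fun k => θ (w i k) := fun i =>
      functional_comp_baseChange (fun x => by simp only [hf]; rw [← map_tan]) θ _
    have h3 := congrArg θ (congrFun hw e)
    simp only [Finset.sum_apply, map_sum, Pi.zero_apply, map_zero] at h3 ⊢
    rw [← h3]
    exact Finset.sum_congr rfl fun i _ => (congrFun (h2 i) e).symm

theorem ContactTrivialAt.map (f : F →ₐ[ℂ] F') {v : Fin m → Coord n → F} {i : Fin m}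
    (h : ContactTrivialAt r v i) : ContactTrivialAt r (fun i k => f (v i k)) i := by
  let _ := (f : F →+* F').toAlgebra
  have hf : ∀ x, algebraMap F F' x = f x := fun _ => rfl
  intro u c hc k l
  rw [← sub_eq_zero]
  refine (Module.forall_dual_apply_eq_zero_iff F _).1 fun θ => ?_
  have h1 := h (fun k => θ (u k)) (fun s i k => θ (c s i k)) (fun s => ?_) k l
  · have he := map_euler (f : F →+* F') (v i)
    simp only [RingHom.coe_coe] at he
    beta_reduce
    rw [← he]
    beta_reduce
    rw [← hf, ← hf, mul_comm, mul_comm (u l), ← Algebra.smul_def, ← Algebra.smul_def, map_sub,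
      map_smul, map_smul, smul_eq_mul, smul_eq_mul]
    linear_combination h1
  · have h2 : ∀ i x, (fun e => θ (tan r (fun k => f (v i k)) x e)) =
        tan r (v i) fun k => θ (x k) := fun i x =>
      functional_comp_baseChange (fun x => by simp only [hf]; rw [← map_tan]) θ _
    have h3 := functional_comp_baseChange (T := (hess r (v i)).flip (Pi.single s 1))
      (T' := (hess r fun k => f (v i k)).flip (Pi.single s 1))
      (fun x => by
        simp only [hf, LinearMap.flip_apply]; rw [← map_single_one f, ← map_hess]) θ u
    simp only [LinearMap.flip_apply] at h3
    rw [← h3, hc s]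
    funext e
    simp only [Finset.sum_apply, map_sum]
    exact Finset.sum_congr rfl fun k _ => congrFun (h2 k _) e

theorem ContactTrivialAt.of_perm {v : Fin m → Coord n → F} {i : Fin m} (π : Equiv.Perm (Fin m))
    (h : ContactTrivialAt r (fun k => v (π k)) i) : ContactTrivialAt r v (π i) := by
  intro u c hc
  refine h u (fun s k => c s (π k)) fun s => ?_
  rw [hc s]
  exact (Equiv.sum_comp π fun k => tan r (v k) (c s k)).symm

end General

section Generic
variable {n r m N : ℕ}

theorem mem_tangSum_range {x : Mon n (r + 4) → GenField n} {c : Fin m → Coord n → GenField n}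
    (h : x = ∑ k : Fin m, tan r (gen k) (c k)) : x ∈ tangSum r (Finset.range m) := by
  rw [h]
  exact Submodule.sum_mem _ fun k _ =>
    tang_le_tangSum (Finset.mem_range.2 k.2) ⟨_, rfl⟩

theorem tangentsIndependent_gen (hn : 5 ≤ n) (hN : N = n * (n + 3) / 2)
    (hD : N * (m + 1 + N) ≤ (n + (r + 4) - 1).choose (r + 4)) :
    TangentsIndependent r fun i : Fin m => (gen i : Coord n → GenField n) := by
  classical
  have hN0 : 0 < N := by
    have : 2 ≤ n * (n + 3) := by nlinarith
    omega
  have hK : TangIndep n r (m + N / 2) := tangIndep (by omega) hN hD hN0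
  intro w hw
  funext i
  have h1 : tan r (gen i) (w i) ∈ (tang r i ⊓ tangSum r ((Finset.range m).erase i) :
      Submodule (GenField n) _) := by
    refine ⟨⟨_, rfl⟩, ?_⟩
    rw [← Finset.add_sum_erase _ _ (Finset.mem_univ i)] at hw
    rw [eq_neg_of_add_eq_zero_left hw]
    refine Submodule.neg_mem _ (Submodule.sum_mem _ fun k hk => ?_)
    refine tang_le_tangSum (Finset.mem_erase.2 ⟨?_, Finset.mem_range.2 k.2⟩) ⟨_, rfl⟩
    exact fun h => (Finset.mem_erase.1 hk).1 (Fin.ext h)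
  have hc : ((Finset.range m).erase (i : ℕ)).card ≤ m + N / 2 := by
    refine (Finset.card_le_card (Finset.erase_subset _ _)).trans ?_
    rw [Finset.card_range]; omega
  rw [hK _ _ (Finset.notMem_erase _ _) hc, Submodule.mem_bot] at h1
  exact (map_eq_zero_iff _ (tan_injective (isGeneralPair_gen hn i))).1 h1

theorem contactTrivialAt_gen (hn : 5 ≤ n) (hr : 1 ≤ r) (hN : N = n * (n + 3) / 2)
    (hD : N * (m + 1 + N) ≤ (n + (r + 4) - 1).choose (r + 4)) (i : Fin m) :
    ContactTrivialAt r (fun i : Fin m => (gen i : Coord n → GenField n)) i := by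
  classical
  have : NeZero m := ⟨by have := i.2; omega⟩
  have h0 : ContactTrivialAt r (fun i : Fin m => (gen i : Coord n → GenField n)) 0 := by
    intro u c hc k l
    have hm : 0 < m := Nat.pos_of_ne_zero (NeZero.ne m)
    have hu : u ∈ contact r ((Finset.range m).erase 0) := by
      rw [mem_contact, Finset.insert_erase (Finset.mem_range.2 hm)]
      intro w
      rw [pi_eq_sum_univ' w, map_sum]
      refine Submodule.sum_mem _ fun s _ => ?_
      rw [map_smul]
      exact Submodule.smul_mem _ _ (mem_tangSum_range (hc s))
    rw [contact_eq_span hn hr hN hD (Finset.notMem_erase _ _)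
      (by rw [Finset.card_erase_of_mem (Finset.mem_range.2 hm), Finset.card_range]; omega),
      Submodule.mem_span_singleton] at hu
    obtain ⟨a, rfl⟩ := hu
    simp only [Pi.smul_apply, smul_eq_mul, Fin.val_zero]
    ring
  obtain ⟨σ, hσ⟩ := exists_algEquiv_perm (n := n) (Equiv.swap 0 (i : ℕ))
  have h1 := h0.map (σ : GenField n →ₐ[ℂ] GenField n)
  have h2 : (fun (j : Fin m) k => (σ : GenField n →ₐ[ℂ] GenField n) (gen (j : ℕ) k)) =
      fun j : Fin m => gen ((Equiv.swap 0 i j : Fin m) : ℕ) := by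
    funext j
    rw [AlgEquiv.coe_toAlgHom, hσ]
    congr 1
    rw [Equiv.swap_apply_def, Equiv.swap_apply_def]
    have e1 : ((j : ℕ) = 0) ↔ j = 0 := by rw [← Fin.val_eq_zero_iff]
    have e2 : ((j : ℕ) = i) ↔ j = i := Fin.ext_iff.symm
    simp only [e1, e2]
    split_ifs <;> simp
  rw [h2] at h1
  have h3 := ContactTrivialAt.of_perm (v := fun i : Fin m => (gen i : Coord n → GenField n)) _ h1
  rwa [Equiv.swap_apply_left] at h3

/-- A generic sequence of points and an algebraically independent family of points have the same
behaviour. -/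
theorem exists_algHom_of_algebraicIndependent {F : Type*} [Field F] [Algebra ℂ F]
    {v : Fin m → Coord n → F}
    (hv : AlgebraicIndependent ℂ fun p : Fin m × Coord n => v p.1 p.2) :
    ∃ f : FractionRing (MvPolynomial (Fin m × Coord n) ℂ) →ₐ[ℂ] F, ∀ i k,
      f (algebraMap _ _ (X (i, k) : MvPolynomial (Fin m × Coord n) ℂ)) = v i k := by
  refine ⟨IsFractionRing.liftAlgHom (K := FractionRing (MvPolynomial (Fin m × Coord n) ℂ))
    (g := aeval fun p : Fin m × Coord n => v p.1 p.2)
    (algebraicIndependent_iff_injective_aeval.1 hv), fun i k => ?_⟩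
  rw [IsFractionRing.liftAlgHom_apply, IsFractionRing.lift_algebraMap]
  simp

theorem algebraicIndependent_gen :
    AlgebraicIndependent ℂ fun p : Fin m × Coord n => (gen p.1 p.2 : GenField n) := by
  have h1 : AlgebraicIndependent ℂ fun p : ℕ × Coord n => (gen p.1 p.2 : GenField n) := by
    have := (algebraicIndependent_X (ℕ × Coord n) ℂ).map' (f := IsScalarTower.toAlgHom ℂ
      (MvPolynomial (ℕ × Coord n) ℂ) (GenField n)) (IsFractionRing.injective _ _)
    exact this
  exact h1.comp (fun p : Fin m × Coord n => ((p.1 : ℕ), p.2)) fun p q h => by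
    simp only [Prod.mk.injEq] at h
    exact Prod.ext (Fin.ext h.1) h.2

theorem tangentsIndependent_of_algebraicIndependent (hn : 5 ≤ n) (hN : N = n * (n + 3) / 2)
    (hD : N * (m + 1 + N) ≤ (n + (r + 4) - 1).choose (r + 4)) {F : Type*} [Field F] [Algebra ℂ F]
    {v : Fin m → Coord n → F}
    (hv : AlgebraicIndependent ℂ fun p : Fin m × Coord n => v p.1 p.2) :
    TangentsIndependent r v := by
  obtain ⟨f, hf⟩ := exists_algHom_of_algebraicIndependent hv
  obtain ⟨g, hg⟩ := exists_algHom_of_algebraicIndependent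
    (v := fun i : Fin m => (gen i : Coord n → GenField n)) algebraicIndependent_gen
  have h := tangentsIndependent_gen (m := m) (r := r) hn hN hD
  have e : (fun i : Fin m => (gen i : Coord n → GenField n)) = fun i k =>
      g (algebraMap _ _ (X (i, k) : MvPolynomial (Fin m × Coord n) ℂ)) := by
    funext i k; exact (hg i k).symm
  rw [e] at h
  have h2 := (TangentsIndependent.of_map g h).map f
  simpa only [hf] using h2

theorem contactTrivialAt_of_algebraicIndependent (hn : 5 ≤ n) (hr : 1 ≤ r)
    (hN : N = n * (n + 3) / 2)
    (hD : N * (m + 1 + N) ≤ (n + (r + 4) - 1).choose (r + 4)) {F : Type*} [Field F] [Algebra ℂ F]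
    {v : Fin m → Coord n → F}
    (hv : AlgebraicIndependent ℂ fun p : Fin m × Coord n => v p.1 p.2) (i : Fin m) :
    ContactTrivialAt r v i := by
  obtain ⟨f, hf⟩ := exists_algHom_of_algebraicIndependent hv
  obtain ⟨g, hg⟩ := exists_algHom_of_algebraicIndependent
    (v := fun i : Fin m => (gen i : Coord n → GenField n)) algebraicIndependent_gen
  have h := contactTrivialAt_gen (m := m) (r := r) hn hr hN hD i
  have e : (fun i : Fin m => (gen i : Coord n → GenField n)) = fun i k =>
      g (algebraMap _ _ (X (i, k) : MvPolynomial (Fin m × Coord n) ℂ)) := by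
    funext i k; exact (hg i k).symm
  rw [e] at h
  have h2 := (ContactTrivialAt.of_map g h).map f
  simpa only [hf] using h2

end Generic

section Derivations

theorem formallySmooth_of_charZero (K F : Type*) [Field K] [CharZero K] [Field F] [Algebra K F] :
    Algebra.FormallySmooth K F := by
  obtain ⟨s, hs⟩ := exists_isTranscendenceBasis K F
  have h1 : Algebra.IsAlgebraic (IntermediateField.adjoin K (Set.range ((↑) : s → F))) F :=
    hs.isAlgebraic_field
  exact .of_algebraicIndependent_of_isSeparable hs.1

theorem isNilpotent_ker_of_mul_eq_zero {B C : Type*} [CommRing B] [CommRing C] {f : B →+* C}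
    (h : ∀ a b, f a = 0 → f b = 0 → a * b = 0) : IsNilpotent (RingHom.ker f) := by
  refine ⟨2, ?_⟩
  rw [pow_two, Ideal.zero_eq_bot, eq_bot_iff, Ideal.mul_le]
  exact fun a ha b hb => h a b ha hb

/-- In characteristic zero there are derivations with prescribed values on an algebraically
independent family. -/
theorem exists_derivation {k F ι : Type*} [Field k] [CharZero k] [Field F] [Algebra k F]
    {v : ι → F} (hv : AlgebraicIndependent k v) (c : ι → F) :
    ∃ δ : Derivation k F F, ∀ i, δ (v i) = c i := by
  let K := FractionRing (MvPolynomial ι k)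
  have hK : CharZero K := charZero_of_injective_algebraMap (algebraMap k K).injective
  have hv' := algebraicIndependent_iff_injective_aeval.1 hv
  let f : K →ₐ[k] F := IsFractionRing.liftAlgHom (g := aeval v) hv'
  let g : MvPolynomial ι k →ₐ[k] DualNumber F :=
    aeval fun i => TrivSqZeroExt.inl (v i) + TrivSqZeroExt.inr (c i)
  have hfst : (TrivSqZeroExt.fstHom k F F).comp g = aeval v := by
    apply algHom_ext
    intro i
    simp [g]
  have hg : ∀ y : nonZeroDivisors (MvPolynomial ι k), IsUnit (g y) := by
    intro y
    rw [TrivSqZeroExt.isUnit_iff_isUnit_fst, isUnit_iff_ne_zero]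
    have h1 := AlgHom.congr_fun hfst y
    simp only [AlgHom.comp_apply, TrivSqZeroExt.fstHom_apply] at h1
    rw [h1]
    exact fun h => nonZeroDivisors.ne_zero y.2 (hv' (h.trans (map_zero _).symm))
  let G : K →ₐ[k] DualNumber F := IsLocalization.liftAlgHom (M := nonZeroDivisors _) (f := g) hg
  have hG : ∀ p : MvPolynomial ι k, G (algebraMap _ K p) = g p := fun p => by
    simp only [G, IsLocalization.liftAlgHom_apply]
    exact IsLocalization.lift_eq _ _
  have hf : ∀ p : MvPolynomial ι k, f (algebraMap _ K p) = aeval v p := fun p => by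
    simp only [f, IsFractionRing.liftAlgHom_apply]
    exact IsFractionRing.lift_algebraMap _ _
  have hfG : (TrivSqZeroExt.fstHom k F F).comp G = f := by
    refine IsLocalization.algHom_ext (nonZeroDivisors (MvPolynomial ι k)) ?_
    ext p
    change (G (algebraMap _ K (X p))).fst = f (algebraMap _ K (X p))
    rw [hG, hf]
    simp [g]
  let _ : Algebra K F := f.toRingHom.toAlgebra
  let _ : Algebra K (DualNumber F) := G.toRingHom.toAlgebra
  let fst : DualNumber F →ₐ[K] F :=
    { (TrivSqZeroExt.fstHom k F F).toRingHom with
      commutes' := fun x => AlgHom.congr_fun hfG x }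
  have hsm := formallySmooth_of_charZero K F
  have hsurj : Function.Surjective fst := fun x => ⟨TrivSqZeroExt.inl x, rfl⟩
  have hnil : IsNilpotent (RingHom.ker (fst : DualNumber F →+* F)) := by
    refine isNilpotent_ker_of_mul_eq_zero fun a b ha hb => ?_
    have ha' : a.fst = 0 := ha
    have hb' : b.fst = 0 := hb
    ext <;> simp [ha', hb']
  let s := Algebra.FormallySmooth.liftOfSurjective (AlgHom.id K F) fst hsurj hnil
  have hs : ∀ x, (s x).fst = x := fun x =>
    Algebra.FormallySmooth.liftOfSurjective_apply (AlgHom.id K F) fst hsurj hnil x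
  have hsK : ∀ x : K, s (f x) = G x := fun x => s.commutes x
  have hsk : ∀ x : k, s (algebraMap k F x) = algebraMap k (DualNumber F) x := fun x => by
    rw [← f.commutes, hsK, G.commutes]
  refine ⟨Derivation.mk'
    { toFun := fun x => (s x).snd
      map_add' := fun x y => by rw [map_add, TrivSqZeroExt.snd_add]
      map_smul' := fun a x => ?_ } fun x y => ?_, fun i => ?_⟩
  · rw [Algebra.smul_def, map_mul, hsk, TrivSqZeroExt.snd_mul, hs,
      TrivSqZeroExt.algebraMap_eq_inl']
    simp [Algebra.smul_def]
  · simp [hs, mul_comm]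
  · change (s (v i)).snd = c i
    have h1 := hsK (algebraMap _ K (X i : MvPolynomial ι k))
    rw [hf, hG, aeval_X] at h1
    rw [h1]
    simp [g]

end Derivations

section DerivCoeffs
variable {σ F : Type*} [Field F] [Algebra ℂ F]

/-- A derivation of the coefficients, extended to polynomials. -/
def derivCoeffs (σ : Type*) (δ : Derivation ℂ F F) : MvPolynomial σ F →ₗ[ℂ] MvPolynomial σ F where
  toFun p := .ofCoeff (Finsupp.mapRange δ (map_zero δ) (AddMonoidAlgebra.coeff p))
  map_add' p q := by
    ext e
    exact map_add δ (coeff e p) (coeff e q)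
  map_smul' a p := by
    ext e
    exact δ.map_smul a (coeff e p)

theorem coeff_derivCoeffs (δ : Derivation ℂ F F) (p : MvPolynomial σ F) (e : σ →₀ ℕ) :
    coeff e (derivCoeffs σ δ p) = δ (coeff e p) := rfl

theorem derivCoeffs_mul (δ : Derivation ℂ F F) (p q : MvPolynomial σ F) :
    derivCoeffs σ δ (p * q) = derivCoeffs σ δ p * q + p * derivCoeffs σ δ q := by
  classical
  ext e
  rw [coeff_derivCoeffs, coeff_add, coeff_mul, coeff_mul, coeff_mul, map_sum,
    ← Finset.sum_add_distrib]
  refine Finset.sum_congr rfl fun x _ => ?_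
  rw [δ.leibniz, coeff_derivCoeffs, coeff_derivCoeffs, smul_eq_mul, smul_eq_mul]
  ring

variable {n : ℕ}

theorem derivCoeffs_form (δ : Derivation ℂ F F) {k : ℕ} (u : Mon n k → F) :
    derivCoeffs _ δ (form n k F u) = form n k F fun e => δ (u e) := by
  classical
  ext e
  rw [coeff_derivCoeffs, form_apply, form_apply, coeff_sum, coeff_sum, map_sum]
  refine Finset.sum_congr rfl fun x _ => ?_
  rw [coeff_monomial, coeff_monomial]
  split_ifs <;> simp

theorem derivCoeffs_lin (δ : Derivation ℂ F F) (u : Coord n → F) :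
    derivCoeffs _ δ (lin n F u) = lin n F fun k => δ (u k) :=
  derivCoeffs_form δ _

theorem derivCoeffs_quad (δ : Derivation ℂ F F) (u : Coord n → F) :
    derivCoeffs _ δ (quad n F u) = quad n F fun k => δ (u k) :=
  derivCoeffs_form δ _

theorem derivCoeffs_mom (δ : Derivation ℂ F F) (u : Coord n → F) (k : ℕ) :
    derivCoeffs _ δ (mom u (k + 2)) =
      lin n F (fun k => δ (u k)) * mom u (k + 1) + quad n F (fun k => δ (u k)) * mom u k := by
  rw [mom, leibniz_expPart _ (derivCoeffs_mul δ), derivCoeffs_lin, derivCoeffs_quad, mom, mom]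

theorem deriv_phi (δ : Derivation ℂ F F) (r : ℕ) (u : Coord n → F) :
    (fun e => δ (phi r u e)) = tan r u fun k => δ (u k) := by
  funext e
  rw [phi, coeffs_apply, ← coeff_derivCoeffs, derivCoeffs_mom, tan_apply, coeffs_apply, tanPoly]

theorem deriv_tan (δ : Derivation ℂ F F) (r : ℕ) (u w : Coord n → F) :
    (fun e => δ (tan r u w e)) =
      tan r u (fun k => δ (w k)) + hess r u (fun k => δ (u k)) w := by
  funext e
  rw [tan_apply, coeffs_apply, ← coeff_derivCoeffs, Pi.add_apply, tan_apply, coeffs_apply,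
    hess_apply, coeffs_apply, ← coeff_add]
  refine congrArg _ ?_
  rw [tanPoly, map_add, derivCoeffs_mul, derivCoeffs_mul, derivCoeffs_lin, derivCoeffs_quad,
    derivCoeffs_mom, derivCoeffs_mom, tanPoly, hessPoly]
  ring

end DerivCoeffs

section Uniqueness
variable {n r m : ℕ} {F : Type*} [Field F] [Algebra ℂ F]

/-- The differential of the sum of the `phi r (v i)`. -/
def tanSum (r : ℕ) (v : Fin m → Coord n → F) :
    (Fin m → Coord n → F) →ₗ[F] (Mon n (r + 4) → F) :=
  ∑ i, (tan r (v i)).comp (LinearMap.proj i)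

theorem tanSum_apply (v c : Fin m → Coord n → F) :
    tanSum r v c = ∑ i, tan r (v i) (c i) := by
  simp [tanSum]

theorem tanSum_single (v : Fin m → Coord n → F) (i : Fin m) (c : Coord n → F) :
    tanSum r v (Pi.single i c) = tan r (v i) c := by
  rw [tanSum_apply, Finset.sum_eq_single i]
  · simp
  · intro k _ hk; simp [hk]
  · simp

theorem TangentsIndependent.injective {v : Fin m → Coord n → F} (h : TangentsIndependent r v) :
    Function.Injective (tanSum r v) := by
  rw [injective_iff_map_eq_zero]
  intro c hc
  exact h c (by rwa [← tanSum_apply])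

theorem deriv_sum_phi (δ : Derivation ℂ F F) (v : Fin m → Coord n → F) :
    (fun e => δ ((∑ i, phi r (v i)) e)) = tanSum r v fun i k => δ (v i k) := by
  rw [tanSum_apply]
  funext e
  simp only [Finset.sum_apply, map_sum, ← deriv_phi]

theorem range_tanSum_le {v w : Fin m → Coord n → F}
    (hv : AlgebraicIndependent ℂ fun p : Fin m × Coord n => v p.1 p.2)
    (h : ∑ i, phi r (v i) = ∑ i, phi r (w i)) :
    LinearMap.range (tanSum r v) ≤ LinearMap.range (tanSum r w) := by
  rintro _ ⟨c, rfl⟩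
  obtain ⟨δ, hδ⟩ := exists_derivation hv fun p => c p.1 p.2
  refine ⟨fun i k => δ (w i k), ?_⟩
  rw [← deriv_sum_phi, ← h, deriv_sum_phi]
  congr 1
  funext i k
  exact hδ (i, k)

theorem euler_ne_zero {v : Fin m → Coord n → F} (hn : 0 < n)
    (hv : AlgebraicIndependent ℂ fun p : Fin m × Coord n => v p.1 p.2) (i : Fin m) :
    euler (v i) ≠ 0 := by
  intro h
  let k : Coord n := Sum.inl ⟨Finsupp.single ⟨0, hn⟩ 1, by simp⟩
  exact hv.ne_zero (i, k) (congrFun h k)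

theorem phi_eq_tan (v : Coord n → F) : phi r v = tan r v (((r : F) + 4)⁻¹ • euler v) := by
  have : CharZero F := charZero_of_injective_algebraMap (algebraMap ℂ F).injective
  have h4 : (r : F) + 4 ≠ 0 := by exact_mod_cast (by omega : r + 4 ≠ 0)
  rw [map_smul, tan_euler, smul_smul, inv_mul_cancel₀ h4, one_smul]

theorem tan_euler_eq_sum {v w : Fin m → Coord n → F}
    (hn : 0 < n) (hv : AlgebraicIndependent ℂ fun p : Fin m × Coord n => v p.1 p.2)
    (hw : AlgebraicIndependent ℂ fun p : Fin m × Coord n => w p.1 p.2)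
    (hcw : ∀ i, ContactTrivialAt r w i)
    (h : ∑ i, phi r (v i) = ∑ i, phi r (w i)) (l : Fin m) :
    ∃ a : Fin m → F, tan r (v l) (euler (v l)) = ∑ i, a i • tan r (w i) (euler (w i)) := by
  classical
  obtain ⟨δ, hδ⟩ := exists_derivation hv fun p => Pi.single (M := fun _ => Coord n → F) l
    (euler (v l)) p.1 p.2
  have hδv : (fun i k => δ (v i k)) = Pi.single l (euler (v l)) := by
    funext i k; exact hδ (i, k)
  have hmem : ∀ i s, hess r (w i) (fun k => δ (w i k)) (Pi.single s 1) ∈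
      LinearMap.range (tanSum r w) := by
    intro i s
    have h1 : tan r (w i) (Pi.single s 1) ∈ LinearMap.range (tanSum r v) :=
      range_tanSum_le hw h.symm ⟨Pi.single i (Pi.single s 1), tanSum_single _ _ _⟩
    obtain ⟨c, hc⟩ := h1
    have h2 := deriv_tan δ r (w i) (Pi.single s 1)
    have h3 : (fun k => δ ((Pi.single s 1 : Coord n → F) k)) = 0 := by
      funext k
      by_cases hk : k = s
      · subst hk; simp
      · simp [hk]
    rw [h3, map_zero, zero_add, ← hc, tanSum_apply] at h2
    rw [← h2]
    have h4 : (fun e => δ ((∑ k, tan r (v k) (c k)) e)) = tanSum r v (fun i k => δ (c i k)) +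
        hess r (v l) (euler (v l)) (c l) := by
      rw [tanSum_apply]
      have h5 : ∑ k, hess r (v k) (fun j => δ (v k j)) (c k) =
          hess r (v l) (euler (v l)) (c l) := by
        rw [Finset.sum_eq_single l]
        · have := congrFun hδv l
          simp only [Pi.single_eq_same] at this
          rw [this]
        · intro k _ hk
          have := congrFun hδv k
          simp only [Pi.single_eq_of_ne hk] at this
          rw [this, map_zero, LinearMap.zero_apply]
        · simp
      rw [← h5, ← Finset.sum_add_distrib]
      simp only [← deriv_tan]
      funext e
      simp
    rw [h4]
    refine range_tanSum_le hv h (Submodule.add_mem _ ⟨_, rfl⟩ ?_)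
    obtain ⟨x, hx⟩ := hess_euler_mem r (v l) (c l)
    rw [← hx]
    exact ⟨Pi.single l x, tanSum_single _ _ _⟩
  have hprop : ∀ i, ∃ a : F, (fun k => δ (w i k)) = a • euler (w i) := by
    intro i
    choose c hc using hmem i
    have h1 := hcw i _ c fun s => by rw [← hc s, tanSum_apply]
    obtain ⟨k, hk⟩ := Function.ne_iff.1 (euler_ne_zero hn hw i)
    refine ⟨δ (w i k) / euler (w i) k, funext fun j => ?_⟩
    have h2 := h1 j k
    rw [Pi.zero_apply] at hk
    rw [Pi.smul_apply, smul_eq_mul]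
    field_simp
    exact h2
  choose a ha using hprop
  refine ⟨a, ?_⟩
  have h1 := deriv_sum_phi (r := r) δ v
  rw [h, deriv_sum_phi, hδv, tanSum_single, tanSum_apply] at h1
  rw [← h1]
  exact Finset.sum_congr rfl fun i _ => by rw [ha i, map_smul]

theorem exists_tan_eq {w : Fin m → Coord n → F} {v : Coord n → F}
    (hw : AlgebraicIndependent ℂ fun p : Fin m × Coord n => w p.1 p.2)
    {a : Fin m → F} (h : phi r v = ∑ i, a i • phi r (w i)) {i : Fin m} (hi : a i ≠ 0)
    (c : Coord n → F) :
    ∃ (x : Coord n → F) (y : Fin m → F), tan r (w i) c =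
      tan r v x + tanSum r w fun k => y k • euler (w k) := by
  classical
  obtain ⟨δ, hδ⟩ := exists_derivation hw fun p => Pi.single (M := fun _ => Coord n → F) i c p.1 p.2
  have hδw : (fun i k => δ (w i k)) = Pi.single i c := by
    funext i k; exact hδ (i, k)
  have h1 : tan r v (fun k => δ (v k)) = a i • tan r (w i) c + ∑ k, δ (a k) • phi r (w k) := by
    rw [← deriv_phi, h]
    have h2 : ∑ k, a k • tan r (w k) (fun j => δ (w k j)) = a i • tan r (w i) c := by
      rw [Finset.sum_eq_single i]
      · have := congrFun hδw i
        simp only [Pi.single_eq_same] at this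
        rw [this]
      · intro k _ hk
        have := congrFun hδw k
        simp only [Pi.single_eq_of_ne hk] at this
        rw [this, map_zero, smul_zero]
      · simp
    rw [← h2, ← Finset.sum_add_distrib]
    funext e
    simp only [Finset.sum_apply, map_sum, ← deriv_phi, Pi.add_apply, Pi.smul_apply, smul_eq_mul,
      δ.leibniz]
    exact Finset.sum_congr rfl fun k _ => by ring
  refine ⟨(a i)⁻¹ • fun k => δ (v k), fun k => -((a i)⁻¹ * δ (a k) * ((r : F) + 4)⁻¹), ?_⟩
  have h3 : (tanSum r w fun k => -((a i)⁻¹ * δ (a k) * ((r : F) + 4)⁻¹) • euler (w k)) =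
      -((a i)⁻¹ • ∑ k, δ (a k) • phi r (w k)) := by
    rw [tanSum_apply, Finset.smul_sum, ← Finset.sum_neg_distrib]
    refine Finset.sum_congr rfl fun k _ => ?_
    rw [phi_eq_tan, map_smul, map_smul, smul_smul, smul_smul, neg_smul]
  rw [h3, map_smul, h1, smul_add, smul_smul, inv_mul_cancel₀ hi, one_smul, add_neg_cancel_right]

theorem eq_of_ne_zero_of_ne_zero {w : Fin m → Coord n → F} {v : Coord n → F}
    (hw : AlgebraicIndependent ℂ fun p : Fin m × Coord n => w p.1 p.2)
    (htw : TangentsIndependent r w) (hcard : 2 < Fintype.card (Coord n))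
    (hv : LinearMap.range (tan r v) ≤ LinearMap.range (tanSum r w))
    {a : Fin m → F} (h : phi r v = ∑ i, a i • phi r (w i)) {i j : Fin m} (hi : a i ≠ 0)
    (hj : a j ≠ 0) : i = j := by
  classical
  by_contra hij
  obtain ⟨g, hg⟩ := LinearMap.exists_leftInverse_of_injective (tanSum r w)
    (LinearMap.ker_eq_bot.2 htw.injective)
  have hA : ∀ x, tanSum r w (g (tan r v x)) = tan r v x := by
    intro x
    obtain ⟨y, hy⟩ := hv ⟨x, rfl⟩
    rw [← hy]
    exact congrArg _ (LinearMap.congr_fun hg y)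
  let B : (Coord n → F) × F × F →ₗ[F] (Coord n → F) × (Coord n → F) :=
    { toFun := fun z => (g (tan r v z.1) i + z.2.1 • euler (w i),
        g (tan r v z.1) j + z.2.2 • euler (w j))
      map_add' := fun z z' => by
        simp only [Prod.fst_add, Prod.snd_add, map_add, Pi.add_apply, add_smul, Prod.mk_add_mk,
          Prod.mk.injEq]
        constructor <;> abel
      map_smul' := fun c z => by
        simp [mul_smul] }
  have hB : Function.Surjective B := by
    rintro ⟨c, c'⟩
    obtain ⟨x, y, hx⟩ := exists_tan_eq hw h hi c
    obtain ⟨x', y', hx'⟩ := exists_tan_eq hw h hj c'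
    refine ⟨(x + x', y i + y' i, y j + y' j), ?_⟩
    have h1 : Pi.single i c + Pi.single j c' =
        g (tan r v (x + x')) + fun k => (y k + y' k) • euler (w k) := by
      apply htw.injective
      rw [map_add, map_add, tanSum_single, tanSum_single, hA, hx, hx', map_add]
      have h2 : (fun k => (y k + y' k) • euler (w k)) =
          (fun k => y k • euler (w k)) + fun k => y' k • euler (w k) := by
        funext k; exact add_smul _ _ _
      rw [h2, map_add]
      abel
    have e1 := congrFun h1 i
    have e2 := congrFun h1 j
    simp only [Pi.add_apply, Pi.single_eq_same, Pi.single_eq_of_ne hij, add_zero,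
      Pi.single_eq_of_ne (Ne.symm hij), zero_add] at e1 e2
    exact Prod.ext e1.symm e2.symm
  have h1 := LinearMap.finrank_le_finrank_of_surjective hB
  simp only [Module.finrank_prod, Module.finrank_fintype_fun_eq_card, Module.finrank_self] at h1
  omega

/-- Two generic decompositions of the same form agree up to order. -/
theorem exists_perm_of_sum_phi_eq {v w : Fin m → Coord n → F} (hn : 0 < n)
    (hcard : 2 < Fintype.card (Coord n))
    (hv : AlgebraicIndependent ℂ fun p : Fin m × Coord n => v p.1 p.2)
    (hw : AlgebraicIndependent ℂ fun p : Fin m × Coord n => w p.1 p.2)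
    (htv : TangentsIndependent r v) (htw : TangentsIndependent r w)
    (hcw : ∀ i, ContactTrivialAt r w i)
    (h : ∑ i, phi r (v i) = ∑ i, phi r (w i)) :
    ∃ π : Equiv.Perm (Fin m), ∀ l, phi r (v l) = phi r (w (π l)) := by
  classical
  have : CharZero F := charZero_of_injective_algebraMap (algebraMap ℂ F).injective
  have h4 : (r : F) + 4 ≠ 0 := by exact_mod_cast (by omega : r + 4 ≠ 0)
  have hlin : ∀ l, ∃ a : Fin m → F, phi r (v l) = ∑ i, a i • phi r (w i) := by
    intro l
    obtain ⟨a, ha⟩ := tan_euler_eq_sum hn hv hw hcw h l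
    refine ⟨a, smul_right_injective _ h4 ?_⟩
    simp only [Finset.smul_sum, tan_euler] at ha ⊢
    rw [ha]
    exact Finset.sum_congr rfl fun i _ => smul_comm _ _ _
  choose a ha using hlin
  have hne : ∀ l, phi r (v l) ≠ 0 := by
    intro l h0
    have h1 : tanSum r v (Pi.single l (euler (v l))) = 0 := by
      rw [tanSum_single, tan_euler, h0, smul_zero]
    have h2 := congrFun (htv.injective (h1.trans (map_zero _).symm)) l
    rw [Pi.single_eq_same] at h2
    exact euler_ne_zero hn hv l h2
  have hex : ∀ l, ∃ i, a l i ≠ 0 := by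
    intro l
    by_contra! h0
    exact hne l (by rw [ha l]; simp [h0])
  choose p hp using hex
  have hp' : ∀ l i, i ≠ p l → a l i = 0 := by
    intro l i hi
    by_contra h0
    refine hi (eq_of_ne_zero_of_ne_zero hw htw hcard ?_ (ha l) h0 (hp l))
    rintro _ ⟨x, rfl⟩
    exact range_tanSum_le hv h ⟨Pi.single l x, tanSum_single _ _ _⟩
  have hphi : ∀ l, phi r (v l) = a l (p l) • phi r (w (p l)) := by
    intro l
    rw [ha l, Finset.sum_eq_single (p l)]
    · intro i _ hi; rw [hp' l i hi, zero_smul]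
    · simp
  have hsum : ∀ i, ∑ l, a l i = 1 := by
    have h1 : tanSum r w (fun i => (∑ l, a l i - 1) • ((r : F) + 4)⁻¹ • euler (w i)) = 0 := by
      rw [tanSum_apply]
      have hterm : ∀ i, tan r (w i) ((∑ l, a l i - 1) • ((r : F) + 4)⁻¹ • euler (w i)) =
          (∑ l, a l i) • phi r (w i) - phi r (w i) := fun i => by
        rw [map_smul, ← phi_eq_tan, sub_smul, one_smul]
      rw [Finset.sum_congr rfl fun i _ => hterm i, Finset.sum_sub_distrib, ← h, sub_eq_zero]
      simp only [Finset.sum_smul]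
      rw [Finset.sum_comm]
      exact Finset.sum_congr rfl fun l _ => (ha l).symm
    intro i
    have h2 := congrFun (htw.injective (h1.trans (map_zero _).symm)) i
    rw [Pi.zero_apply, smul_smul, smul_eq_zero] at h2
    have h3 := h2.resolve_right (euler_ne_zero hn hw i)
    have h5 := (mul_eq_zero.1 h3).resolve_right (inv_ne_zero h4)
    exact sub_eq_zero.1 h5
  have hsurj : Function.Surjective p := by
    intro i
    by_contra! h0
    have h1 := hsum i
    rw [Finset.sum_eq_zero fun l _ => hp' l i (h0 l).symm] at h1
    exact zero_ne_one h1
  have hbij : Function.Bijective p := Finite.injective_iff_bijective.1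
    (Finite.injective_iff_surjective.2 hsurj)
  refine ⟨Equiv.ofBijective p hbij, fun l => ?_⟩
  rw [Equiv.ofBijective_apply, hphi l]
  have h1 := hsum (p l)
  rw [Finset.sum_eq_single l] at h1
  · rw [h1, one_smul]
  · intro l' _ hl'
    exact hp' l' _ fun h0 => hl' (hbij.1 h0.symm)
  · simp

end Uniqueness

section PhiPoly
variable {n : ℕ} {F : Type*} [Field F] [Algebra ℂ F]

/-- The map `phi r` as a family of polynomials. -/
def phiPoly (r : ℕ) : Mon n (r + 4) → MvPolynomial (Coord n) ℂ :=
  coeffs n (r + 4) _ (expPart (lin n (MvPolynomial (Coord n) ℂ) X) (quad n _ X) (r + 4))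

theorem aeval_phiPoly (r : ℕ) (u : Coord n → F) (e : Mon n (r + 4)) :
    aeval u (phiPoly r e) = phi r u e := by
  have h := map_expPart (mapAlgHom (aeval u : MvPolynomial (Coord n) ℂ →ₐ[ℂ] F))
    (lin n (MvPolynomial (Coord n) ℂ) X) (quad n _ X) (r + 4)
  simp only [mapAlgHom_apply] at h
  have h1 := coeffs_map (aeval u : MvPolynomial (Coord n) ℂ →ₐ[ℂ] F).toRingHom (k := r + 4)
    (expPart (lin n (MvPolynomial (Coord n) ℂ) X) (quad n _ X) (r + 4))
  refine (congrFun h1 e).symm.trans ?_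
  have h2 := map_lin (aeval u : MvPolynomial (Coord n) ℂ →ₐ[ℂ] F).toRingHom (X (R := ℂ))
  have h3 := map_quad (aeval u : MvPolynomial (Coord n) ℂ →ₐ[ℂ] F).toRingHom (X (R := ℂ))
  simp only [AlgHom.toRingHom_eq_coe, RingHom.coe_coe, aeval_X] at h2 h3
  rw [phi, mom]
  refine congrFun (congrArg _ ?_) e
  rw [← h2, ← h3]
  exact h

end PhiPoly

section Algebraicity
variable {n r m : ℕ}

/-- The field of rational functions of `m` points. -/
abbrev ParField (n m : ℕ) : Type := FractionRing (MvPolynomial (Fin m × Coord n) ℂ)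

/-- The generic points. -/
def par (i : Fin m) (k : Coord n) : ParField n m :=
  algebraMap _ _ (X (i, k) : MvPolynomial (Fin m × Coord n) ℂ)

theorem algebraicIndependent_par :
    AlgebraicIndependent ℂ fun p : Fin m × Coord n => (par p.1 p.2 : ParField n m) :=
  (algebraicIndependent_X (Fin m × Coord n) ℂ).map' (f := IsScalarTower.toAlgHom ℂ
      (MvPolynomial (Fin m × Coord n) ℂ) (ParField n m)) (IsFractionRing.injective _ _)

theorem derivation_eq_zero_of_par (δ : Derivation ℂ (ParField n m) (ParField n m))
    (h : ∀ i k, δ (par i k) = 0) (x : ParField n m) : δ x = 0 := by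
  have hR : ∀ p : MvPolynomial (Fin m × Coord n) ℂ, δ (algebraMap _ _ p) = 0 := by
    intro p
    have : (δ.compAlgebraMap (MvPolynomial (Fin m × Coord n) ℂ)) = 0 := by
      refine MvPolynomial.derivation_ext fun i => ?_
      exact h i.1 i.2
    exact congrArg (fun D : Derivation ℂ (MvPolynomial (Fin m × Coord n) ℂ) (ParField n m) =>
      D p) this
  obtain ⟨a, b, hb, rfl⟩ := IsFractionRing.div_surjective
    (A := MvPolynomial (Fin m × Coord n) ℂ) x
  rw [Derivation.leibniz_div, hR, hR]
  simp

theorem isAlgebraic_adjoin_sum_phi (ht : TangentsIndependent r (par : Fin m → Coord n → _)) :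
    Algebra.IsAlgebraic (Algebra.adjoin ℂ (Set.range fun e => ∑ i : Fin m,
      phi r (par i : Coord n → ParField n m) e)) (ParField n m) := by
  set s := Set.range fun e => ∑ i : Fin m, phi r (par i : Coord n → ParField n m) e
  have hK : Algebra.IsAlgebraic (IntermediateField.adjoin ℂ s) (ParField n m) := by
    refine ⟨fun t => ?_⟩
    by_contra htr
    have hind : AlgebraicIndependent (IntermediateField.adjoin ℂ s) fun _ : Unit => t :=
      algebraicIndependent_unique_type_iff.2 htr
    obtain ⟨δ, hδ⟩ := exists_derivation hind fun _ => 1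
    let D := δ.restrictScalars ℂ
    have hD : ∀ x, D x = 0 := by
      refine derivation_eq_zero_of_par D ?_
      have h1 := deriv_sum_phi (r := r) D par
      have h2 := ht (fun i k => D (par i k)) ?_
      · exact fun i k => congrFun (congrFun h2 i) k
      · rw [← tanSum_apply, ← h1]
        funext e
        have hmem : (∑ i : Fin m, phi r (par i : Coord n → ParField n m)) e ∈
            IntermediateField.adjoin ℂ s :=
          IntermediateField.subset_adjoin _ _ ⟨e, by simp⟩
        exact δ.map_algebraMap ⟨_, hmem⟩
    exact one_ne_zero ((hδ ()).symm.trans (hD t))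
  open scoped IntermediateField.algebraAdjoinAdjoin in
  exact (IsFractionRing.comap_isAlgebraic_iff (A := Algebra.adjoin ℂ s)
    (K := IntermediateField.adjoin ℂ s)).2 hK

end Algebraicity

section Lift
variable {L Ω ι κ : Type*} [Field L] [Algebra ℂ L] [Field Ω] [Algebra ℂ Ω] [IsAlgClosed Ω]

/-- A specialization of a point `a` that stays generic on a subring over which the whole field is
algebraic is a generic point itself. -/
theorem exists_algHom_of_specialization {a : ι → L} {b : ι → Ω} {Q : κ → MvPolynomial ι ℂ}
    (halg : Algebra.IsAlgebraic (Algebra.adjoin ℂ (Set.range fun e => aeval a (Q e))) L)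
    (h1 : ∀ P : MvPolynomial ι ℂ, aeval a P = 0 → aeval b P = 0)
    (h2 : ∀ g : MvPolynomial κ ℂ, aeval b (bind₁ Q g) = 0 → aeval a (bind₁ Q g) = 0) :
    ∃ ψ : L →ₐ[ℂ] Ω, ∀ i, ψ (a i) = b i := by
  have hinj : ∀ P : MvPolynomial ι ℂ, aeval b P = 0 → aeval a P = 0 := by
    intro P hP
    by_contra hP0
    obtain ⟨t, ht, x, hx0, hx⟩ := (halg.isAlgebraic (aeval a P)).exists_nonzero_eq_adjoin_mul
      (mem_nonZeroDivisors_of_ne_zero hP0)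
    have hmem : ∀ x ∈ Algebra.adjoin ℂ (Set.range fun e => aeval a (Q e)),
        ∃ g, x = aeval a (bind₁ Q g) := by
      intro x hx
      rw [Algebra.adjoin_range_eq_range_aeval] at hx
      obtain ⟨g, rfl⟩ := hx
      exact ⟨g, (aeval_bind₁ a Q g).symm⟩
    have ht' : ∃ P' : MvPolynomial ι ℂ, t = aeval a P' := by
      clear hx
      induction ht using Algebra.adjoin_induction with
      | mem x hx => exact ⟨P, hx⟩
      | algebraMap x =>
        obtain ⟨g, hg⟩ := hmem x x.2
        exact ⟨_, hg⟩
      | add x y _ _ hx hy =>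
        obtain ⟨p, rfl⟩ := hx
        obtain ⟨q, rfl⟩ := hy
        exact ⟨p + q, (map_add _ _ _).symm⟩
      | mul x y _ _ hx hy =>
        obtain ⟨p, rfl⟩ := hx
        obtain ⟨q, rfl⟩ := hy
        exact ⟨p * q, (map_mul _ _ _).symm⟩
    obtain ⟨P', rfl⟩ := ht'
    obtain ⟨g, hg⟩ := hmem x x.2
    have hx' : aeval a P * aeval a P' = (x : L) := hx
    have h3 := h1 (P * P' - bind₁ Q g) (by rw [map_sub, map_mul, hx', hg, sub_self])
    rw [map_sub, map_mul, hP, zero_mul, zero_sub, neg_eq_zero] at h3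
    exact hx0 (Subtype.ext (hg.trans (h2 g h3)))
  let f : MvPolynomial ι ℂ →ₐ[ℂ] (aeval a : MvPolynomial ι ℂ →ₐ[ℂ] L).range :=
    (aeval a).rangeRestrict
  have hf : Function.Surjective f := AlgHom.rangeRestrict_surjective _
  have hfa : ∀ P, f P = 0 ↔ aeval a P = 0 := fun P => by
    rw [← Subtype.coe_inj]; rfl
  let φ : (aeval a : MvPolynomial ι ℂ →ₐ[ℂ] L).range →ₐ[ℂ] Ω :=
    f.liftOfSurjective hf (aeval b) fun P hP => h1 P ((hfa P).1 hP)
  have hφ : ∀ P, φ (f P) = aeval b P := fun P => AlgHom.liftOfSurjective_apply ..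
  have hφinj : Function.Injective φ := by
    rw [injective_iff_map_eq_zero]
    intro x hx
    obtain ⟨P, rfl⟩ := hf x
    rw [hφ] at hx
    exact (hfa P).2 (hinj P hx)
  let _ : Algebra (aeval a : MvPolynomial ι ℂ →ₐ[ℂ] L).range Ω := φ.toRingHom.toAlgebra
  have : Module.IsTorsionFree (aeval a : MvPolynomial ι ℂ →ₐ[ℂ] L).range Ω :=
    Module.isTorsionFree_iff_algebraMap_injective.2 hφinj
  have halg' : Algebra.IsAlgebraic (aeval a : MvPolynomial ι ℂ →ₐ[ℂ] L).range L := by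
    have hle : Algebra.adjoin ℂ (Set.range fun e => aeval a (Q e)) ≤
        (aeval a : MvPolynomial ι ℂ →ₐ[ℂ] L).range := by
      rw [Algebra.adjoin_le_iff]
      rintro _ ⟨e, rfl⟩
      exact ⟨Q e, rfl⟩
    exact ⟨fun x => (halg.isAlgebraic x).tower_top_of_subalgebra_le hle⟩
  let ψ : L →ₐ[(aeval a : MvPolynomial ι ℂ →ₐ[ℂ] L).range] Ω := IsAlgClosed.lift
  have hψ : ∀ P, ψ (aeval a P) = aeval b P := fun P => (ψ.commutes (f P)).trans (hφ P)
  refine ⟨{ ψ.toRingHom with commutes' := fun c => ?_ }, fun i => ?_⟩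
  · simp
  · simpa using hψ (X i)

end Lift

section ZeroClosure
variable {κ : Type*}

/-- The common zeros of the polynomials vanishing on `S`. -/
def zeroClosure (S : Set (κ → ℂ)) : Set (κ → ℂ) :=
  {x | ∀ P : MvPolynomial κ ℂ, (∀ s ∈ S, eval s P = 0) → eval x P = 0}

theorem subset_zeroClosure (S : Set (κ → ℂ)) : S ⊆ zeroClosure S := fun x hx _ h => h x hx

theorem eval_eq_zero_of_mem_zeroClosure {S : Set (κ → ℂ)} {m : ℕ}
    {P : MvPolynomial (Fin m × κ) ℂ}
    (hP : ∀ x : Fin m → κ → ℂ, (∀ i, x i ∈ S) → eval (fun q => x q.1 q.2) P = 0)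
    {x : Fin m → κ → ℂ} (hx : ∀ i, x i ∈ zeroClosure S) : eval (fun q => x q.1 q.2) P = 0 := by
  classical
  suffices h : ∀ (T : Finset (Fin m)) (x : Fin m → κ → ℂ), (∀ i ∈ T, x i ∈ zeroClosure S) →
      (∀ i ∉ T, x i ∈ S) → eval (fun q => x q.1 q.2) P = 0 from
    h Finset.univ x (fun i _ => hx i) fun i hi => absurd (Finset.mem_univ i) hi
  intro T
  induction T using Finset.induction_on with
  | empty => exact fun x _ h => hP x fun i => h i (Finset.notMem_empty i)
  | insert i T hi ih =>
    intro x hx hxS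
    have key : ∀ y : κ → ℂ, eval y (bind₁ (fun q : Fin m × κ =>
        if q.1 = i then X q.2 else C (x q.1 q.2)) P) =
          eval (fun q => Function.update x i y q.1 q.2) P := by
      intro y
      rw [← coe_aeval_eq_eval, ← coe_aeval_eq_eval, RingHom.coe_coe, RingHom.coe_coe, aeval_bind₁]
      congr 2
      funext q
      by_cases hq : q.1 = i
      · simp [hq]
      · simp [hq]
    have h1 := hx i (Finset.mem_insert_self i T) (bind₁ (fun q : Fin m × κ =>
        if q.1 = i then X q.2 else C (x q.1 q.2)) P) fun s hs => by
      rw [key]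
      refine ih _ (fun j hj => ?_) fun j hj => ?_
      · have hji : j ≠ i := fun h => hi (h ▸ hj)
        rw [Function.update_of_ne hji]
        exact hx j (Finset.mem_insert_of_mem hj)
      · by_cases hji : j = i
        · subst hji; simpa using hs
        · rw [Function.update_of_ne hji]
          exact hxS j (by simp [hji, hj])
    rwa [key, Function.update_eq_self] at h1

theorem eval_sum_eq_zero_of_mem_zeroClosure {S : Set (κ → ℂ)} {m : ℕ} {P : MvPolynomial κ ℂ}
    (hP : ∀ x : Fin m → κ → ℂ, (∀ i, x i ∈ S) → eval (∑ i, x i) P = 0)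
    {x : Fin m → κ → ℂ} (hx : ∀ i, x i ∈ zeroClosure S) : eval (∑ i, x i) P = 0 := by
  have key : ∀ x : Fin m → κ → ℂ, eval (fun q : Fin m × κ => x q.1 q.2)
      (bind₁ (fun e => ∑ i : Fin m, X (i, e)) P) = eval (∑ i, x i) P := by
    intro x
    rw [← coe_aeval_eq_eval, ← coe_aeval_eq_eval, RingHom.coe_coe, RingHom.coe_coe, aeval_bind₁]
    congr 2
    funext e
    simp
  rw [← key]
  exact eval_eq_zero_of_mem_zeroClosure (fun x hx => by rw [key]; exact hP x hx) hx

end ZeroClosure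

section Zariski
variable {M ι : Type*} [AddCommGroup M] [Module ℂ M] [Fintype ι] (κ : M ≃ₗ[ℂ] (ι → ℂ))

theorem zIsOpenV_ne_zero (P : MvPolynomial ι ℂ) : zIsOpenV {x : M | eval (κ x) P ≠ 0} := by
  refine TopologicalSpace.isOpen_generateFrom_of_mem ⟨Fintype.card ι,
    rename (Fintype.equivFin ι) P,
    fun i => (LinearMap.proj ((Fintype.equivFin ι).symm i)).comp κ.toLinearMap, ?_⟩
  ext x
  have : ((fun i => ((LinearMap.proj ((Fintype.equivFin ι).symm i)).comp κ.toLinearMap) x) ∘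
      Fintype.equivFin ι) = κ x := by
    funext e
    simp
  rw [Set.mem_ofPred_eq, Set.mem_ofPred_eq, eval_rename, this]

theorem exists_ne_zero_of_zIsOpenV {U : Set M} (hU : zIsOpenV U) {x : M} (hx : x ∈ U) :
    ∃ P : MvPolynomial ι ℂ, eval (κ x) P ≠ 0 ∧ ∀ y, eval (κ y) P ≠ 0 → y ∈ U := by
  classical
  have hU' : TopologicalSpace.GenerateOpen { U : Set M | ∃ (k : ℕ)
    (p : MvPolynomial (Fin k) ℂ) (L : Fin k → M →ₗ[ℂ] ℂ),
        U = { x | MvPolynomial.eval (fun i => L i x) p ≠ 0 } } U := hU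
  induction hU' with
  | basic s hs =>
    obtain ⟨k, p, L, rfl⟩ := hs
    have key : ∀ y, eval (κ y) (bind₁ (fun i => ∑ j, C (L i (κ.symm (Pi.single j 1))) * X j) p) =
        eval (fun i => L i y) p := by
      intro y
      rw [← coe_aeval_eq_eval, ← coe_aeval_eq_eval, RingHom.coe_coe, RingHom.coe_coe, aeval_bind₁]
      congr 2
      funext i
      have h1 : L i y = L i (κ.symm (κ y)) := by rw [LinearEquiv.symm_apply_apply]
      rw [h1]
      conv_rhs => rw [pi_eq_sum_univ' (κ y)]
      simp [mul_comm]
    exact ⟨_, by rw [key]; exact hx, fun y hy => by rwa [key] at hy⟩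
  | univ => exact ⟨1, by simp, fun _ _ => trivial⟩
  | inter s t hs ht ihs iht =>
    obtain ⟨P, hP, hP'⟩ := ihs hs hx.1
    obtain ⟨Q, hQ, hQ'⟩ := iht ht hx.2
    refine ⟨P * Q, by rw [map_mul]; exact mul_ne_zero hP hQ, fun y hy => ?_⟩
    rw [map_mul] at hy
    exact ⟨hP' y (left_ne_zero_of_mul hy), hQ' y (right_ne_zero_of_mul hy)⟩
  | sUnion S hS ih =>
    obtain ⟨t, htS, hxt⟩ := hx
    obtain ⟨P, hP, hP'⟩ := ih t htS (hS t htS) hxt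
    exact ⟨P, hP, fun y hy => ⟨t, htS, hP' y hy⟩⟩

theorem mem_zClosureV_iff {S : Set M} {x : M} : x ∈ zClosureV S ↔ κ x ∈ zeroClosure (κ '' S) := by
  rw [zClosureV, @mem_closure_iff _ (ztV M)]
  refine ⟨fun h P hP => ?_, fun h U hU hx => ?_⟩
  · by_contra h0
    obtain ⟨y, hy, hyS⟩ := h _ (zIsOpenV_ne_zero κ P) h0
    exact hy (hP _ ⟨y, hyS, rfl⟩)
  · by_contra hne
    obtain ⟨P, hP, hP'⟩ := exists_ne_zero_of_zIsOpenV κ hU hx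
    refine hP (h P ?_)
    rintro _ ⟨s, hs, rfl⟩
    by_contra h0
    exact hne ⟨s, hP' s h0, hs⟩

/-- Identifiability of the closure of a set, in coordinates. -/
theorem isIdentifiableV_of_coordinates {m : ℕ} {V : Set M} {S : Set (ι → ℂ)}
    (hV : ∀ x, x ∈ V ↔ κ x ∈ zeroClosure S) (f : MvPolynomial ι ℂ)
    (hf : ∀ P : MvPolynomial ι ℂ,
      (∀ x : Fin m → ι → ℂ, (∀ i, x i ∈ S) → eval (∑ i, x i) (P * f) = 0) →
        ∀ x : Fin m → ι → ℂ, (∀ i, x i ∈ S) → eval (∑ i, x i) P = 0)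
    (hgood : ∀ p ∈ zeroClosure {p | ∃ x : Fin m → ι → ℂ, (∀ i, x i ∈ S) ∧ p = ∑ i, x i},
      eval p f ≠ 0 →
      (∃ x : Fin m → ι → ℂ, (∀ i, x i ∈ zeroClosure S) ∧ p = ∑ i, x i) ∧
      ∀ x y : Fin m → ι → ℂ, (∀ i, x i ∈ zeroClosure S) → (∀ i, y i ∈ zeroClosure S) →
        p = ∑ i, x i → p = ∑ i, y i → ∃ e : Equiv.Perm (Fin m), ∀ i, y i = x (e i)) :
    IsIdentifiableV m V := by
  have hsec : ∀ p, p ∈ secantV m V →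
      κ p ∈ zeroClosure {p | ∃ x : Fin m → ι → ℂ, (∀ i, x i ∈ S) ∧ p = ∑ i, x i} := by
    intro p hp P hP
    rw [secantV, mem_zClosureV_iff κ] at hp
    refine hp P ?_
    rintro _ ⟨_, ⟨x, hx, rfl⟩, rfl⟩
    rw [map_sum]
    exact eval_sum_eq_zero_of_mem_zeroClosure (fun x hx => hP _ ⟨x, hx, rfl⟩)
      fun i => (hV _).1 (hx i)
  have hsum : ∀ x : Fin m → ι → ℂ, (∀ i, x i ∈ zeroClosure S) →
      (∀ i, κ.symm (x i) ∈ V) ∧ κ (∑ i, κ.symm (x i)) = ∑ i, x i := by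
    intro x hx
    exact ⟨fun i => by rw [hV, LinearEquiv.apply_symm_apply]; exact hx i, by simp⟩
  refine ⟨{x | eval (κ x) f ≠ 0} ∩ secantV m V, Set.inter_subset_right,
    ⟨_, zIsOpenV_ne_zero κ f, rfl⟩, fun p hp => ?_, ?_⟩
  · rw [mem_zClosureV_iff κ]
    intro P hP
    refine hsec p hp P ?_
    rintro _ ⟨x, hx, rfl⟩
    refine hf P (fun x hx => ?_) x hx
    by_cases h0 : eval (∑ i, x i) f = 0
    · rw [map_mul, h0, mul_zero]
    · have hx' := hsum x fun i => subset_zeroClosure S (hx i)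
      rw [map_mul, hP, zero_mul]
      refine ⟨∑ i, κ.symm (x i), ⟨?_, ?_⟩, hx'.2⟩
      · rw [Set.mem_ofPred_eq, hx'.2]
        exact h0
      · rw [secantV, mem_zClosureV_iff κ]
        exact subset_zeroClosure _ ⟨_, ⟨_, hx'.1, rfl⟩, rfl⟩
  · rintro p ⟨hpf, hp⟩
    obtain ⟨⟨x, hx, hpx⟩, huniq⟩ := hgood (κ p) (hsec p hp) hpf
    refine ⟨⟨fun i => κ.symm (x i), (hsum x hx).1, κ.injective ?_⟩, fun y z hy hz hpy hpz => ?_⟩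
    · rw [(hsum x hx).2, hpx]
    · obtain ⟨e, he⟩ := huniq (fun i => κ (y i)) (fun i => κ (z i)) (fun i => (hV _).1 (hy i))
        (fun i => (hV _).1 (hz i)) (by rw [hpy, map_sum]) (by rw [hpz, map_sum])
      exact ⟨e, fun i => κ.injective (he i)⟩

end Zariski

section MomentCoordinates
variable {n : ℕ}

/-- The coordinates of a form. -/
def formCoord (n k : ℕ) : ↥(homogeneousSubmodule (Fin n) ℂ k) ≃ₗ[ℂ] (Mon n k → ℂ) where
  toFun f := coeffs n k ℂ f
  map_add' f g := by simp
  map_smul' a f := by simp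
  invFun u := ⟨form n k ℂ u, isHomogeneous_form u⟩
  left_inv f := Subtype.ext (form_coeffs f.2)
  right_inv u := coeffs_form u

theorem formCoord_apply {k : ℕ} (f : ↥(homogeneousSubmodule (Fin n) ℂ k)) :
    formCoord n k f = coeffs n k ℂ f := rfl

section ExplicitFormula
variable {A : Type*} [CommRing A] [Algebra ℂ A]

/-- The summands of `expPart`. -/
def expTerm (l q : A) (k j : ℕ) : A :=
  if 2 * j ≤ k then ((j.factorial * (k - 2 * j).factorial : ℂ)⁻¹) • (l ^ (k - 2 * j) * q ^ j) else 0

theorem expTerm_rec_zero (l q : A) (k : ℕ) :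
    (k + 2 : ℂ) • expTerm l q (k + 2) 0 = l * expTerm l q (k + 1) 0 := by
  have h1 : (k + 2 : ℂ) ≠ 0 := by exact_mod_cast (by omega : k + 2 ≠ 0)
  have h2 : ((k + 1).factorial : ℂ) ≠ 0 := by exact_mod_cast Nat.factorial_ne_zero _
  simp only [expTerm, mul_zero, Nat.zero_le, if_true, Nat.sub_zero, pow_zero, mul_one,
    mul_smul_comm, Nat.factorial_zero, Nat.cast_one, one_mul, smul_smul]
  rw [show k + 2 = k + 1 + 1 by ring, Nat.factorial_succ, pow_succ']
  push_cast
  congr 1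
  rw [show (k + 1 + 1 : ℂ) = k + 2 by ring]
  field_simp

theorem expTerm_rec_succ (l q : A) (k j : ℕ) :
    (k + 2 : ℂ) • expTerm l q (k + 2) (j + 1) =
      l * expTerm l q (k + 1) (j + 1) + 2 * q * expTerm l q k j := by
  have hj : ((j.factorial : ℂ)) ≠ 0 := by exact_mod_cast Nat.factorial_ne_zero _
  have hj1 : (j + 1 : ℂ) ≠ 0 := by exact_mod_cast (by omega : j + 1 ≠ 0)
  have h2 : (2 : A) = algebraMap ℂ A 2 := (map_ofNat _ _).symm
  rcases lt_trichotomy k (2 * j) with h | h | h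
  · simp [expTerm, show ¬ 2 * (j + 1) ≤ k + 2 by omega, show ¬ 2 * (j + 1) ≤ k + 1 by omega,
      show ¬ 2 * j ≤ k by omega]
  · subst h
    simp only [expTerm, show 2 * (j + 1) ≤ 2 * j + 2 by omega,
      show ¬ 2 * (j + 1) ≤ 2 * j + 1 by omega, if_true, if_false, le_refl,
      show 2 * j + 2 - 2 * (j + 1) = 0 by omega, Nat.sub_self, Nat.factorial_zero, pow_zero,
      Nat.factorial_succ, mul_zero, zero_add, one_mul, smul_smul, mul_smul_comm, h2,
      ← Algebra.smul_def, smul_mul_assoc, pow_succ' q]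
    congr 1
    push_cast
    field_simp
  · obtain ⟨i, rfl⟩ : ∃ i, k = i + 1 + 2 * j := ⟨k - 2 * j - 1, by omega⟩
    have hi : ((i.factorial : ℂ)) ≠ 0 := by exact_mod_cast Nat.factorial_ne_zero _
    have hi1 : (i + 1 : ℂ) ≠ 0 := by exact_mod_cast (by omega : i + 1 ≠ 0)
    have e1 : l * (l ^ i * q ^ (j + 1)) = l ^ (i + 1) * q ^ (j + 1) := by ring
    have e2 : q * (l ^ (i + 1) * q ^ j) = l ^ (i + 1) * q ^ (j + 1) := by ring
    simp only [expTerm, show 2 * (j + 1) ≤ i + 1 + 2 * j + 2 by omega,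
      show 2 * (j + 1) ≤ i + 1 + 2 * j + 1 by omega, show 2 * j ≤ i + 1 + 2 * j by omega, if_true,
      show i + 1 + 2 * j + 2 - 2 * (j + 1) = i + 1 by omega,
      show i + 1 + 2 * j + 1 - 2 * (j + 1) = i by omega,
      show i + 1 + 2 * j - 2 * j = i + 1 by omega, mul_smul_comm, h2,
      ← Algebra.smul_def, smul_mul_assoc, smul_smul, e1, e2, Nat.factorial_succ, ← add_smul]
    congr 1
    push_cast
    field_simp
    ring

theorem expPart_eq_sum (l q : A) (k : ℕ) :
    ∀ K, k < 2 * K → expPart l q k = ∑ j ∈ Finset.range K, expTerm l q k j := by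
  induction k using Nat.strong_induction_on with
  | _ k ih =>
    intro K hK
    obtain ⟨K, rfl⟩ : ∃ K', K = K' + 1 := ⟨K - 1, by omega⟩
    match k, ih with
    | 0, _ =>
      rw [Finset.sum_range_succ', Finset.sum_eq_zero]
      · simp [expTerm, expPart_zero]
      · intro j _
        simp [expTerm]
    | 1, _ =>
      rw [Finset.sum_range_succ', Finset.sum_eq_zero]
      · simp [expTerm, expPart_one]
      · intro j _
        simp [expTerm, show ¬ 2 * (j + 1) ≤ 1 by omega]
    | k + 2, ih =>
      have hk : (k + 2 : ℂ) ≠ 0 := by exact_mod_cast (by omega : k + 2 ≠ 0)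
      rw [expPart, inv_smul_eq_iff₀ hk, ih (k + 1) (by omega) (K + 1) (by omega),
        ih k (by omega) K (by omega), Finset.sum_range_succ', Finset.sum_range_succ', smul_add,
        expTerm_rec_zero, Finset.smul_sum, mul_add, Finset.mul_sum, Finset.mul_sum, add_right_comm,
        ← Finset.sum_add_distrib]
      exact congrArg (· + _) (Finset.sum_congr rfl fun j _ => (expTerm_rec_succ l q k j).symm)

end ExplicitFormula

theorem sMoment_eq_expPart (d : ℕ) (l q : MvPolynomial (Fin n) ℂ) :
    sMoment n d l q = expPart l ((2 : ℂ)⁻¹ • q) d := by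
  rw [sMoment, expPart_eq_sum l _ d (d / 2 + 1) (by omega)]
  refine Finset.sum_congr rfl fun j hj => ?_
  have hj' : 2 * j ≤ d := by have := Finset.mem_range.1 hj; omega
  rw [expTerm, if_pos hj', smul_pow, mul_smul_comm, smul_smul]
  congr 1
  push_cast
  rw [one_div, inv_pow, ← mul_inv]
  congr 1
  ring

theorem mem_GMVariety_iff {r : ℕ} (x : ↥(homogeneousSubmodule (Fin n) ℂ (r + 4))) :
    x ∈ GMVariety n (r + 4) ↔
      formCoord n (r + 4) x ∈ zeroClosure (Set.range (phi r : (Coord n → ℂ) → _)) := by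
  rw [GMVariety, mem_zClosureV_iff (formCoord n (r + 4))]
  suffices h : formCoord n (r + 4) '' { f | ∃ ℓ q : MvPolynomial (Fin n) ℂ,
      ℓ ∈ homogeneousSubmodule (Fin n) ℂ 1 ∧ q ∈ homogeneousSubmodule (Fin n) ℂ 2 ∧
      (f : MvPolynomial (Fin n) ℂ) = sMoment n (r + 4) ℓ q } =
        Set.range (phi r : (Coord n → ℂ) → _) by rw [h]
  ext y
  constructor
  · rintro ⟨f, ⟨l, q, hl, hq, hf⟩, rfl⟩
    refine ⟨point l ((2 : ℂ)⁻¹ • q), ?_⟩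
    rw [phi, mom, lin_point hl,
      quad_point (Submodule.smul_mem (homogeneousSubmodule (Fin n) ℂ 2) _ hq), formCoord_apply, hf,
      sMoment_eq_expPart]
  · rintro ⟨u, rfl⟩
    refine ⟨⟨mom u (r + 4), isHomogeneous_mom u _⟩, ⟨lin n ℂ u, (2 : ℂ) • quad n ℂ u,
      isHomogeneous_lin u,
      Submodule.smul_mem (homogeneousSubmodule (Fin n) ℂ 2) _ (isHomogeneous_quad u), ?_⟩, rfl⟩
    rw [sMoment_eq_expPart, smul_smul, inv_mul_cancel₀ two_ne_zero, one_smul]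
    rfl

end MomentCoordinates

section Ultraproduct
variable {T : Type*}

/-- The ultrapower of the complex numbers. -/
def UltraC (U : Ultrafilter T) : Type _ := (U : Filter T).Germ ℂ

variable (U : Ultrafilter T)

instance : Field (UltraC U) := inferInstanceAs (Field ((U : Filter T).Germ ℂ))

/-- The class of a family of complex numbers. -/
def ultraMk : (T → ℂ) →+* UltraC U := Filter.Germ.coeRingHom (U : Filter T)

instance : Algebra ℂ (UltraC U) := ((ultraMk U).comp (algebraMap ℂ (T → ℂ))).toAlgebra

/-- The class of a family of complex numbers, as an algebra homomorphism. -/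
def ultraMkAlg : (T → ℂ) →ₐ[ℂ] UltraC U := { ultraMk U with commutes' := fun _ => rfl }

variable {U}

theorem ultraMkAlg_eq_iff {x y : T → ℂ} :
    ultraMkAlg U x = ultraMkAlg U y ↔ ∀ᶠ t in (U : Filter T), x t = y t :=
  Filter.Germ.coe_eq

theorem ultraMkAlg_surjective : Function.Surjective (ultraMkAlg U) := fun x => by
  induction x using Filter.Germ.inductionOn with
  | _ x => exact ⟨x, rfl⟩

theorem ultraMkAlg_aeval {ι : Type*} (x : T → ι → ℂ) (P : MvPolynomial ι ℂ) :
    aeval (fun i => ultraMkAlg U fun t => x t i) P = ultraMkAlg U fun t => eval (x t) P := by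
  have h : ∀ t, (aeval (fun i t => x t i) P : T → ℂ) t = eval (x t) P := by
    intro t
    have := comp_aeval_apply (fun i t => x t i) (Pi.evalAlgHom ℂ (fun _ : T => ℂ) t) P
    exact this
  have h2 := comp_aeval_apply (fun i t => x t i) (ultraMkAlg U) P
  rw [← funext h]
  exact h2.symm

theorem ultraMkAlg_aeval_eq_zero_iff {ι : Type*} (x : T → ι → ℂ) (P : MvPolynomial ι ℂ) :
    aeval (fun i => ultraMkAlg U fun t => x t i) P = 0 ↔
      ∀ᶠ t in (U : Filter T), eval (x t) P = 0 := by
  rw [ultraMkAlg_aeval, ← map_zero (ultraMkAlg U), ultraMkAlg_eq_iff]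
  rfl

instance : IsAlgClosed (UltraC U) := by
  refine IsAlgClosed.of_exists_root _ fun p hp hirr => ?_
  have hdeg : p.natDegree ≠ 0 := hirr.natDegree_pos.ne'
  choose c hc using fun i => ultraMkAlg_surjective (U := U) (p.coeff i)
  have hroot : ∀ t, ∃ z : ℂ, z ^ p.natDegree +
      ∑ i ∈ Finset.range p.natDegree, c i t * z ^ i = 0 := by
    intro t
    let q : Polynomial ℂ := Polynomial.X ^ p.natDegree +
      ∑ i ∈ Finset.range p.natDegree, Polynomial.C (c i t) * Polynomial.X ^ i
    have hq : q.degree = p.natDegree := by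
      rw [Polynomial.degree_add_eq_left_of_degree_lt] <;> rw [Polynomial.degree_X_pow]
      rw [Finset.sum_range]
      exact Polynomial.degree_sum_fin_lt _
    obtain ⟨z, hz⟩ := IsAlgClosed.exists_root q (by
      rw [hq]; exact_mod_cast hdeg)
    refine ⟨z, ?_⟩
    simpa [q, Polynomial.IsRoot.def, Polynomial.eval_finsetSum] using hz
  choose z hz using hroot
  refine ⟨ultraMkAlg U z, ?_⟩
  rw [Polynomial.eval_eq_sum_range, Finset.sum_range_succ, hp.coeff_natDegree, one_mul, add_comm]
  simp only [← hc, ← map_pow, ← map_mul, ← map_sum, ← map_add]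
  rw [← map_zero (ultraMkAlg U)]
  congr 1
  funext t
  simpa using hz t

end Ultraproduct

section Generic
variable {n r m : ℕ}

theorem aeval_par_eq_zero_iff (P : MvPolynomial (Fin m × Coord n) ℂ) :
    aeval (fun p : Fin m × Coord n => (par p.1 p.2 : ParField n m)) P = 0 ↔
      ∀ u : Fin m → Coord n → ℂ, eval (fun p => u p.1 p.2) P = 0 := by
  rw [map_eq_zero_iff _ (algebraicIndependent_iff_injective_aeval.1 algebraicIndependent_par)]
  refine ⟨fun h u => by rw [h, map_zero], fun h => MvPolynomial.funext fun u => ?_⟩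
  rw [map_zero]
  exact h fun i k => u (i, k)

/-- The components of `phi r` at each of `m` points. -/
def phiPolyAt (r : ℕ) (q : Fin m × Mon n (r + 4)) : MvPolynomial (Fin m × Coord n) ℂ :=
  rename (fun k => (q.1, k)) (phiPoly r q.2)

theorem aeval_phiPolyAt {F : Type*} [Field F] [Algebra ℂ F] (u : Fin m → Coord n → F)
    (q : Fin m × Mon n (r + 4)) :
    aeval (fun p : Fin m × Coord n => u p.1 p.2) (phiPolyAt r q) = phi r (u q.1) q.2 := by
  rw [phiPolyAt, aeval_rename, ← aeval_phiPoly]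
  rfl

theorem aeval_phi_par_eq_zero_iff (P : MvPolynomial (Fin m × Mon n (r + 4)) ℂ) :
    aeval (fun q : Fin m × Mon n (r + 4) => phi r (par q.1 : Coord n → ParField n m) q.2) P = 0 ↔
      ∀ u : Fin m → Coord n → ℂ, eval (fun q => phi r (u q.1) q.2) P = 0 := by
  have h := aeval_par_eq_zero_iff (bind₁ (phiPolyAt r) P : MvPolynomial (Fin m × Coord n) ℂ)
  simp only [← coe_aeval_eq_eval, RingHom.coe_coe, aeval_bind₁, aeval_phiPolyAt] at h ⊢
  exact h

/-- The sum of the blocks of variables. -/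
def sumPoly (m : ℕ) {κ : Type*} (e : κ) : MvPolynomial (Fin m × κ) ℂ := ∑ i : Fin m, X (i, e)

theorem aeval_sumPoly {κ F : Type*} [Field F] [Algebra ℂ F] (x : Fin m → κ → F) (e : κ) :
    aeval (fun q : Fin m × κ => x q.1 q.2) (sumPoly m e) = ∑ i, x i e := by
  simp [sumPoly]

theorem eval_bind₁_sumPoly {κ : Type*} (x : Fin m → κ → ℂ) (P : MvPolynomial κ ℂ) :
    eval (fun q : Fin m × κ => x q.1 q.2) (bind₁ (sumPoly m) P) = eval (∑ i, x i) P := by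
  rw [← coe_aeval_eq_eval, ← coe_aeval_eq_eval, RingHom.coe_coe, RingHom.coe_coe, aeval_bind₁]
  simp only [aeval_sumPoly]
  congr 2
  funext e
  simp

theorem aeval_sum_phi_par_eq_zero_iff (P : MvPolynomial (Mon n (r + 4)) ℂ) :
    aeval (fun e => ∑ i : Fin m, phi r (par i : Coord n → ParField n m) e) P = 0 ↔
      ∀ u : Fin m → Coord n → ℂ, eval (∑ i, phi r (u i)) P = 0 := by
  have h := aeval_phi_par_eq_zero_iff (n := n) (m := m) (bind₁ (sumPoly m) P)
  rw [aeval_bind₁] at h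
  simp only [aeval_sumPoly fun i => phi r (par i : Coord n → ParField n m)] at h
  rw [h]
  exact forall_congr' fun u => by rw [← eval_bind₁_sumPoly fun i => phi r (u i)]

theorem eval_sum_phi_eq_zero_of_mul {P f : MvPolynomial (Mon n (r + 4)) ℂ}
    {u₀ : Fin m → Coord n → ℂ} (hf : eval (∑ i, phi r (u₀ i)) f ≠ 0)
    (h : ∀ u : Fin m → Coord n → ℂ, eval (∑ i, phi r (u i)) (P * f) = 0)
    (u : Fin m → Coord n → ℂ) : eval (∑ i, phi r (u i)) P = 0 := by
  rw [← aeval_sum_phi_par_eq_zero_iff, map_mul, mul_eq_zero] at h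
  rcases h with h | h
  · exact (aeval_sum_phi_par_eq_zero_iff P).1 h u
  · exact absurd ((aeval_sum_phi_par_eq_zero_iff f).1 h u₀) hf

variable {T : Type*} {U : Ultrafilter T} {p : T → Mon n (r + 4) → ℂ}

theorem eventually_exists_eq_sum_phi
    (ht : TangentsIndependent r (par : Fin m → Coord n → ParField n m))
    (hp : ∀ g : MvPolynomial (Mon n (r + 4)) ℂ, (∀ᶠ t in (U : Filter T), eval (p t) g = 0) ↔
      ∀ u : Fin m → Coord n → ℂ, eval (∑ i, phi r (u i)) g = 0) :
    ∀ᶠ t in (U : Filter T), ∃ u : Fin m → Coord n → ℂ, p t = ∑ i, phi r (u i) := by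
  have halg := isAlgebraic_adjoin_sum_phi ht
  have hX : (fun e => ∑ i : Fin m, phi r (par i : Coord n → ParField n m) e) = fun e =>
      aeval (fun e => ∑ i : Fin m, phi r (par i : Coord n → ParField n m) e)
        (X e : MvPolynomial (Mon n (r + 4)) ℂ) := by
    simp only [aeval_X]
  rw [hX] at halg
  obtain ⟨ψ, hψ⟩ := exists_algHom_of_specialization
    (a := fun e => ∑ i : Fin m, phi r (par i : Coord n → ParField n m) e)
    (b := fun e => ultraMkAlg U fun t => p t e) (Q := X) halg
    (fun P hP => by
      rw [ultraMkAlg_aeval_eq_zero_iff, hp]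
      exact (aeval_sum_phi_par_eq_zero_iff P).1 hP)
    (fun g hg => by
      rw [bind₁_X_left, AlgHom.id_apply, ultraMkAlg_aeval_eq_zero_iff, hp] at hg
      rw [bind₁_X_left, AlgHom.id_apply, aeval_sum_phi_par_eq_zero_iff]
      exact hg)
  choose u hu using fun i k => ultraMkAlg_surjective (U := U) (ψ (par i k : ParField n m))
  have key : ∀ e, ∀ᶠ t in (U : Filter T), p t e = ∑ i, phi r (fun k => u i k t) e := by
    intro e
    rw [← ultraMkAlg_eq_iff, ← hψ, map_sum]
    have h1 : (fun t => ∑ i, phi r (fun k => u i k t) e) =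
        ∑ i, fun t => eval (fun k => u i k t) (phiPoly r e) := by
      funext t
      rw [Finset.sum_apply]
      refine Finset.sum_congr rfl fun i _ => ?_
      rw [← aeval_phiPoly, aeval_eq_eval]
    rw [h1, map_sum]
    refine Finset.sum_congr rfl fun i _ => ?_
    rw [← ultraMkAlg_aeval (U := U) (fun t k => u i k t), aeval_phiPoly]
    simp only [hu]
    exact congrFun (map_phi ψ r (par i)) e
  filter_upwards [Filter.eventually_all.2 key] with t h
  refine ⟨fun i k => u i k t, funext fun e => ?_⟩
  rw [h e, Finset.sum_apply]

/-- Generic decompositions are images of the tautological one. -/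
theorem exists_algebraicIndependent_of_eventually
    (ht : TangentsIndependent r (par : Fin m → Coord n → ParField n m))
    (hp : ∀ g : MvPolynomial (Mon n (r + 4)) ℂ, (∀ᶠ t in (U : Filter T), eval (p t) g = 0) ↔
      ∀ u : Fin m → Coord n → ℂ, eval (∑ i, phi r (u i)) g = 0)
    {x : T → Fin m → Mon n (r + 4) → ℂ}
    (hx : ∀ᶠ t in (U : Filter T), ∀ i, x t i ∈ zeroClosure (Set.range (phi r : (Coord n → ℂ) → _)))
    (hpx : ∀ᶠ t in (U : Filter T), p t = ∑ i, x t i) :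
    ∃ v : Fin m → Coord n → UltraC U,
      (AlgebraicIndependent ℂ fun q : Fin m × Coord n => v q.1 q.2) ∧
        ∀ i e, phi r (v i) e = ultraMkAlg U fun t => x t i e := by
  have halg := isAlgebraic_adjoin_sum_phi ht
  have hQ : (fun e => ∑ i : Fin m, phi r (par i : Coord n → ParField n m) e) = fun e =>
      aeval (fun q : Fin m × Mon n (r + 4) => phi r (par q.1 : Coord n → ParField n m) q.2)
        (sumPoly m e) :=
    funext fun e => (aeval_sumPoly (fun i => phi r (par i : Coord n → ParField n m)) e).symm
  rw [hQ] at halg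
  obtain ⟨ψ, hψ⟩ := exists_algHom_of_specialization
    (a := fun q : Fin m × Mon n (r + 4) => phi r (par q.1 : Coord n → ParField n m) q.2)
    (b := fun q => ultraMkAlg U fun t => x t q.1 q.2) (Q := sumPoly m)
    halg
    (fun P hP => by
      rw [ultraMkAlg_aeval_eq_zero_iff fun t (q : Fin m × Mon n (r + 4)) => x t q.1 q.2]
      rw [aeval_phi_par_eq_zero_iff] at hP
      filter_upwards [hx] with t hxt
      refine eval_eq_zero_of_mem_zeroClosure (fun y hy => ?_) hxt
      choose u hu using hy
      simp only [← hu]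
      exact hP u)
    (fun g hg => by
      rw [ultraMkAlg_aeval_eq_zero_iff fun t (q : Fin m × Mon n (r + 4)) => x t q.1 q.2] at hg
      rw [aeval_phi_par_eq_zero_iff]
      intro u
      rw [eval_bind₁_sumPoly fun i => phi r (u i)]
      refine (hp g).1 ?_ u
      filter_upwards [hg, hpx] with t h1 h2
      rwa [h2, ← eval_bind₁_sumPoly])
  refine ⟨fun i k => ψ (par i k), algebraicIndependent_par.map' ψ.injective, fun i e => ?_⟩
  exact (congrFun (map_phi ψ r (par i)) e).symm.trans (hψ (i, e))

theorem eventually_exists_perm (hn : 0 < n) (hcard : 2 < Fintype.card (Coord n))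
    (ht : TangentsIndependent r (par : Fin m → Coord n → ParField n m))
    (htU : ∀ {v : Fin m → Coord n → UltraC U},
      (AlgebraicIndependent ℂ fun q : Fin m × Coord n => v q.1 q.2) →
        TangentsIndependent r v ∧ ∀ i, ContactTrivialAt r v i)
    (hp : ∀ g : MvPolynomial (Mon n (r + 4)) ℂ, (∀ᶠ t in (U : Filter T), eval (p t) g = 0) ↔
      ∀ u : Fin m → Coord n → ℂ, eval (∑ i, phi r (u i)) g = 0)
    {x y : T → Fin m → Mon n (r + 4) → ℂ}
    (hx : ∀ᶠ t in (U : Filter T), ∀ i, x t i ∈ zeroClosure (Set.range (phi r : (Coord n → ℂ) → _)))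
    (hy : ∀ᶠ t in (U : Filter T), ∀ i, y t i ∈ zeroClosure (Set.range (phi r : (Coord n → ℂ) → _)))
    (hpx : ∀ᶠ t in (U : Filter T), p t = ∑ i, x t i)
    (hpy : ∀ᶠ t in (U : Filter T), p t = ∑ i, y t i) :
    ∀ᶠ t in (U : Filter T), ∃ π : Equiv.Perm (Fin m), ∀ i, y t i = x t (π i) := by
  obtain ⟨v, hv, hvx⟩ := exists_algebraicIndependent_of_eventually ht hp hx hpx
  obtain ⟨w, hw, hwy⟩ := exists_algebraicIndependent_of_eventually ht hp hy hpy
  obtain ⟨π, hπ⟩ := exists_perm_of_sum_phi_eq hn hcard hw hv (htU hw).1 (htU hv).1 (htU hv).2 (by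
    funext e
    simp only [Finset.sum_apply, hvx, hwy, ← map_sum]
    rw [ultraMkAlg_eq_iff]
    filter_upwards [hpx, hpy] with t h1 h2
    simpa using congrFun (h2.symm.trans h1) e)
  have key : ∀ i e, ∀ᶠ t in (U : Filter T), y t i e = x t (π i) e := by
    intro i e
    rw [← ultraMkAlg_eq_iff, ← hwy, ← hvx, hπ]
  filter_upwards [Filter.eventually_all.2 fun i => Filter.eventually_all.2 (key i)] with t h
  exact ⟨π, fun i => funext (h i)⟩

end Generic

section Main
variable {n r m N : ℕ}

/-- An ultrafilter on polynomials not vanishing identically on a set of points, containing the sets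
of multiples. -/
theorem exists_ultrafilter_dvd {κ : Type} {A : Type*} [CommRing A] [IsDomain A] [Algebra ℂ A]
    (a : κ → A) : ∃ U : Ultrafilter {f : MvPolynomial κ ℂ // aeval a f ≠ 0},
      ∀ g : MvPolynomial κ ℂ, aeval a g ≠ 0 →
        ∀ᶠ f in (U : Filter {f : MvPolynomial κ ℂ // aeval a f ≠ 0}), g ∣ f.1 := by
  let T := {f : MvPolynomial κ ℂ // aeval a f ≠ 0}
  let S : T → Set T := fun g => {f | g.1 ∣ f.1}
  have hne : Filter.NeBot (⨅ g, Filter.principal (S g)) := by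
    have : Nonempty T := ⟨⟨1, by simp⟩⟩
    refine Filter.iInf_neBot_of_directed ?_ fun g => Filter.principal_neBot_iff.2 ⟨g, dvd_refl _⟩
    intro g h
    refine ⟨⟨g.1 * h.1, by rw [map_mul]; exact mul_ne_zero g.2 h.2⟩,
      Filter.principal_mono.2 fun f hf => (dvd_mul_right _ _).trans hf,
      Filter.principal_mono.2 fun f hf => (dvd_mul_left _ _).trans hf⟩
  refine ⟨Ultrafilter.of (⨅ g, Filter.principal (S g)), fun g hg => ?_⟩
  exact (Ultrafilter.of_le _).trans (iInf_le _ (⟨g, hg⟩ : T)) (Filter.mem_principal_self _)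

theorem exists_polynomial_identifiable (hn : 5 ≤ n) (hr : 1 ≤ r) (hN : N = n * (n + 3) / 2)
    (hD : N * (m + 1 + N) ≤ (n + (r + 4) - 1).choose (r + 4)) :
    ∃ f : MvPolynomial (Mon n (r + 4)) ℂ,
      (∃ u : Fin m → Coord n → ℂ, eval (∑ i, phi r (u i)) f ≠ 0) ∧
      ∀ p : Mon n (r + 4) → ℂ, (∀ g : MvPolynomial (Mon n (r + 4)) ℂ,
        (∀ u : Fin m → Coord n → ℂ, eval (∑ i, phi r (u i)) g = 0) → eval p g = 0) →
      eval p f ≠ 0 →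
      (∃ u : Fin m → Coord n → ℂ, p = ∑ i, phi r (u i)) ∧
      ∀ x y : Fin m → Mon n (r + 4) → ℂ,
        (∀ i, x i ∈ zeroClosure (Set.range (phi r : (Coord n → ℂ) → _))) →
        (∀ i, y i ∈ zeroClosure (Set.range (phi r : (Coord n → ℂ) → _))) →
        p = ∑ i, x i → p = ∑ i, y i → ∃ e : Equiv.Perm (Fin m), ∀ i, y i = x (e i) := by
  by_contra! hcon
  obtain ⟨U, hU⟩ := exists_ultrafilter_dvd
    fun e => ∑ i : Fin m, phi r (par i : Coord n → ParField n m) e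
  have hT : ∀ f : {f : MvPolynomial (Mon n (r + 4)) ℂ //
      aeval (fun e => ∑ i : Fin m, phi r (par i : Coord n → ParField n m) e) f ≠ 0},
      ∃ u : Fin m → Coord n → ℂ, eval (∑ i, phi r (u i)) f.1 ≠ 0 := by
    intro f
    have := f.2
    rw [Ne, aeval_sum_phi_par_eq_zero_iff] at this
    push Not at this
    exact this
  choose p hp hpf hbad using fun f => hcon _ (hT f)
  have hpU : ∀ g : MvPolynomial (Mon n (r + 4)) ℂ, (∀ᶠ t in (U : Filter _), eval (p t) g = 0) ↔
      ∀ u : Fin m → Coord n → ℂ, eval (∑ i, phi r (u i)) g = 0 := by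
    refine fun g => ⟨fun h => ?_, fun h => Filter.Eventually.of_forall fun t => hp t g h⟩
    rw [← aeval_sum_phi_par_eq_zero_iff]
    by_contra hg
    obtain ⟨t, h0, c, hc⟩ := (h.and (hU g hg)).exists
    refine hpf t ?_
    rw [hc, map_mul, h0, zero_mul]
  have ht := tangentsIndependent_of_algebraicIndependent hn hN hD
    (algebraicIndependent_par (n := n) (m := m))
  have hbad' : ∀ t, ∃ x y : Fin m → Mon n (r + 4) → ℂ, (∃ u : Fin m → Coord n → ℂ,
      p t = ∑ i, phi r (u i)) →
      (∀ i, x i ∈ zeroClosure (Set.range (phi r : (Coord n → ℂ) → _))) ∧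
      (∀ i, y i ∈ zeroClosure (Set.range (phi r : (Coord n → ℂ) → _))) ∧
      p t = ∑ i, x i ∧ p t = ∑ i, y i ∧ ∀ e : Equiv.Perm (Fin m), ∃ i, y i ≠ x (e i) := by
    intro t
    by_cases h : ∃ u : Fin m → Coord n → ℂ, p t = ∑ i, phi r (u i)
    · obtain ⟨x, y, h⟩ := hbad t h
      exact ⟨x, y, fun _ => h⟩
    · exact ⟨0, 0, fun h' => absurd h' h⟩
  choose x y hxy using hbad'
  have hrep := eventually_exists_eq_sum_phi ht hpU
  have hperm := eventually_exists_perm (by omega : 0 < n)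
    (by rw [card_coord]; have : 6 ≤ n * (n + 3) := by nlinarith
        omega) ht
    (fun hv => ⟨tangentsIndependent_of_algebraicIndependent hn hN hD hv,
      contactTrivialAt_of_algebraicIndependent hn hr hN hD hv⟩) hpU
    (hrep.mono fun t h => (hxy t h).1) (hrep.mono fun t h => (hxy t h).2.1)
    (hrep.mono fun t h => (hxy t h).2.2.1) (hrep.mono fun t h => (hxy t h).2.2.2.1)
  obtain ⟨t, h1, π, hπ⟩ := (hrep.and hperm).exists
  obtain ⟨i, hi⟩ := (hxy t h1).2.2.2.2 π
  exact hi (hπ i)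

theorem isIdentifiableV_GMVariety (hn : 5 ≤ n) (hr : 1 ≤ r) (hN : N = n * (n + 3) / 2)
    (hD : N * (m + 1 + N) ≤ (n + (r + 4) - 1).choose (r + 4)) :
    IsIdentifiableV m (GMVariety n (r + 4)) := by
  obtain ⟨f, ⟨u₀, hf⟩, hgood⟩ := exists_polynomial_identifiable (m := m) hn hr hN hD
  refine isIdentifiableV_of_coordinates (formCoord n (r + 4)) mem_GMVariety_iff f
    (fun P hP x hx => ?_) fun p hp hpf => ?_
  · choose u hu using hx
    obtain rfl : (fun i => phi r (u i)) = x := funext hu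
    exact eval_sum_phi_eq_zero_of_mul hf (fun u => hP _ fun i => ⟨u i, rfl⟩) u
  · have hp' : ∀ g : MvPolynomial (Mon n (r + 4)) ℂ,
        (∀ u : Fin m → Coord n → ℂ, eval (∑ i, phi r (u i)) g = 0) → eval p g = 0 := by
      refine fun g hg => hp g ?_
      rintro _ ⟨x, hx, rfl⟩
      choose u hu using hx
      obtain rfl : (fun i => phi r (u i)) = x := funext hu
      exact hg u
    obtain ⟨⟨u, hu⟩, huniq⟩ := hgood p hp' hpf
    exact ⟨⟨_, fun i => subset_zeroClosure _ ⟨u i, rfl⟩, hu⟩, huniq⟩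

theorem five_le_of_bound {d : ℕ} (hn : 2 ≤ n) (hd5 : 5 ≤ d) (hd9 : d ≤ 9)
    (hN : N = n * (n + 3) / 2) (hm : 1 ≤ m)
    (hbound : N * (m + 1 + N) ≤ Nat.choose (n + d - 1) d) : 5 ≤ n := by
  by_contra! h
  have h2 : N * (2 + N) ≤ Nat.choose (n + d - 1) d :=
    (Nat.mul_le_mul_left N (by omega)).trans hbound
  subst hN
  interval_cases n <;> interval_cases d <;> revert h2 <;> decide

end Main

end GaussMoment

theorem stmt_15 (n d : ℕ) (hn : 2 ≤ n) (hd5 : 5 ≤ d) (hd9 : d ≤ 9)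
    (N : ℕ) (hN : N = n * (n + 3) / 2)
    (m : ℕ) (hm : 1 ≤ m)
    (hbound : N * (m + 1 + N) ≤ Nat.choose (n + d - 1) d) :
    IsIdentifiableV m (GMVariety n d) := by
  have hn5 := GaussMoment.five_le_of_bound hn hd5 hd9 hN hm hbound
  obtain ⟨r, rfl⟩ : ∃ r, d = r + 4 := ⟨d - 4, by omega⟩
  exact GaussMoment.isIdentifiableV_GMVariety hn5 (by omega) hN hbound
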